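/- Assume that every nontrivial zero of the Riemann zeta function and of the Dirichlet L-function L(s, χ₋₄) has real part 1/2, and that the set consisting of the nonnegative imaginary parts of all nontrivial zeros of ζ and of L(s, χ₋₄) is linearly independent over ℚ. Then the limit δ = lim_{X→∞} (1/log X) · ∫_{t ∈ [2,X], π(t;4,3) > π(t;4,1)} dt/t exists, and 1/2 < δ < 1. -/

import Mathlib

open Filter MeasureTheory

/-- `π(x; q, a)`: the number of primes `p ≤ x` with `p ≡ a (mod q)`. -/
noncomputable def primePiMod (x : ℝ) (q a : ℕ) : ℕ :=
  ((Finset.range (⌊x⌋₊ + 1)).filter fun p => p.Prime ∧ p % q = a).card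

/-- The nonprincipal Dirichlet character modulo `4`, with values in `ℂ`. -/
noncomputable def chiMinusFour : DirichletCharacter ℂ 4 :=
  ZMod.χ₄.ringHomComp (Int.castRingHom ℂ)

/-- The set of nonnegative imaginary parts of the nontrivial zeros of `ζ` and of
`L(s, χ₋₄)`. -/
def jointOrdinates : Set ℝ :=
  {t : ℝ | 0 ≤ t ∧ ∃ ρ : ℂ,
    (riemannZeta ρ = 0 ∨ DirichletCharacter.LFunction chiMinusFour ρ = 0) ∧
    0 < ρ.re ∧ ρ.re < 1 ∧ ρ.im = t}

open Metric
open scoped Topology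

section Plancherel

open scoped FourierTransform SchwartzMap ContDiff

/-- The `L²` Fourier transform of an integrable square-integrable function is given by the Fourier
integral. -/
theorem fourier_toLp_ae_eq {f : ℝ → ℂ} (hf : Integrable f) (hf2 : MemLp f 2) :
    (𝓕 (hf2.toLp f) : Lp (α := ℝ) ℂ 2 volume) =ᵐ[volume] 𝓕 f := by
  have hcont : Continuous (𝓕 f) :=
    VectorFourier.fourierIntegral_continuous Real.continuous_fourierChar (by fun_prop) hf
  refine ae_eq_of_integral_contDiff_smul_eq ((Lp.memLp _).locallyIntegrable (by norm_num))
    hcont.locallyIntegrable fun g hg hgs => ?_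
  have hgc : HasCompactSupport (fun x => (g x : ℂ)) := hgs.comp_left (g := fun r : ℝ => (r : ℂ)) rfl
  have hgd : ContDiff ℝ ∞ (fun x => (g x : ℂ)) := Complex.ofRealCLM.contDiff.comp hg
  let φ : 𝓢(ℝ, ℂ) := hgc.toSchwartzMap hgd
  have hφ : ∀ x, φ x = (g x : ℂ) := fun x => rfl
  have h1 := congrArg (fun T => T φ) (Lp.fourier_toTemperedDistribution_eq (hf2.toLp f))
  simp only [TemperedDistribution.fourier_apply,
    Lp.toTemperedDistribution_apply (μ := volume)] at h1
  have h2 : ∫ x, g x • ((𝓕 (hf2.toLp f) : Lp (α := ℝ) ℂ 2 volume) : ℝ → ℂ) x =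
      ∫ x, (𝓕 φ) x • (hf2.toLp f : ℝ → ℂ) x := by
    rw [h1]; rfl
  rw [h2]
  have h3 : ∫ x, (𝓕 φ) x • (hf2.toLp f : ℝ → ℂ) x = ∫ x, (𝓕 φ) x • f x :=
    integral_congr_ae (by filter_upwards [hf2.coeFn_toLp] with x hx; rw [hx])
  rw [h3]
  have h4 := VectorFourier.integral_fourierIntegral_smul_eq_flip (L := innerₗ ℝ)
    Real.continuous_fourierChar (by fun_prop) (φ.integrable (μ := volume)) hf
  rw [flip_innerₗ] at h4
  exact h4.trans rfl

/-- **Plancherel's theorem** for functions in `L¹ ∩ L²`. -/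
theorem lintegral_enorm_fourier_sq {f : ℝ → ℂ} (hf : Integrable f) (hf2 : MemLp f 2) :
    ∫⁻ x, ‖𝓕 f x‖ₑ ^ 2 = ∫⁻ x, ‖f x‖ₑ ^ 2 := by
  have h := Lp.norm_fourier_eq (hf2.toLp f)
  have key : ∀ F : Lp (α := ℝ) ℂ 2, ∫⁻ x, ‖(F : ℝ → ℂ) x‖ₑ ^ 2 = ENNReal.ofReal (‖F‖ ^ 2) := by
    intro F
    rw [Lp.norm_def, ← ENNReal.toReal_pow,
      ENNReal.ofReal_toReal (by finiteness [Lp.eLpNorm_ne_top F])]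
    rw [eLpNorm_eq_lintegral_rpow_enorm_toReal (by norm_num) (by norm_num)]
    rw [← ENNReal.rpow_natCast, ← ENNReal.rpow_mul]
    simp
  have e1 : ∫⁻ x, ‖𝓕 f x‖ₑ ^ 2 =
      ∫⁻ x, ‖((𝓕 (hf2.toLp f) : Lp (α := ℝ) ℂ 2 volume) : ℝ → ℂ) x‖ₑ ^ 2 :=
    lintegral_congr_ae (by filter_upwards [fourier_toLp_ae_eq hf hf2] with x hx; rw [hx])
  have e2 : ∫⁻ x, ‖f x‖ₑ ^ 2 = ∫⁻ x, ‖(hf2.toLp f : ℝ → ℂ) x‖ₑ ^ 2 :=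
    lintegral_congr_ae (by filter_upwards [hf2.coeFn_toLp] with x hx; rw [hx])
  rw [e1, e2, key, key, h]

end Plancherel

section FourierTransform

open scoped FourierTransform

/-- An integral depending holomorphically on a parameter, with locally uniform integrable bounds, is
holomorphic. -/
theorem differentiableOn_integral_of_locally_dominated {D : Set ℂ} {F : ℂ → ℝ → ℂ}
    (hF : ∀ t, DifferentiableOn ℂ (F · t) D)
    (hmeas : ∀ w ∈ D, AEStronglyMeasurable (F w))
    (hb : ∀ w₀ ∈ D, ∃ ε > 0, Metric.closedBall w₀ ε ⊆ D ∧ ∃ B : ℝ → ℝ, Integrable B ∧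
      ∀ w ∈ Metric.closedBall w₀ ε, ∀ t, ‖F w t‖ ≤ B t) :
    DifferentiableOn ℂ (fun w => ∫ t, F w t) D := by
  intro w₀ hw₀
  obtain ⟨ε, hε, hsub, B, hB, hFB⟩ := hb w₀ hw₀
  have hnear : ∀ w ∈ Metric.ball w₀ (ε / 2), Metric.closedBall w (ε / 2) ⊆ Metric.closedBall w₀ ε :=
    fun w hw => Metric.closedBall_subset_closedBall' (by rw [Metric.mem_ball] at hw; linarith)
  have hdiff : ∀ w ∈ Metric.ball w₀ (ε / 2), ∀ t, HasDerivAt (F · t) (deriv (F · t) w) w := by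
    intro w hw t
    refine ((hF t).differentiableAt ?_).hasDerivAt
    exact mem_of_superset (Metric.closedBall_mem_nhds w (half_pos hε)) ((hnear w hw).trans hsub)
  have hw₀b : w₀ ∈ Metric.ball w₀ (ε / 2) := Metric.mem_ball_self (half_pos hε)
  have key := hasDerivAt_integral_of_dominated_loc_of_deriv_le (𝕜 := ℂ) (μ := volume) (F := F)
    (x₀ := w₀) (s := Metric.ball w₀ (ε / 2)) (bound := fun t => B t / (ε / 2))
    (F' := fun w t => deriv (F · t) w) (Metric.ball_mem_nhds _ (half_pos hε)) ?_ ?_ ?_ ?_ ?_ ?_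
  · exact key.2.differentiableAt.differentiableWithinAt
  · filter_upwards [Metric.ball_mem_nhds w₀ hε] with w hw
    exact hmeas w (hsub (Metric.ball_subset_closedBall hw))
  · exact hB.mono' (hmeas w₀ hw₀)
      (Eventually.of_forall fun t => hFB w₀ (Metric.mem_closedBall_self hε.le) t)
  · have hlim : Tendsto (fun n : ℕ => w₀ + ((ε / 2 / ((n : ℝ) + 2) : ℝ) : ℂ)) atTop (𝓝[≠] w₀) := by
      refine tendsto_nhdsWithin_iff.2 ⟨?_, Eventually.of_forall fun n => ?_⟩
      · have : Tendsto (fun n : ℕ => ε / 2 / ((n : ℝ) + 2)) atTop (𝓝 0) :=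
          tendsto_const_nhds.div_atTop
            (tendsto_atTop_add_const_right _ _ tendsto_natCast_atTop_atTop)
        have h2 := ((Complex.continuous_ofReal.tendsto 0).comp this).const_add w₀
        simpa using h2
      · simp only [Set.mem_compl_iff, Set.mem_singleton_iff, add_eq_left, Complex.ofReal_eq_zero]
        positivity
    refine aestronglyMeasurable_of_tendsto_ae (u := atTop)
      (f := fun (n : ℕ) t => slope (F · t) w₀ (w₀ + ((ε / 2 / ((n : ℝ) + 2) : ℝ) : ℂ)))
      (fun n => ?_) ?_
    · simp only [slope, vsub_eq_sub, smul_eq_mul]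
      refine ((hmeas _ (hsub ?_)).sub (hmeas w₀ hw₀)).const_mul _
      have : ε / 2 / ((n : ℝ) + 2) ≤ ε / 2 :=
        div_le_self (by positivity) (by linarith [n.cast_nonneg (α := ℝ)])
      rw [Metric.mem_closedBall, dist_self_add_left, Complex.norm_real, Real.norm_eq_abs,
        abs_of_nonneg (by positivity)]
      linarith
    · exact Eventually.of_forall fun t =>
        ((hasDerivAt_iff_tendsto_slope.1 (hdiff w₀ hw₀b t)).comp hlim)
  · refine Eventually.of_forall fun t w hw => ?_
    refine Complex.norm_deriv_le_of_forall_mem_sphere_norm_le (half_pos hε) ?_ ?_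
    · refine DifferentiableOn.diffContOnCl ((hF t).mono ?_)
      rw [closure_ball _ (half_pos hε).ne']
      exact (hnear w hw).trans hsub
    · exact fun z hz => hFB z (hnear w hw (Metric.sphere_subset_closedBall hz)) t
  · exact hB.div_const _
  · exact Eventually.of_forall fun t w hw => hdiff w hw t

/-- The (one-sided) Laplace transform. -/
noncomputable def laplaceTransform (g : ℝ → ℂ) (s : ℂ) : ℂ :=
  ∫ u in Set.Ioi (0 : ℝ), g u * Complex.exp (-s * u)

theorem lintegral_comp_mul_pos (F : ℝ → ENNReal) {a : ℝ} (ha : 0 < a) :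
    ∫⁻ x, F x = ENNReal.ofReal a * ∫⁻ x, F (a * x) := by
  have h := Real.smul_map_volume_mul_left ha.ne'
  have he : MeasurableEmbedding (fun x : ℝ => a * x) := measurableEmbedding_mulLeft₀ ha.ne'
  conv_lhs => rw [← h]
  rw [lintegral_smul_measure, he.lintegral_map, abs_of_pos ha, smul_eq_mul]

theorem integrableOn_norm_sq_mul_exp {g : ℝ → ℂ} (hg : Measurable g) {C b : ℝ}
    (hC : ∀ u > 0, ‖g u‖ ≤ C * Real.exp (b * u)) {σ : ℝ} (hσ : b < σ) :
    IntegrableOn (fun u => g u * Complex.exp (-σ * u)) (Set.Ioi 0) ∧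
    IntegrableOn (fun u => ‖g u‖ ^ 2 * Real.exp (-2 * σ * u)) (Set.Ioi 0) := by
  constructor
  · refine Integrable.mono' (g := fun u => C * Real.exp (-(σ - b) * u))
      ((exp_neg_integrableOn_Ioi 0 (sub_pos.2 hσ)).const_mul C) (by fun_prop) ?_
    refine (ae_restrict_iff' measurableSet_Ioi).2 (Eventually.of_forall fun u hu => ?_)
    rw [norm_mul, Complex.norm_exp]
    calc ‖g u‖ * _ ≤ C * Real.exp (b * u) * Real.exp (-σ * u) := by
          have : (-(σ : ℂ) * u).re = -σ * u := by simp
          rw [this]; gcongr; exact hC u hu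
      _ = _ := by rw [mul_assoc, ← Real.exp_add]; ring_nf
  · refine Integrable.mono' (g := fun u => C ^ 2 * Real.exp (-(2 * (σ - b)) * u))
      ((exp_neg_integrableOn_Ioi 0 (by linarith)).const_mul _) (by fun_prop) ?_
    refine (ae_restrict_iff' measurableSet_Ioi).2 (Eventually.of_forall fun u hu => ?_)
    rw [norm_mul, norm_pow, norm_norm, Real.norm_eq_abs, Real.abs_exp]
    calc ‖g u‖ ^ 2 * _ ≤ (C * Real.exp (b * u)) ^ 2 * Real.exp (-2 * σ * u) := by
          gcongr; exact hC u hu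
      _ = _ := by rw [mul_pow, mul_assoc, ← Real.exp_nat_mul, ← Real.exp_add]; push_cast; ring_nf

theorem lintegral_laplaceTransform_sq {g : ℝ → ℂ} (hg : Measurable g) {C b : ℝ}
    (hC : ∀ u > 0, ‖g u‖ ≤ C * Real.exp (b * u)) {σ : ℝ} (hσ : b < σ) :
    ∫⁻ t : ℝ, ‖laplaceTransform g (σ + t * Complex.I)‖ₑ ^ 2 =
      ENNReal.ofReal (2 * Real.pi) *
        ∫⁻ u in Set.Ioi (0 : ℝ), ENNReal.ofReal (‖g u‖ ^ 2 * Real.exp (-2 * σ * u)) := by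
  obtain ⟨h1, h2⟩ := integrableOn_norm_sq_mul_exp hg hC hσ
  set F : ℝ → ℂ := (Set.Ioi (0 : ℝ)).indicator fun u => g u * Complex.exp (-σ * u) with hF
  have hFi : Integrable F := h1.integrable_indicator measurableSet_Ioi
  have hsq : ∀ u, ‖F u‖ ^ 2 = (Set.Ioi (0 : ℝ)).indicator
      (fun u => ‖g u‖ ^ 2 * Real.exp (-2 * σ * u)) u := by
    intro u
    by_cases hu : u ∈ Set.Ioi (0 : ℝ)
    · have : (-(σ : ℂ) * u).re = -σ * u := by simp
      rw [hF, Set.indicator_of_mem hu, Set.indicator_of_mem hu, norm_mul, Complex.norm_exp, mul_pow,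
        ← Real.exp_nat_mul, this]
      push_cast; ring_nf
    · simp [hF, Set.indicator_of_notMem hu]
  have hFm : MemLp F 2 := by
    refine (memLp_two_iff_integrable_sq_norm hFi.1).2 ?_
    simp_rw [hsq]
    exact h2.integrable_indicator measurableSet_Ioi
  rw [lintegral_comp_mul_pos _ Real.two_pi_pos]
  congr 1
  have hfour : ∀ x : ℝ,
      laplaceTransform g (σ + ((2 * Real.pi * x : ℝ) : ℂ) * Complex.I) = 𝓕 F x := by
    intro x
    rw [Real.fourier_real_eq_integral_exp_smul, laplaceTransform,
      ← integral_indicator measurableSet_Ioi]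
    congr 1 with u
    by_cases hu : u ∈ Set.Ioi (0 : ℝ)
    · rw [hF, Set.indicator_of_mem hu, Set.indicator_of_mem hu, smul_eq_mul, mul_left_comm,
        ← Complex.exp_add]
      congr 2; push_cast; ring
    · simp [hF, Set.indicator_of_notMem hu]
  simp_rw [hfour]
  rw [lintegral_enorm_fourier_sq hFi hFm, ← lintegral_indicator measurableSet_Ioi]
  congr 1 with u
  rw [← ofReal_norm, ← ENNReal.ofReal_pow (norm_nonneg _), hsq]
  by_cases hu : u ∈ Set.Ioi (0 : ℝ)
  · rw [Set.indicator_of_mem hu, Set.indicator_of_mem hu]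
  · simp [Set.indicator_of_notMem hu]

end FourierTransform

section MeanSquareTransfer

open ProbabilityTheory
open scoped FourierTransform

/-- If the moment generating function of a measure on `[0, ∞)` extends holomorphically to a disc,
then the exponential moments are finite in that disc and given by the extension. -/
theorem lintegral_exp_of_mgf_extension {μ : Measure ℝ} (hpos : ∀ᵐ u ∂μ, 0 ≤ u)
    (hintg : (0 : ℝ) ∈ interior (integrableExpSet id μ)) {K : ℂ → ℂ} {r : ℝ}
    (hK : DifferentiableOn ℂ K (Metric.ball 0 r))
    (hKm : ∀ᶠ x : ℝ in 𝓝 0, K x = mgf id μ x) {x : ℝ} (hx0 : 0 ≤ x) (hxr : x < r) :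
    ∫⁻ u, ENNReal.ofReal (Real.exp (x * u)) ∂μ = ENNReal.ofReal (K x).re := by
  have hr : 0 < r := hx0.trans_lt hxr
  have hKa : AnalyticAt ℂ K 0 := hK.analyticAt (Metric.ball_mem_nhds 0 hr)
  have hMa : AnalyticAt ℂ (complexMGF id μ) 0 := analyticAt_complexMGF (by simpa using hintg)
  have hev : K =ᶠ[𝓝 0] complexMGF id μ := by
    refine (hKa.frequently_eq_iff_eventually_eq hMa).1 ?_
    have hlim : Tendsto (fun x : ℝ => (x : ℂ)) (𝓝[≠] 0) (𝓝[≠] 0) := by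
      refine tendsto_nhdsWithin_iff.2 ⟨?_, ?_⟩
      · exact (Complex.continuous_ofReal.tendsto' 0 0 (by simp)).mono_left nhdsWithin_le_nhds
      · filter_upwards [self_mem_nhdsWithin] with x hx
        simpa using hx
    refine hlim.frequently (Eventually.frequently ?_)
    filter_upwards [hKm.filter_mono nhdsWithin_le_nhds] with x hx
    rw [hx, complexMGF_ofReal]
  have hder : ∀ n, iteratedDeriv n K 0 = ((∫ u, u ^ n ∂μ : ℝ) : ℂ) := by
    intro n
    rw [hev.iteratedDeriv_eq n, iteratedDeriv_complexMGF (by simpa using hintg),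
      ← integral_complex_ofReal]
    simp
  have hsum := Complex.hasSum_taylorSeries_on_ball (f := K) (c := 0) (r := r) hK (z := (x : ℂ))
    (by simpa [abs_of_nonneg hx0] using hxr)
  simp_rw [hder] at hsum
  have hsumr : HasSum (fun n : ℕ => x ^ n / n.factorial * ∫ u, u ^ n ∂μ) (K x).re := by
    have h := Complex.hasSum_re hsum
    convert h using 2 with n
    rw [sub_zero, smul_eq_mul, smul_eq_mul, ← Complex.ofReal_natCast, ← Complex.ofReal_inv,
      ← Complex.ofReal_pow,
      ← Complex.ofReal_mul, ← Complex.ofReal_mul, Complex.ofReal_re]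
    ring
  have hterm : ∀ n : ℕ, ∫⁻ u, ENNReal.ofReal (x ^ n / n.factorial * u ^ n) ∂μ =
      ENNReal.ofReal (x ^ n / n.factorial * ∫ u, u ^ n ∂μ) := by
    intro n
    rw [← integral_const_mul]
    refine (ofReal_integral_eq_lintegral_ofReal ?_ ?_).symm
    · exact (integrable_pow_of_mem_interior_integrableExpSet hintg n).const_mul _
    · filter_upwards [hpos] with u hu
      positivity
  have hnn : ∀ n : ℕ, 0 ≤ x ^ n / n.factorial * ∫ u, u ^ n ∂μ := by
    intro n
    have : 0 ≤ ∫ u, u ^ n ∂μ :=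
      integral_nonneg_of_ae (by filter_upwards [hpos] with u hu; positivity)
    positivity
  have hexp : ∀ᵐ u ∂μ, ENNReal.ofReal (Real.exp (x * u)) =
      ∑' n : ℕ, ENNReal.ofReal (x ^ n / n.factorial * u ^ n) := by
    filter_upwards [hpos] with u hu
    have h := NormedSpace.expSeries_div_hasSum_exp (x * u)
    rw [← Real.exp_eq_exp_ℝ] at h
    rw [← h.tsum_eq, ENNReal.ofReal_tsum_of_nonneg (fun n => by positivity) h.summable]
    congr 1 with n
    rw [mul_pow]; ring_nf
  rw [lintegral_congr_ae hexp, lintegral_tsum (fun n => by fun_prop)]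
  simp_rw [hterm]
  rw [← ENNReal.ofReal_tsum_of_nonneg hnn hsumr.summable, hsumr.tsum_eq]

theorem one_add_abs_rpow_neg_le (t y p : ℝ) (hp : 0 ≤ p) :
    (1 + |t + y|) ^ (-p) ≤ (1 + |y|) ^ p * (1 + |t|) ^ (-p) := by
  have h1 : 1 + |t| ≤ (1 + |t + y|) * (1 + |y|) := by
    have : |t| ≤ |t + y| + |y| := by simpa using abs_sub (t + y) y
    nlinarith [mul_nonneg (abs_nonneg (t + y)) (abs_nonneg y)]
  rw [Real.rpow_neg (by positivity), Real.rpow_neg (by positivity), ← div_eq_mul_inv,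
    inv_le_iff_one_le_mul₀ (by positivity), div_mul_eq_mul_div, one_le_div (by positivity),
    ← Real.mul_rpow (by positivity) (by positivity), mul_comm (1 + |y|)]
  exact Real.rpow_le_rpow (by positivity) h1 hp

/-- Plancherel's formula for Laplace transforms, beyond the half-plane of absolute convergence: if
the transform extends holomorphically to a larger half-plane, with enough decay, then the formula
persists. -/
theorem lintegral_laplaceTransform_extension {g : ℝ → ℂ} (hg : Measurable g) {C b : ℝ}
    (hC : ∀ u > 0, ‖g u‖ ≤ C * Real.exp (b * u)) {a : ℝ} {G : ℂ → ℂ}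
    (hG : DifferentiableOn ℂ G {s | a < s.re})
    (hGg : ∀ s : ℂ, b < s.re → G s = laplaceTransform g s)
    (hGb : ∀ σ₀ > a, ∃ C : ℝ, ∀ s : ℂ, σ₀ ≤ s.re → ‖G s‖ ≤ C * (1 + |s.im|) ^ (-(3 / 4) : ℝ))
    {σ : ℝ} (hσ : a < σ) :
    ENNReal.ofReal (2 * Real.pi) *
        ∫⁻ u in Set.Ioi (0 : ℝ), ENNReal.ofReal (‖g u‖ ^ 2 * Real.exp (-2 * σ * u)) =
      ∫⁻ t : ℝ, ‖G (σ + t * Complex.I)‖ₑ ^ 2 := by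
  have hplan : ∀ σ : ℝ, b < σ → ENNReal.ofReal (2 * Real.pi) *
        ∫⁻ u in Set.Ioi (0 : ℝ), ENNReal.ofReal (‖g u‖ ^ 2 * Real.exp (-2 * σ * u)) =
      ∫⁻ t : ℝ, ‖G (σ + t * Complex.I)‖ₑ ^ 2 := by
    intro σ hσb
    rw [← lintegral_laplaceTransform_sq hg hC hσb]
    congr 1 with t
    rw [hGg _ (by simpa using hσb)]
  rcases lt_or_ge b σ with hσb | hσb
  · exact hplan σ hσb
  set D : Set ℂ := {s | a < s.re} with hD
  have hDo : IsOpen D := isOpen_lt continuous_const Complex.continuous_re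
  set F : ℂ → ℝ → ℂ := fun w t =>
    G (w + t * Complex.I) * (starRingEnd ℂ) (G ((starRingEnd ℂ) w + t * Complex.I)) with hF
  have hmem : ∀ w ∈ D, ∀ t : ℝ, w + t * Complex.I ∈ D := fun w hw t => by simpa [hD] using hw
  have hmemc : ∀ w ∈ D, (starRingEnd ℂ) w ∈ D := fun w hw => by simpa [hD] using hw
  have hFb : ∀ w₀ ∈ D, ∃ ε > 0, Metric.closedBall w₀ ε ⊆ D ∧ ∃ B : ℝ → ℝ, Integrable B ∧
      ∀ w ∈ Metric.closedBall w₀ ε, ∀ t, ‖F w t‖ ≤ B t := by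
    intro w₀ hw₀
    have hw₀' : a < w₀.re := hw₀
    obtain ⟨C₁, hC₁⟩ := hGb ((w₀.re + a) / 2) (by linarith)
    have hre : ∀ w ∈ Metric.closedBall w₀ ((w₀.re - a) / 2), (w₀.re + a) / 2 ≤ w.re := by
      intro w hw
      have h1 := (Complex.abs_re_le_norm (w - w₀)).trans (mem_closedBall_iff_norm.1 hw)
      rw [Complex.sub_re, abs_le] at h1
      linarith
    set Y := |w₀.im| + (w₀.re - a) / 2 with hY
    have hYn : 0 ≤ Y := by have := abs_nonneg w₀.im; rw [hY]; linarith
    have hC₁n : 0 ≤ C₁ := by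
      have := (norm_nonneg _).trans (hC₁ w₀ (by linarith))
      exact nonneg_of_mul_nonneg_left this (by positivity)
    refine ⟨(w₀.re - a) / 2, by linarith, fun w hw => ?_,
      fun t => C₁ ^ 2 * (1 + Y) ^ (3 / 2 : ℝ) * (1 + ‖t‖) ^ (-(3 / 2) : ℝ), ?_, ?_⟩
    · have := hre w hw
      simp only [hD, Set.mem_ofPred_eq]; linarith
    · exact (integrable_one_add_norm (by norm_num)).const_mul _
    · intro w hw t
      have him : |w.im| ≤ Y := by
        have h1 := (Complex.abs_im_le_norm (w - w₀)).trans (mem_closedBall_iff_norm.1 hw)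
        have : |w.im| ≤ |w₀.im| + |w.im - w₀.im| := by
          simpa using abs_add_le w₀.im (w.im - w₀.im)
        rw [Complex.sub_im] at h1
        linarith
      have hone : ∀ y : ℝ, |y| ≤ Y → C₁ * (1 + |t + y|) ^ (-(3 / 4) : ℝ) ≤
          C₁ * ((1 + Y) ^ (3 / 4 : ℝ) * (1 + |t|) ^ (-(3 / 4) : ℝ)) := by
        intro y hy
        refine mul_le_mul_of_nonneg_left
          ((one_add_abs_rpow_neg_le t y (3 / 4) (by norm_num)).trans ?_) hC₁n
        gcongr
      have e1 := (hC₁ (w + t * Complex.I) (by simpa using hre w hw)).trans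
        (by simpa [add_comm] using hone w.im him)
      have e2 := (hC₁ ((starRingEnd ℂ) w + t * Complex.I) (by simpa using hre w hw)).trans
        (by simpa [add_comm] using hone (-w.im) (by simpa using him))
      simp only [hF, norm_mul, RCLike.norm_conj]
      refine (mul_le_mul e1 e2 (norm_nonneg _) (by positivity)).trans (le_of_eq ?_)
      rw [Real.norm_eq_abs, show (3 / 2 : ℝ) = 3 / 4 + 3 / 4 by norm_num, neg_add,
        Real.rpow_add (by positivity), Real.rpow_add (by positivity)]
      ring
  have hFmeas : ∀ w ∈ D, AEStronglyMeasurable (F w) := by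
    intro w hw
    have hc : ∀ w ∈ D, Continuous fun t : ℝ => G (w + t * Complex.I) := fun w hw =>
      hG.continuousOn.comp_continuous (by fun_prop) (hmem w hw)
    exact ((hc w hw).mul (Complex.continuous_conj.comp (hc _ (hmemc w hw)))).aestronglyMeasurable
  have hFdiff : ∀ t, DifferentiableOn ℂ (F · t) D := by
    intro t w hw
    refine DifferentiableAt.differentiableWithinAt (DifferentiableAt.mul ?_ ?_)
    · have := hG.differentiableAt (hDo.mem_nhds (hmem w hw t))
      exact this.comp w (by fun_prop : DifferentiableAt ℂ (fun w : ℂ => w + t * Complex.I) w)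
    · have h1 : DifferentiableAt ℂ (fun z => G (z + t * Complex.I)) ((starRingEnd ℂ) w) := by
        have := hG.differentiableAt (hDo.mem_nhds (hmem _ (hmemc w hw) t))
        exact this.comp ((starRingEnd ℂ) w)
          (by fun_prop : DifferentiableAt ℂ (fun w : ℂ => w + t * Complex.I) ((starRingEnd ℂ) w))
      have h2 := h1.conj_conj
      simpa [Function.comp_def] using h2
  have hJ := differentiableOn_integral_of_locally_dominated hFdiff hFmeas hFb
  set J : ℂ → ℂ := fun w => ∫ t, F w t with hJdef
  have hFint : ∀ w ∈ D, Integrable (F w) := by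
    intro w hw
    obtain ⟨ε, hε, -, B, hB, hFB⟩ := hFb w hw
    exact hB.mono' (hFmeas w hw) (Eventually.of_forall (hFB w (Metric.mem_closedBall_self hε.le)))
  have hFreal : ∀ σ : ℝ, ∀ t, F σ t = ((‖G (σ + t * Complex.I)‖ ^ 2 : ℝ) : ℂ) := by
    intro σ t
    simp only [hF, Complex.conj_ofReal, Complex.mul_conj, Complex.normSq_eq_norm_sq]
  have hJreal : ∀ σ : ℝ, a < σ → J σ = ((∫ t : ℝ, ‖G (σ + t * Complex.I)‖ ^ 2 : ℝ) : ℂ) := by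
    intro σ hσ
    simp only [hJdef, hFreal]
    exact integral_complex_ofReal
  have hJlin : ∀ σ : ℝ, a < σ →
      ∫⁻ t : ℝ, ‖G (σ + t * Complex.I)‖ₑ ^ 2 = ENNReal.ofReal (J σ).re := by
    intro σ hσ
    have hi : Integrable fun t : ℝ => ‖G (σ + t * Complex.I)‖ ^ 2 := by
      have := (hFint σ (by simpa [hD] using hσ)).re
      simpa [hFreal, ← Complex.ofReal_pow] using this
    rw [hJreal σ hσ, Complex.ofReal_re, ofReal_integral_eq_lintegral_ofReal hi
      (Eventually.of_forall fun t => by positivity)]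
    congr 1 with t
    rw [ENNReal.ofReal_pow (norm_nonneg _), ofReal_norm]
  set w₀ : ℝ := b + 1 with hw₀
  set μ : Measure ℝ := (volume.restrict (Set.Ioi 0)).withDensity
    (fun u => ENNReal.ofReal (‖g u‖ ^ 2 * Real.exp (-2 * w₀ * u))) with hμ
  have hdm : Measurable fun u => ENNReal.ofReal (‖g u‖ ^ 2 * Real.exp (-2 * w₀ * u)) := by fun_prop
  have hlin : ∀ x : ℝ, ∫⁻ u, ENNReal.ofReal (Real.exp (x * u)) ∂μ =
      ∫⁻ u in Set.Ioi (0 : ℝ), ENNReal.ofReal (‖g u‖ ^ 2 * Real.exp (-2 * (w₀ - x / 2) * u)) := by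
    intro x
    rw [hμ, lintegral_withDensity_eq_lintegral_mul _ hdm (by fun_prop)]
    congr 1 with u
    rw [Pi.mul_apply, ← ENNReal.ofReal_mul (by positivity), mul_assoc, ← Real.exp_add]
    ring_nf
  have h2pi : ENNReal.ofReal (2 * Real.pi) ≠ 0 := by simp [Real.pi_pos]
  have hlinJ : ∀ x : ℝ, x < 2 → ∫⁻ u, ENNReal.ofReal (Real.exp (x * u)) ∂μ =
      ENNReal.ofReal ((J (w₀ - x / 2)).re / (2 * Real.pi)) := by
    intro x hx
    have h1 := hplan (w₀ - x / 2) (by rw [hw₀]; linarith)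
    rw [hJlin _ (by rw [hw₀]; linarith)] at h1
    rw [hlin, ENNReal.ofReal_div_of_pos Real.two_pi_pos]
    push_cast at h1
    rw [← h1, mul_comm (ENNReal.ofReal (2 * Real.pi)),
      ENNReal.mul_div_cancel_right h2pi ENNReal.ofReal_ne_top]
  have hmu_int : ∀ x : ℝ, x < 2 → Integrable (fun u => Real.exp (x * u)) μ := by
    intro x hx
    refine ⟨by fun_prop, ?_⟩
    rw [hasFiniteIntegral_iff_ofReal (Eventually.of_forall fun u => (Real.exp_pos _).le),
      hlinJ x hx]
    exact ENNReal.ofReal_lt_top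
  have hJre : ∀ σ : ℝ, a < σ → 0 ≤ (J σ).re := by
    intro σ hσ
    rw [hJreal σ hσ, Complex.ofReal_re]
    exact integral_nonneg fun t => by positivity
  have key := lintegral_exp_of_mgf_extension (μ := μ) (r := 2 * (w₀ - a))
    (K := fun z => J (w₀ - z / 2) / (2 * Real.pi)) ?_ ?_ ?_ ?_ (x := 2 * (w₀ - σ)) ?_ ?_
  · rw [hlin] at key
    have e : w₀ - 2 * (w₀ - σ) / 2 = σ := by ring
    have e' : ((w₀ : ℂ) - ((2 * (w₀ - σ) : ℝ) : ℂ) / 2) = σ := by push_cast; ring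
    rw [e] at key
    simp only [e'] at key
    rw [key, hJlin σ hσ, ← ENNReal.ofReal_mul (by positivity), hJreal σ hσ]
    congr 1
    rw [← Complex.ofReal_ofNat, ← Complex.ofReal_mul, ← Complex.ofReal_div, Complex.ofReal_re,
      Complex.ofReal_re, mul_div_cancel₀ _ Real.two_pi_pos.ne']
  · refine withDensity_absolutelyContinuous _ _ ?_
    exact (ae_restrict_iff' measurableSet_Ioi).2 (Eventually.of_forall fun u hu => le_of_lt hu)
  · refine mem_interior_iff_mem_nhds.2
      (mem_of_superset (Iio_mem_nhds (by norm_num : (0 : ℝ) < 2)) ?_)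
    intro x hx
    simpa [integrableExpSet] using hmu_int x hx
  · refine DifferentiableOn.div_const (hJ.comp (by fun_prop) ?_) _
    intro z hz
    have h1 := (Complex.re_le_norm z).trans_lt (mem_ball_zero_iff.1 hz)
    simp only [hD, Set.mem_ofPred_eq, Complex.sub_re, Complex.ofReal_re]
    have : (z / 2).re = z.re / 2 := by simp
    rw [this]; linarith
  · filter_upwards [Iio_mem_nhds (by norm_num : (0 : ℝ) < 2)] with x hx
    have hx2 : x < 2 := hx
    have ha' : a < w₀ - x / 2 := by rw [hw₀]; linarith
    have hm : mgf id μ x = (J (w₀ - x / 2)).re / (2 * Real.pi) := by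
      have h1 := hlinJ x hx2
      have h3 : 0 ≤ (J (w₀ - x / 2)).re := by simpa using hJre _ ha'
      rw [mgf, integral_eq_lintegral_of_nonneg_ae
        (Eventually.of_forall fun u => (Real.exp_pos _).le)
        (by fun_prop)]
      simp only [id]
      rw [h1, ENNReal.toReal_ofReal (by positivity)]
    rw [hm]
    have h2 := hJreal _ ha'
    push_cast at h2
    rw [h2]
    simp
  · rw [hw₀]; linarith
  · linarith

end MeanSquareTransfer

theorem Differentiable.analyticOrderAt_ne_top {f : ℂ → ℂ} (hf : Differentiable ℂ f) {c : ℂ}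
    (hc : f c ≠ 0) (z : ℂ) : analyticOrderAt f z ≠ ⊤ := by
  intro h
  rw [analyticOrderAt_eq_top] at h
  have han : AnalyticOnNhd ℂ f Set.univ := fun w _ => hf.analyticAt w
  exact hc (han.eqOn_zero_of_preconnected_of_eventuallyEq_zero isPreconnected_univ
    (Set.mem_univ z) h (Set.mem_univ c))

theorem Differentiable.finite_zeros {f : ℂ → ℂ} (hf : Differentiable ℂ f) {c : ℂ}
    (hc : f c ≠ 0) {K : Set ℂ} (hK : IsCompact K) : {z | z ∈ K ∧ f z = 0}.Finite := by
  by_contra hinf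
  obtain ⟨z, -, hz⟩ := Set.Infinite.exists_accPt_of_subset_isCompact hinf hK (fun z hz => hz.1)
  have han : AnalyticOnNhd ℂ f Set.univ := fun w _ => hf.analyticAt w
  refine hc (han.eqOn_zero_of_preconnected_of_frequently_eq_zero isPreconnected_univ
    (Set.mem_univ z) ?_ (Set.mem_univ c))
  exact (accPt_iff_frequently_nhdsNE.1 hz).mono fun w hw => hw.2

/-- Dividing an entire function by the full power of a linear factor. -/
theorem Differentiable.exists_eq_pow_mul {f : ℂ → ℂ} (hf : Differentiable ℂ f) {ρ : ℂ}
    (hρ : analyticOrderAt f ρ ≠ ⊤) :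
    ∃ h : ℂ → ℂ, Differentiable ℂ h ∧ h ρ ≠ 0 ∧
      ∀ z, f z = (z - ρ) ^ analyticOrderNatAt f ρ * h z := by
  obtain ⟨g, hg, hg0, hfg⟩ := ((hf.analyticAt ρ).analyticOrderAt_ne_top).1 hρ
  set m := analyticOrderNatAt f ρ with hm
  classical
  set h : ℂ → ℂ := fun z => if z = ρ then g ρ else f z / (z - ρ) ^ m with hh
  have hhg : h =ᶠ[𝓝 ρ] g := by
    filter_upwards [hfg] with z hz
    by_cases hzρ : z = ρ
    · simp [hh, hzρ]
    · have : (z - ρ) ^ m ≠ 0 := pow_ne_zero _ (sub_ne_zero.2 hzρ)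
      simp only [hh, if_neg hzρ, hz, smul_eq_mul]
      field_simp
  refine ⟨h, fun z => ?_, by simpa [hh] using hg0, fun z => ?_⟩
  · by_cases hzρ : z = ρ
    · rw [hzρ]; exact (hg.differentiableAt).congr_of_eventuallyEq hhg
    · have : h =ᶠ[𝓝 z] fun z => f z / (z - ρ) ^ m := by
        filter_upwards [isOpen_ne.mem_nhds hzρ] with w hw
        simp only [hh, if_neg hw]
      refine DifferentiableAt.congr_of_eventuallyEq ?_ this
      exact (hf z).div (by fun_prop) (pow_ne_zero _ (sub_ne_zero.2 hzρ))
  · by_cases hzρ : z = ρ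
    · have := hfg.self_of_nhds
      simpa [hzρ, hh] using this
    · have : (z - ρ) ^ m ≠ 0 := pow_ne_zero _ (sub_ne_zero.2 hzρ)
      simp only [hh, if_neg hzρ]
      field_simp

theorem Differentiable.exists_eq_prod_pow_mul {f : ℂ → ℂ} (hf : Differentiable ℂ f) {c : ℂ}
    (hc : f c ≠ 0) (T : Finset ℂ) :
    ∃ h : ℂ → ℂ, Differentiable ℂ h ∧ (∀ ρ ∈ T, h ρ ≠ 0) ∧
      ∀ z, f z = (∏ ρ ∈ T, (z - ρ) ^ analyticOrderNatAt f ρ) * h z := by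
  classical
  induction T using Finset.induction_on with
  | empty => exact ⟨f, hf, by simp, by simp⟩
  | insert ρ T hρT ih =>
    obtain ⟨h, hd, hne, hfac⟩ := ih
    have hhc : h c ≠ 0 := fun h0 => hc (by rw [hfac, h0, mul_zero])
    obtain ⟨k, kd, kne, kfac⟩ := hd.exists_eq_pow_mul (hd.analyticOrderAt_ne_top hhc ρ)
    have hord : analyticOrderNatAt f ρ = analyticOrderNatAt h ρ := by
      have hP : Differentiable ℂ fun z => ∏ ρ ∈ T, (z - ρ) ^ analyticOrderNatAt f ρ := by fun_prop
      have hfe : f = (fun z => ∏ ρ ∈ T, (z - ρ) ^ analyticOrderNatAt f ρ) * h := by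
        funext z; exact hfac z
      have h0 : analyticOrderAt (fun z => ∏ ρ ∈ T, (z - ρ) ^ analyticOrderNatAt f ρ) ρ = 0 := by
        rw [(hP.analyticAt ρ).analyticOrderAt_eq_zero]
        refine Finset.prod_ne_zero_iff.2 fun τ hτ => pow_ne_zero _ (sub_ne_zero.2 ?_)
        rintro rfl; exact hρT hτ
      have hmul := analyticOrderAt_mul (hP.analyticAt ρ) (hd.analyticAt ρ)
      rw [← hfe, h0, zero_add] at hmul
      rw [analyticOrderNatAt, analyticOrderNatAt, hmul]
    refine ⟨k, kd, ?_, ?_⟩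
    · intro τ hτ
      rcases Finset.mem_insert.1 hτ with rfl | hτ
      · exact kne
      · intro h0; exact hne τ hτ (by rw [kfac, h0, mul_zero])
    · intro z
      rw [Finset.prod_insert hρT, hfac z, kfac z, ← hord]; ring

/-- Derivative bound for the logarithm of a zero-free function with a one-sided growth bound. -/
theorem norm_logDeriv_le_of_norm_le {g : ℂ → ℂ} {c : ℂ} {r₁ r₂ M : ℝ} (hg : Differentiable ℂ g)
    (hr : 0 ≤ r₁) (hr₁₂ : r₁ < r₂) (hM : 1 < M) (hne : ∀ z ∈ ball c r₂, g z ≠ 0)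
    (hb : ∀ z ∈ ball c r₂, ‖g z‖ ≤ M * ‖g c‖) {z : ℂ} (hz : z ∈ closedBall c r₁) :
    ‖logDeriv g z‖ ≤ 8 * r₂ / (r₂ - r₁) ^ 2 * Real.log M := by
  have hr₂ : 0 < r₂ := hr.trans_lt hr₁₂
  have hcb : c ∈ ball c r₂ := mem_ball_self hr₂
  have hl : DifferentiableOn ℂ (logDeriv g) (ball c r₂) := by
    intro w hw
    exact ((hg.deriv w).div (hg w) (hne w hw)).differentiableWithinAt
  obtain ⟨ℓ, hℓc, hℓ⟩ := hl.isExactOn_ball.with_val_at c 0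
  have hconst : ∀ w ∈ ball c r₂, g w * Complex.exp (-ℓ w) = g c := by
    intro w hw
    have hd : ∀ x ∈ ball c r₂, HasDerivAt (fun w => g w * Complex.exp (-ℓ w)) 0 x := by
      intro x hx
      have h1 := (hg x).hasDerivAt.mul ((hℓ x hx).neg.cexp)
      refine h1.congr_deriv ?_
      rw [logDeriv_apply]
      have := hne x hx
      field_simp
      simp
    have := (convex_ball c r₂).is_const_of_fderivWithin_eq_zero (𝕜 := ℂ)
      (f := fun w => g w * Complex.exp (-ℓ w))
      (fun x hx => (hd x hx).differentiableAt.differentiableWithinAt) (fun x hx => by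
        rw [fderivWithin_of_isOpen isOpen_ball hx]
        ext; simpa using (hd x hx).deriv) hw hcb
    simpa [hℓc] using this
  have hlog : 0 < Real.log M := Real.log_pos hM
  have hre : ∀ w ∈ ball c r₂, (ℓ w).re ≤ Real.log M := by
    intro w hw
    have h1 := congrArg norm (hconst w hw)
    rw [norm_mul, Complex.norm_exp, Complex.neg_re] at h1
    have hgc : 0 < ‖g c‖ := norm_pos_iff.2 (hne c hcb)
    have h2 : ‖g w‖ = ‖g c‖ * Real.exp (ℓ w).re := by
      rw [← h1, mul_assoc, ← Real.exp_add]; simp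
    have h3 := hb w hw
    rw [h2, mul_comm] at h3
    rw [Real.le_log_iff_exp_le (by linarith)]
    exact le_of_mul_le_mul_right h3 hgc
  set r' := (r₁ + r₂) / 2 with hr'
  have hbd : ∀ w ∈ closedBall c r', ‖ℓ w‖ ≤ 4 * r₂ / (r₂ - r₁) * Real.log M := by
    intro w hw
    have hw' : ‖w - c‖ ≤ r' := mem_closedBall_iff_norm.1 hw
    have h1 := Complex.borelCaratheodory_zero (f := fun z => ℓ (c + z)) (R := r₂) (z := w - c)
      hlog ?_ ?_ hr₂
      ?_ (by simpa using hℓc)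
    · simp only [add_sub_cancel] at h1
      refine h1.trans ?_
      rw [div_le_iff₀ (by linarith), div_mul_eq_mul_div, div_mul_eq_mul_div,
        le_div_iff₀ (by linarith)]
      have : ‖w - c‖ * (r₂ - r₁) ≤ 2 * r₂ * (r₂ - ‖w - c‖) := by
        have e1 : ‖w - c‖ * (r₂ - r₁) ≤ r₂ * (r₂ - r₁) := by
          gcongr; linarith
        have e2 : r₂ * (r₂ - r₁) ≤ 2 * r₂ * (r₂ - ‖w - c‖) := by
          have : r₂ - r₁ ≤ 2 * (r₂ - ‖w - c‖) := by linarith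
          nlinarith
        linarith
      nlinarith
    · intro x hx
      have hx' : c + x ∈ ball c r₂ := by simpa using hx
      exact ((hℓ _ hx').differentiableAt.comp x (by fun_prop)).differentiableWithinAt
    · intro x hx
      exact hre _ (by simpa using hx)
    · rw [mem_ball_zero_iff]; linarith
  have hsub : closedBall z ((r₂ - r₁) / 2) ⊆ closedBall c r' :=
    closedBall_subset_closedBall' (by rw [mem_closedBall] at hz; linarith)
  have hzb : z ∈ ball c r₂ := closedBall_subset_ball hr₁₂ hz
  have hcl := Complex.norm_deriv_le_of_forall_mem_sphere_norm_le (f := ℓ) (c := z)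
    (R := (r₂ - r₁) / 2) (C := 4 * r₂ / (r₂ - r₁) * Real.log M) (by linarith) ?_ ?_
  · rw [(hℓ z hzb).deriv] at hcl
    refine hcl.trans (le_of_eq ?_)
    have : r₂ - r₁ ≠ 0 := by linarith
    field_simp
    ring
  · refine DifferentiableOn.diffContOnCl fun x hx => ?_
    refine (hℓ x ?_).differentiableAt.differentiableWithinAt
    rw [closure_ball _ (by linarith)] at hx
    exact closedBall_subset_ball (by linarith) (hsub hx)
  · exact fun x hx => hbd x (hsub (sphere_subset_closedBall hx))

/-- Local approximation of the logarithmic derivative of an entire function by its zeros in a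
disc. -/
theorem logDeriv_sub_sum_le {f : ℂ → ℂ} (hf : Differentiable ℂ f) {c : ℂ} {r₁ r₂ R M : ℝ}
    (hr : 0 < r₁) (hr₁₂ : r₁ < r₂) (hr₂ : r₂ < R) (hM : 1 < M) (hc : f c ≠ 0)
    (hb : ∀ z ∈ closedBall c R, ‖f z‖ ≤ M * ‖f c‖) :
    ∃ T : Finset ℂ, (∀ ρ, ρ ∈ T ↔ ρ ∈ closedBall c r₂ ∧ f ρ = 0) ∧
      (∑ ρ ∈ T, (analyticOrderNatAt f ρ : ℝ)) ≤ Real.log M / Real.log (R / r₂) ∧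
      ∀ z ∈ closedBall c r₁, f z ≠ 0 →
        ‖logDeriv f z - ∑ ρ ∈ T, (analyticOrderNatAt f ρ : ℂ) / (z - ρ)‖ ≤
          (8 * r₂ / (r₂ - r₁) ^ 2 + r₂ / ((R ^ 2 - r₂ ^ 2) * Real.log (R / r₂))) * Real.log M := by
  have hr₂0 : 0 < r₂ := hr.trans hr₁₂
  have hR0 : 0 < R := hr₂0.trans hr₂
  have hfin := hf.finite_zeros hc (isCompact_closedBall c r₂)
  set T := hfin.toFinset with hT
  have hTmem : ∀ ρ, ρ ∈ T ↔ ρ ∈ closedBall c r₂ ∧ f ρ = 0 := by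
    intro ρ; simp [hT]
  obtain ⟨h, hd, hne, hfac⟩ := hf.exists_eq_prod_pow_mul hc T
  set m := analyticOrderNatAt f with hm
  set B : ℂ → ℂ → ℂ := fun ρ z => (R ^ 2 - (starRingEnd ℂ) (ρ - c) * (z - c)) / R with hB
  have hTn : ∀ ρ ∈ T, ‖ρ - c‖ ≤ r₂ := fun ρ hρ => mem_closedBall_iff_norm.1 ((hTmem ρ).1 hρ).1
  have hBlow : ∀ ρ ∈ T, ∀ z ∈ closedBall c r₂,
      R ^ 2 - r₂ ^ 2 ≤ ‖(R : ℂ) ^ 2 - (starRingEnd ℂ) (ρ - c) * (z - c)‖ := by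
    intro ρ hρ z hz
    have h1 : ‖(starRingEnd ℂ) (ρ - c) * (z - c)‖ ≤ r₂ ^ 2 := by
      rw [norm_mul, RCLike.norm_conj, sq]
      exact mul_le_mul (hTn ρ hρ) (mem_closedBall_iff_norm.1 hz) (norm_nonneg _) hr₂0.le
    have h2 := norm_sub_norm_le ((R : ℂ) ^ 2) ((starRingEnd ℂ) (ρ - c) * (z - c))
    rw [norm_pow, Complex.norm_real, Real.norm_of_nonneg hR0.le] at h2
    linarith
  have hgap : 0 < R ^ 2 - r₂ ^ 2 := by nlinarith
  have hnum : ∀ ρ ∈ T, ∀ z ∈ closedBall c r₂, (R : ℂ) ^ 2 - (starRingEnd ℂ) (ρ - c) * (z - c) ≠ 0 :=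
    fun ρ hρ z hz => norm_pos_iff.1 (hgap.trans_le (hBlow ρ hρ z hz))
  have hBne : ∀ ρ ∈ T, ∀ z ∈ closedBall c r₂, B ρ z ≠ 0 := fun ρ hρ z hz =>
    div_ne_zero (hnum ρ hρ z hz) (by exact_mod_cast hR0.ne')
  set P : ℂ → ℂ := fun z => ∏ ρ ∈ T, B ρ z ^ m ρ with hP
  have hPd : Differentiable ℂ P := by simp only [hP, hB]; fun_prop
  set g : ℂ → ℂ := fun z => P z * h z with hg
  have hgd : Differentiable ℂ g := hPd.mul hd
  have hhne : ∀ z ∈ closedBall c r₂, h z ≠ 0 := by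
    intro z hz h0
    have : f z = 0 := by rw [hfac, h0, mul_zero]
    exact hne z ((hTmem z).2 ⟨hz, this⟩) h0
  have hPne : ∀ z ∈ closedBall c r₂, P z ≠ 0 := fun z hz =>
    Finset.prod_ne_zero_iff.2 fun ρ hρ => pow_ne_zero _ (hBne ρ hρ z hz)
  have hgne : ∀ z ∈ closedBall c r₂, g z ≠ 0 := fun z hz => mul_ne_zero (hPne z hz) (hhne z hz)
  have hsphere : ∀ z ∈ sphere c R, ‖g z‖ = ‖f z‖ := by
    intro z hz
    have hzn : ‖z - c‖ = R := mem_sphere_iff_norm.1 hz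
    simp only [hg, hP, hfac z, norm_mul, norm_prod, norm_pow]
    congr 1
    refine Finset.prod_congr rfl fun ρ _ => ?_
    congr 1
    have h1 : (R : ℂ) ^ 2 = (starRingEnd ℂ) (z - c) * (z - c) := by
      rw [Complex.conj_mul', hzn]
    simp only [hB]
    rw [h1, ← sub_mul, ← map_sub, norm_div, norm_mul, RCLike.norm_conj, hzn, Complex.norm_real,
      Real.norm_of_nonneg hR0.le, mul_div_cancel_right₀ _ hR0.ne']
    congr 1; ring
  have hgle : ∀ z ∈ closedBall c R, ‖g z‖ ≤ M * ‖f c‖ := by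
    intro z hz
    refine Complex.norm_le_of_forall_mem_frontier_norm_le (U := ball c R) isBounded_ball
      hgd.diffContOnCl (fun w hw => ?_) (by rwa [closure_ball _ hR0.ne'])
    rw [frontier_ball _ hR0.ne'] at hw
    rw [hsphere w hw]
    exact hb w (sphere_subset_closedBall hw)
  have hcb : c ∈ closedBall c r₂ := mem_closedBall_self hr₂0.le
  have hgc : (R / r₂) ^ (∑ ρ ∈ T, m ρ) * ‖f c‖ ≤ ‖g c‖ := by
    simp only [hg, hP, hfac c, norm_mul, norm_prod, norm_pow]
    rw [← mul_assoc]
    refine mul_le_mul_of_nonneg_right ?_ (norm_nonneg _)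
    rw [← Finset.prod_pow_eq_pow_sum, ← Finset.prod_mul_distrib]
    refine Finset.prod_le_prod (fun ρ _ => by positivity) fun ρ hρ => ?_
    rw [← mul_pow]
    refine pow_le_pow_left₀ (by positivity) ?_ _
    have : ‖B ρ c‖ = R := by
      simp only [hB, sub_self, mul_zero, sub_zero, norm_div, norm_pow, Complex.norm_real,
        Real.norm_of_nonneg hR0.le]
      field_simp
    rw [this, div_mul_eq_mul_div, div_le_iff₀ hr₂0, norm_sub_rev]
    exact mul_le_mul_of_nonneg_left (hTn ρ hρ) hR0.le
  have hfc : 0 < ‖f c‖ := norm_pos_iff.2 hc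
  have hq : 1 < R / r₂ := (one_lt_div hr₂0).2 hr₂
  have hlogq : 0 < Real.log (R / r₂) := Real.log_pos hq
  have hcount : (∑ ρ ∈ T, (m ρ : ℝ)) ≤ Real.log M / Real.log (R / r₂) := by
    have h1 : (R / r₂) ^ (∑ ρ ∈ T, m ρ) ≤ M :=
      le_of_mul_le_mul_right (hgc.trans (hgle c (mem_closedBall_self hR0.le))) hfc
    have h2 := Real.log_le_log (by positivity) h1
    rw [Real.log_pow] at h2
    rw [le_div_iff₀ hlogq]
    exact_mod_cast h2
  refine ⟨T, hTmem, hcount, fun z hz hfz => ?_⟩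
  have hz₂ : z ∈ closedBall c r₂ := closedBall_subset_closedBall hr₁₂.le hz
  have hlg := norm_logDeriv_le_of_norm_le (g := g) (c := c) hgd hr.le hr₁₂ hM
    (fun w hw => hgne w (ball_subset_closedBall hw)) (fun w hw => ?_) hz
  swap
  · refine (hgle w (closedBall_subset_closedBall hr₂.le (ball_subset_closedBall hw))).trans ?_
    have h1 : ‖f c‖ ≤ ‖g c‖ :=
      le_trans (le_mul_of_one_le_left (norm_nonneg _) (one_le_pow₀ hq.le)) hgc
    exact mul_le_mul_of_nonneg_left h1 (by linarith)
  have hzρ : ∀ ρ ∈ T, z - ρ ≠ 0 := by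
    intro ρ hρ h0
    rw [sub_eq_zero.1 h0] at hfz
    exact hfz ((hTmem ρ).1 hρ).2
  have e1 : logDeriv f z = (∑ ρ ∈ T, (m ρ : ℂ) / (z - ρ)) + logDeriv h z := by
    have hfe : f = fun z => (∏ ρ ∈ T, (z - ρ) ^ m ρ) * h z := funext hfac
    rw [hfe, logDeriv_mul z (Finset.prod_ne_zero_iff.2 fun ρ hρ => pow_ne_zero _ (hzρ ρ hρ))
      (hhne z hz₂) (by fun_prop) (hd z), logDeriv_prod (f := fun ρ z => (z - ρ) ^ m ρ)
      (fun ρ hρ => pow_ne_zero _ (hzρ ρ hρ))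
      (fun ρ _ => by fun_prop)]
    congr 1
    refine Finset.sum_congr rfl fun ρ hρ => ?_
    rw [logDeriv_fun_pow (by fun_prop), logDeriv_apply, deriv_sub_const, deriv_id'']
    ring
  have e2 : logDeriv g z = (∑ ρ ∈ T, (m ρ : ℂ) * (-(starRingEnd ℂ) (ρ - c) /
      (R ^ 2 - (starRingEnd ℂ) (ρ - c) * (z - c)))) + logDeriv h z := by
    simp only [hg]
    rw [logDeriv_mul z (hPne z hz₂) (hhne z hz₂) (hPd z) (hd z)]
    simp only [hP]
    rw [logDeriv_prod (f := fun ρ z => B ρ z ^ m ρ) (fun ρ hρ => pow_ne_zero _ (hBne ρ hρ z hz₂))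
      (fun ρ _ => by simp only [hB]; fun_prop)]
    congr 1
    refine Finset.sum_congr rfl fun ρ hρ => ?_
    rw [logDeriv_fun_pow (by simp only [hB]; fun_prop)]
    congr 1
    simp only [hB]
    rw [logDeriv_apply, deriv_div_const]
    have hd1 : deriv (fun z => (R : ℂ) ^ 2 - (starRingEnd ℂ) (ρ - c) * (z - c)) z =
        -(starRingEnd ℂ) (ρ - c) := by
      rw [deriv_const_sub, deriv_const_mul _ (by fun_prop), deriv_sub_const, deriv_id'', mul_one]
    rw [hd1, div_div_div_cancel_right₀ (by exact_mod_cast hR0.ne')]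
  have e3 : logDeriv f z - ∑ ρ ∈ T, (m ρ : ℂ) / (z - ρ) = logDeriv g z -
      ∑ ρ ∈ T, (m ρ : ℂ) * (-(starRingEnd ℂ) (ρ - c) /
        (R ^ 2 - (starRingEnd ℂ) (ρ - c) * (z - c))) := by
    rw [e1, e2]; ring
  rw [e3, add_mul]
  refine (norm_sub_le _ _).trans (add_le_add hlg ((norm_sum_le _ _).trans ?_))
  calc _ ≤ ∑ ρ ∈ T, (m ρ : ℝ) * (r₂ / (R ^ 2 - r₂ ^ 2)) := by
        refine Finset.sum_le_sum fun ρ hρ => ?_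
        rw [norm_mul, Complex.norm_natCast, norm_div, norm_neg, RCLike.norm_conj]
        refine mul_le_mul_of_nonneg_left ?_ (Nat.cast_nonneg _)
        exact div_le_div₀ hr₂0.le (hTn ρ hρ) hgap (hBlow ρ hρ z hz₂)
    _ ≤ Real.log M / Real.log (R / r₂) * (r₂ / (R ^ 2 - r₂ ^ 2)) := by
        rw [← Finset.sum_mul]
        exact mul_le_mul_of_nonneg_right hcount (by positivity)
    _ = _ := by field_simp

theorem measurable_summatory_exp (f : ℕ → ℂ) :
    Measurable fun u : ℝ => ∑ k ∈ Finset.Icc 1 ⌊Real.exp u⌋₊, f k := by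
  have h : Measurable fun n : ℕ => ∑ k ∈ Finset.Icc 1 n, f k := measurable_from_top
  exact h.comp (Nat.measurable_floor.comp Real.measurable_exp)

theorem integral_Ioi_one_eq_integral_exp (F : ℝ → ℂ) :
    ∫ t in Set.Ioi (1 : ℝ), F t = ∫ u in Set.Ioi (0 : ℝ), Real.exp u • F (Real.exp u) := by
  have himg : Real.exp '' Set.Ioi 0 = Set.Ioi 1 := by
    ext y
    simp only [Set.mem_image, Set.mem_Ioi]
    constructor
    · rintro ⟨x, hx, rfl⟩
      exact Real.one_lt_exp_iff.2 hx
    · intro hy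
      exact ⟨Real.log y, Real.log_pos hy, Real.exp_log (by linarith)⟩
  rw [← himg, integral_image_eq_integral_abs_deriv_smul measurableSet_Ioi
    (fun x _ => (Real.hasDerivAt_exp x).hasDerivWithinAt) Real.exp_injective.injOn]
  simp [abs_of_pos, Real.exp_pos]

theorem LSeries_eq_mul_laplaceTransform {f : ℕ → ℂ} {C : ℝ}
    (hf : ∀ n : ℕ, ∑ k ∈ Finset.Icc 1 n, ‖f k‖ ≤ C * n) {s : ℂ} (hs : 1 < s.re) :
    LSeries f s =
      s * laplaceTransform (fun u => ∑ k ∈ Finset.Icc 1 ⌊Real.exp u⌋₊, f k) s := by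
  rw [LSeries_eq_mul_integral' f (r := 1) zero_le_one hs, integral_Ioi_one_eq_integral_exp]
  · congr 1
    unfold laplaceTransform
    refine setIntegral_congr_fun measurableSet_Ioi fun u _ => ?_
    simp only [Complex.real_smul, Complex.ofReal_exp]
    rw [Complex.cpow_def_of_ne_zero (Complex.exp_ne_zero _)]
    rw [← Complex.ofReal_exp, ← Complex.ofReal_log (Real.exp_pos u).le, Real.log_exp]
    rw [show -s * (u : ℂ) = u + u * -(s + 1) by ring, Complex.exp_add, Complex.ofReal_exp]
    ring
  · refine Asymptotics.IsBigO.of_bound C (Eventually.of_forall fun n => ?_)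
    rw [Real.norm_of_nonneg (Finset.sum_nonneg fun _ _ => norm_nonneg _), Real.rpow_one,
      Real.norm_of_nonneg (Nat.cast_nonneg n)]
    exact hf n

theorem integrableOn_laplaceTransform {g : ℝ → ℂ} {b C : ℝ} (hg : Measurable g)
    (hC : ∀ u > 0, ‖g u‖ ≤ C * Real.exp (b * u)) {s : ℂ} (hs : b < s.re) :
    IntegrableOn (fun u : ℝ => g u * Complex.exp (-s * u)) (Set.Ioi 0) := by
  have h1 : IntegrableOn (fun u : ℝ => C * Real.exp (-(s.re - b) * u)) (Set.Ioi 0) :=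
    (exp_neg_integrableOn_Ioi 0 (by linarith)).const_mul C
  refine h1.mono' (by fun_prop) ?_
  filter_upwards [ae_restrict_mem measurableSet_Ioi] with u hu
  rw [norm_mul, Complex.norm_exp]
  calc ‖g u‖ * Real.exp (-s * u).re ≤ C * Real.exp (b * u) * Real.exp (-s * u).re := by
        gcongr; exact hC u hu
    _ = _ := by
        rw [mul_assoc, ← Real.exp_add]; congr 2
        simp; ring

theorem norm_laplaceTransform_le {g : ℝ → ℂ} {b C : ℝ}
    (hC : ∀ u > 0, ‖g u‖ ≤ C * Real.exp (b * u)) {s : ℂ} (hs : b < s.re) :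
    ‖laplaceTransform g s‖ ≤ C / (s.re - b) := by
  unfold laplaceTransform
  have h1 : IntegrableOn (fun u : ℝ => C * Real.exp (-(s.re - b) * u)) (Set.Ioi 0) :=
    (exp_neg_integrableOn_Ioi 0 (by linarith)).const_mul C
  refine (norm_integral_le_of_norm_le h1 ?_).trans ?_
  · filter_upwards [ae_restrict_mem measurableSet_Ioi] with u hu
    rw [norm_mul, Complex.norm_exp]
    calc ‖g u‖ * Real.exp (-s * u).re ≤ C * Real.exp (b * u) * Real.exp (-s * u).re := by
          gcongr; exact hC u hu
      _ = _ := by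
          rw [mul_assoc, ← Real.exp_add]; congr 2
          simp; ring
  · rw [integral_const_mul, integral_exp_mul_Ioi (by linarith)]
    apply le_of_eq
    rw [show -(s.re - b) = b - s.re by ring, mul_zero, Real.exp_zero, neg_div, mul_neg,
      mul_one_div, ← div_neg, neg_sub]

theorem differentiableOn_laplaceTransform {g : ℝ → ℂ} {b C : ℝ} (hg : Measurable g)
    (hC : ∀ u > 0, ‖g u‖ ≤ C * Real.exp (b * u)) :
    DifferentiableOn ℂ (laplaceTransform g) {s | b < s.re} := by
  have hC0 : 0 ≤ C := by
    have := (norm_nonneg _).trans (hC 1 one_pos)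
    exact nonneg_of_mul_nonneg_left this (Real.exp_pos _)
  have key : DifferentiableOn ℂ (fun s => ∫ u : ℝ, (Set.Ioi (0:ℝ)).indicator
      (fun u => g u * Complex.exp (-s * u)) u) {s | b < s.re} := by
    refine differentiableOn_integral_of_locally_dominated
      (F := fun s u => (Set.Ioi (0:ℝ)).indicator (fun u => g u * Complex.exp (-s * u)) u)
      ?_ ?_ ?_
    · intro t
      by_cases ht : t ∈ Set.Ioi (0:ℝ)
      · simp only [Set.indicator_of_mem ht]
        fun_prop
      · simp only [Set.indicator_of_notMem ht]
        fun_prop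
    · intro w _
      refine AEStronglyMeasurable.indicator ?_ measurableSet_Ioi
      fun_prop
    · intro w₀ hw₀
      have hw₀' : b < w₀.re := hw₀
      have hre : ∀ w ∈ closedBall w₀ ((w₀.re - b) / 2), (w₀.re + b) / 2 ≤ w.re := by
        intro w hw
        have h1 := (Complex.abs_re_le_norm (w - w₀)).trans (mem_closedBall_iff_norm.1 hw)
        rw [Complex.sub_re] at h1
        linarith [(abs_le.1 h1).1]
      refine ⟨(w₀.re - b) / 2, by linarith, fun w hw => ?_,
        (Set.Ioi (0:ℝ)).indicator (fun u => C * Real.exp (-((w₀.re - b) / 2) * u)), ?_, ?_⟩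
      · have := hre w hw
        show b < w.re
        linarith
      · rw [integrable_indicator_iff measurableSet_Ioi]
        exact (exp_neg_integrableOn_Ioi 0 (by linarith)).const_mul C
      · intro w hw u
        by_cases hu : u ∈ Set.Ioi (0:ℝ)
        · simp only [Set.indicator_of_mem hu]
          have hu0 : 0 < u := hu
          rw [norm_mul, Complex.norm_exp]
          calc ‖g u‖ * Real.exp (-w * u).re
              ≤ C * Real.exp (b * u) * Real.exp (-w * u).re := by gcongr; exact hC u hu
            _ = C * Real.exp (b * u + (-w * u).re) := by rw [mul_assoc, ← Real.exp_add]
            _ ≤ _ := by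
              gcongr
              have := hre w hw
              simp
              nlinarith
        · simp [Set.indicator_of_notMem hu]
  refine key.congr fun s _ => ?_
  rw [integral_indicator measurableSet_Ioi]
  rfl

theorem chiMinusFour_apply (a : ZMod 4) : chiMinusFour a = ((ZMod.χ₄ a : ℤ) : ℂ) := rfl

theorem chiMinusFour_natCast_eq (n : ℕ) :
    chiMinusFour (n : ZMod 4) = if n % 4 = 1 then 1 else if n % 4 = 3 then -1 else 0 := by
  rw [chiMinusFour_apply, ZMod.χ₄_nat_eq_if_mod_four]
  have : n % 4 < 4 := Nat.mod_lt _ (by norm_num)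
  split_ifs <;> first | omega | simp

theorem chiMinusFour_ne_one : chiMinusFour ≠ 1 := by
  intro h
  have h1 := chiMinusFour_natCast_eq 3
  rw [h] at h1
  have h2 : IsUnit ((3 : ℕ) : ZMod 4) := by decide
  rw [MulChar.one_apply h2] at h1
  norm_num at h1

theorem norm_chiMinusFour_le (n : ℕ) : ‖chiMinusFour (n : ZMod 4)‖ ≤ 1 :=
  DirichletCharacter.norm_le_one _ _

theorem norm_sum_chiMinusFour_le (n : ℕ) :
    ‖∑ k ∈ Finset.Icc 1 n, chiMinusFour (k : ZMod 4)‖ ≤ 1 := by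
  have key : ∑ k ∈ Finset.Icc 1 n, chiMinusFour (k : ZMod 4) =
      if n % 4 = 1 ∨ n % 4 = 2 then 1 else 0 := by
    induction n with
    | zero => simp
    | succ m ih =>
      rw [Finset.sum_Icc_succ_top (by omega), ih, chiMinusFour_natCast_eq]
      have : m % 4 < 4 := Nat.mod_lt _ (by norm_num)
      split_ifs <;> first | omega | simp
  rw [key]
  split_ifs <;> simp

theorem sum_norm_chiMinusFour_le (n : ℕ) :
    ∑ k ∈ Finset.Icc 1 n, ‖chiMinusFour (k : ZMod 4)‖ ≤ 1 * n := by
  refine (Finset.sum_le_sum fun k _ => norm_chiMinusFour_le k).trans ?_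
  simp

theorem LFunction_chiMinusFour_eq {s : ℂ} (hs : 0 < s.re) :
    DirichletCharacter.LFunction chiMinusFour s = s * laplaceTransform
      (fun u => ∑ k ∈ Finset.Icc 1 ⌊Real.exp u⌋₊, chiMinusFour (k : ZMod 4)) s := by
  set g : ℝ → ℂ := fun u => ∑ k ∈ Finset.Icc 1 ⌊Real.exp u⌋₊, chiMinusFour (k : ZMod 4)
  have hD : IsOpen {s : ℂ | 0 < s.re} := isOpen_lt continuous_const Complex.continuous_re
  have h1 : AnalyticOnNhd ℂ (DirichletCharacter.LFunction chiMinusFour) {s : ℂ | 0 < s.re} :=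
    (DirichletCharacter.differentiable_LFunction chiMinusFour_ne_one).differentiableOn.analyticOnNhd
      hD
  have h2 : AnalyticOnNhd ℂ (fun s => s * laplaceTransform g s) {s : ℂ | 0 < s.re} := by
    refine DifferentiableOn.analyticOnNhd ?_ hD
    refine differentiableOn_id.mul (differentiableOn_laplaceTransform (C := 1)
      (measurable_summatory_exp _) fun u _ => ?_)
    simpa using norm_sum_chiMinusFour_le _
  refine h1.eqOn_of_preconnected_of_eventuallyEq h2
    (convex_halfSpace_re_gt 0).isPreconnected (z₀ := 2) (by simp) ?_ hs
  have : ∀ᶠ s : ℂ in 𝓝 2, 1 < s.re :=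
    (isOpen_lt continuous_const Complex.continuous_re).eventually_mem (by simp)
  filter_upwards [this] with s hs
  rw [DirichletCharacter.LFunction_eq_LSeries _ hs,
    LSeries_eq_mul_laplaceTransform sum_norm_chiMinusFour_le hs]

theorem norm_LFunction_chiMinusFour_le {s : ℂ} (hs : 0 < s.re) :
    ‖DirichletCharacter.LFunction chiMinusFour s‖ ≤ ‖s‖ / s.re := by
  rw [LFunction_chiMinusFour_eq hs, norm_mul, div_eq_mul_one_div]
  gcongr
  have := norm_laplaceTransform_le (b := 0) (C := 1)
    (g := fun u => ∑ k ∈ Finset.Icc 1 ⌊Real.exp u⌋₊,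
    chiMinusFour (k : ZMod 4)) (fun u _ => by simpa using norm_sum_chiMinusFour_le _) hs
  simpa using this

theorem laplaceTransform_exp {a s : ℂ} (hs : a.re < s.re) :
    laplaceTransform (fun u => Complex.exp (a * u)) s = 1 / (s - a) := by
  unfold laplaceTransform
  have : ∀ u : ℝ, Complex.exp (a * u) * Complex.exp (-s * u) = Complex.exp ((a - s) * u) := by
    intro u; rw [← Complex.exp_add]; ring_nf
  simp_rw [this]
  rw [integral_exp_mul_complex_Ioi (by simpa using hs)]
  simp only [Complex.ofReal_zero, mul_zero, Complex.exp_zero]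
  rw [← neg_sub s a, neg_div_neg_eq]

theorem riemannZeta₁_eq_sub_mul {s : ℂ} (hs : 0 < s.re) :
    riemannZeta₁ s = s - s * (s - 1) * laplaceTransform
      (fun u => ((Int.fract (Real.exp u) : ℝ) : ℂ)) s := by
  set g : ℝ → ℂ := fun u => ((Int.fract (Real.exp u) : ℝ) : ℂ)
  have hgm : Measurable g :=
    Complex.measurable_ofReal.comp (measurable_fract.comp Real.measurable_exp)
  have hgb : ∀ u > 0, ‖g u‖ ≤ 1 * Real.exp (0 * u) := by
    intro u _
    simp only [g, Complex.norm_real, Real.norm_of_nonneg (Int.fract_nonneg _)]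
    simpa using (Int.fract_lt_one _).le
  have hD : IsOpen {s : ℂ | 0 < s.re} := isOpen_lt continuous_const Complex.continuous_re
  have h1 : AnalyticOnNhd ℂ riemannZeta₁ {s : ℂ | 0 < s.re} :=
    differentiable_riemannZeta₁.differentiableOn.analyticOnNhd hD
  have h2 : AnalyticOnNhd ℂ (fun s => s - s * (s - 1) * laplaceTransform g s)
      {s : ℂ | 0 < s.re} := by
    refine DifferentiableOn.analyticOnNhd ?_ hD
    have := differentiableOn_laplaceTransform hgm hgb
    fun_prop
  refine h1.eqOn_of_preconnected_of_eventuallyEq h2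
    (convex_halfSpace_re_gt 0).isPreconnected (z₀ := 2) (by simp) ?_ hs
  have : ∀ᶠ s : ℂ in 𝓝 2, 1 < s.re :=
    (isOpen_lt continuous_const Complex.continuous_re).eventually_mem (by simp)
  filter_upwards [this] with s hs
  have hs1 : s ≠ 1 := by rintro rfl; simp at hs
  have h3 : riemannZeta s = s * laplaceTransform
      (fun u => ∑ k ∈ Finset.Icc 1 ⌊Real.exp u⌋₊, (1 : ℕ → ℂ) k) s := by
    rw [← LSeries_one_eq_riemannZeta hs, LSeries_eq_mul_laplaceTransform (C := 1) ?_ hs]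
    intro n; simp
  have h4 : laplaceTransform (fun u => ∑ k ∈ Finset.Icc 1 ⌊Real.exp u⌋₊, (1 : ℕ → ℂ) k) s
      = 1 / (s - 1) - laplaceTransform g s := by
    rw [← laplaceTransform_exp (a := 1) (by simpa using hs)]
    unfold laplaceTransform
    rw [← integral_sub]
    · refine setIntegral_congr_fun measurableSet_Ioi fun u _ => ?_
      simp only [Pi.one_apply, Finset.sum_const, Nat.card_Icc, add_tsub_cancel_right, nsmul_eq_mul,
        mul_one, one_mul, g]
      rw [← sub_mul, ← Complex.ofReal_exp u, ← Complex.ofReal_sub, Int.self_sub_fract,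
        ← natCast_floor_eq_intCast_floor (Real.exp_pos u).le]
      norm_num
    · exact integrableOn_laplaceTransform (b := 1) (C := 1) (by fun_prop)
        (fun u _ => by simp [Complex.norm_exp]) hs
    · exact integrableOn_laplaceTransform hgm hgb (by linarith)
  have h5 : s - 1 ≠ 0 := sub_ne_zero.2 hs1
  have h6 := riemannZeta_eq_inv_sub_mul hs1
  rw [h3, h4] at h6
  field_simp at h6
  linear_combination -h6

theorem norm_riemannZeta₁_le {s : ℂ} (hs : 0 < s.re) :
    ‖riemannZeta₁ s‖ ≤ ‖s‖ * (1 + ‖s - 1‖ / s.re) := by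
  rw [riemannZeta₁_eq_sub_mul hs]
  have := norm_laplaceTransform_le (b := 0) (C := 1)
    (g := fun u => ((Int.fract (Real.exp u) : ℝ) : ℂ)) (fun u _ => by
      simp only [Complex.norm_real, Real.norm_of_nonneg (Int.fract_nonneg _)]
      simpa using (Int.fract_lt_one _).le) hs
  rw [sub_zero] at this
  calc _ ≤ ‖s‖ + ‖s‖ * ‖s - 1‖ * (1 / s.re) := by
        refine (norm_sub_le _ _).trans ?_
        rw [norm_mul, norm_mul]
        gcongr
    _ = _ := by ring

theorem exists_norm_LSeries_le {f : ℕ → ℂ} {σ : ℝ} (hf : LSeriesSummable f σ) :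
    ∃ K > 0, ∀ s : ℂ, σ ≤ s.re → ‖LSeries f s‖ ≤ K := by
  have hsum : Summable fun n => ‖LSeries.term f σ n‖ := hf.norm
  refine ⟨∑' n, ‖LSeries.term f σ n‖ + 1,
    add_pos_of_nonneg_of_pos (tsum_nonneg fun _ => norm_nonneg _) one_pos, fun s hs => ?_⟩
  have hle : ∀ n, ‖LSeries.term f s n‖ ≤ ‖LSeries.term f σ n‖ :=
    LSeries.norm_term_le_of_re_le_re f (by simpa using hs)
  have hs' : Summable fun n => ‖LSeries.term f s n‖ :=
    hsum.of_nonneg_of_le (fun _ => norm_nonneg _) hle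
  calc ‖LSeries f s‖ ≤ ∑' n, ‖LSeries.term f s n‖ := norm_tsum_le_tsum_norm hs'
    _ ≤ ∑' n, ‖LSeries.term f σ n‖ := hs'.tsum_le_tsum hle hsum
    _ ≤ _ := by linarith

theorem exists_le_norm_LFunction_chiMinusFour :
    ∃ c > 0, ∀ s : ℂ, 13 / 10 ≤ s.re → c ≤ ‖DirichletCharacter.LFunction chiMinusFour s‖ := by
  have h13 : (1 : ℝ) < ((13 / 10 : ℝ) : ℂ).re := by rw [Complex.ofReal_re]; norm_num
  obtain ⟨K, hK, hb⟩ := exists_norm_LSeries_le (DirichletCharacter.LSeriesSummable_mul chiMinusFour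
    (ArithmeticFunction.LSeriesSummable_moebius_iff.mpr h13))
  refine ⟨1 / K, by positivity, fun s hs => ?_⟩
  have hs1 : 1 < s.re := by linarith
  have h1 := DirichletCharacter.LSeries.mul_mu_eq_one chiMinusFour hs1
  rw [DirichletCharacter.LFunction_eq_LSeries _ hs1]
  have h2 := congrArg norm h1
  rw [norm_mul, norm_one] at h2
  rw [div_le_iff₀ hK, ← h2]
  gcongr
  exact hb s hs

theorem exists_le_norm_riemannZeta₁ :
    ∃ c > 0, ∀ s : ℂ, 13 / 10 ≤ s.re → c ≤ ‖riemannZeta₁ s‖ := by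
  have h13 : (1 : ℝ) < ((13 / 10 : ℝ) : ℂ).re := by rw [Complex.ofReal_re]; norm_num
  obtain ⟨K, hK, hb⟩ := exists_norm_LSeries_le
    (ArithmeticFunction.LSeriesSummable_moebius_iff.mpr h13)
  refine ⟨(3 / 10) / K, by positivity, fun s hs => ?_⟩
  have hs1 : 1 < s.re := by linarith
  have hne : s ≠ 1 := by rintro rfl; simp at hs1
  have h1 := _root_.LSeries_one_mul_Lseries_moebius hs1
  rw [LSeries_one_eq_riemannZeta hs1, riemannZeta_eq_inv_sub_mul hne] at h1
  have h2 := congrArg norm h1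
  rw [norm_mul, norm_mul, norm_one, norm_inv] at h2
  have h3 : 3 / 10 ≤ ‖s - 1‖ := by
    have := (le_abs_self _).trans (Complex.abs_re_le_norm (s - 1))
    rw [Complex.sub_re, Complex.one_re] at this
    linarith
  have h4 : 0 < ‖s - 1‖ := by linarith
  rw [div_le_iff₀ hK]
  calc (3 / 10 : ℝ) ≤ ‖s - 1‖ := h3
    _ = ‖riemannZeta₁ s‖ * ‖LSeries (fun n => ((ArithmeticFunction.moebius n : ℤ) : ℂ)) s‖ := by
        field_simp at h2; linarith
    _ ≤ _ := by gcongr; exact hb s hs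

theorem logDeriv_sub_sum_le_vertical {f : ℂ → ℂ} (hf : Differentiable ℂ f) {A c₀ : ℝ}
    (hA : 0 < A) (hc₀ : 0 < c₀) (hlow : ∀ s : ℂ, 13 / 10 ≤ s.re → c₀ ≤ ‖f s‖)
    (hup : ∀ s : ℂ, 1 / 10 ≤ s.re → s.re ≤ 5 / 2 → ‖f s‖ ≤ A * (1 + |s.im|) ^ 2) :
    ∃ K > 0, ∀ t : ℝ, ∃ T : Finset ℂ,
      (∀ ρ, ρ ∈ T ↔ ρ ∈ closedBall (13 / 10 + t * Complex.I) 1 ∧ f ρ = 0) ∧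
      ∑ ρ ∈ T, (analyticOrderNatAt f ρ : ℝ) ≤ K * (1 + |t|) ^ (1 / 8 : ℝ) ∧
      ∀ z : ℂ, 1 / 2 ≤ z.re → z.re ≤ 2 → z.im = t → f z ≠ 0 →
        ‖logDeriv f z - ∑ ρ ∈ T, (analyticOrderNatAt f ρ : ℂ) / (z - ρ)‖ ≤
          K * (1 + |t|) ^ (1 / 8 : ℝ) := by
  set B : ℝ := 9 * A / c₀ + 2
  have hB : 2 ≤ B := by simp only [B]; linarith [show 0 ≤ 9 * A / c₀ by positivity]
  have hB0 : 0 ≤ Real.log B := Real.log_nonneg (by linarith)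
  have hl12 : 0 < Real.log ((6 / 5 : ℝ) / 1) := Real.log_pos (by norm_num)
  set D : ℝ := 1 / Real.log ((6 / 5 : ℝ) / 1) +
    (8 * 1 / (1 - 4 / 5 : ℝ) ^ 2 + 1 / (((6 / 5 : ℝ) ^ 2 - 1 ^ 2) * Real.log ((6 / 5 : ℝ) / 1)))
  have hD1 : 0 ≤ 8 * 1 / (1 - 4 / 5 : ℝ) ^ 2 +
      1 / (((6 / 5 : ℝ) ^ 2 - 1 ^ 2) * Real.log ((6 / 5 : ℝ) / 1)) := by
    have : (0:ℝ) < ((6 / 5 : ℝ) ^ 2 - 1 ^ 2) := by norm_num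
    positivity
  have hD0 : 0 < D := by
    have : 0 < 1 / Real.log ((6 / 5 : ℝ) / 1) := by positivity
    simp only [D]; linarith
  refine ⟨D * (Real.log B + 16), by positivity, fun t => ?_⟩
  set c : ℂ := 13 / 10 + t * Complex.I with hc
  have hcre : c.re = 13 / 10 := by
    rw [hc]; simp
  have hcim : c.im = t := by
    rw [hc]; simp
  have hfc : c₀ ≤ ‖f c‖ := hlow c (by rw [hcre])
  have hw : 1 ≤ (1 + |t|) ^ (1 / 8 : ℝ) :=
    Real.one_le_rpow (by linarith [abs_nonneg t]) (by norm_num)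
  set M : ℝ := B * (1 + |t|) ^ 2
  have h1t : 1 ≤ (1 + |t|) ^ 2 := one_le_pow₀ (by linarith [abs_nonneg t])
  have hM : 1 < M := by simp only [M]; nlinarith
  have hlog : Real.log M ≤ (Real.log B + 16) * (1 + |t|) ^ (1 / 8 : ℝ) := by
    simp only [M]
    rw [Real.log_mul (by positivity) (by positivity), Real.log_pow]
    have := Real.log_le_rpow_div (x := 1 + |t|) (by positivity) (ε := 1 / 8) (by norm_num)
    push_cast
    nlinarith
  have hball : ∀ z ∈ closedBall c (6 / 5), ‖f z‖ ≤ M * ‖f c‖ := by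
    intro z hz
    rw [mem_closedBall_iff_norm] at hz
    have h1 := (Complex.abs_re_le_norm (z - c)).trans hz
    have h2 := (Complex.abs_im_le_norm (z - c)).trans hz
    rw [Complex.sub_re, hcre, abs_le] at h1
    rw [Complex.sub_im, hcim] at h2
    have h3 : |z.im| ≤ |t| + 6 / 5 := by
      have := abs_add_le (z.im - t) t
      rw [sub_add_cancel] at this
      linarith
    refine (hup z (by linarith [h1.1]) (by linarith [h1.2])).trans ?_
    calc A * (1 + |z.im|) ^ 2 ≤ A * (3 * (1 + |t|)) ^ 2 := by
          gcongr; linarith [abs_nonneg t]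
      _ = 9 * A / c₀ * (1 + |t|) ^ 2 * c₀ := by field_simp; ring
      _ ≤ M * ‖f c‖ := by
          simp only [M]
          gcongr
          simp only [B]; linarith
  obtain ⟨T, hT, hTs, hTz⟩ := logDeriv_sub_sum_le hf (c := c) (r₁ := 4 / 5) (r₂ := 1)
    (R := 6 / 5) (M := M) (by norm_num) (by norm_num) (by norm_num) hM
    (norm_pos_iff.1 (hc₀.trans_le hfc)) hball
  have hlogM : 0 ≤ Real.log M := Real.log_nonneg hM.le
  refine ⟨T, hT, ?_, fun z hz1 hz2 hzt hfz => ?_⟩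
  · refine hTs.trans ?_
    calc Real.log M / Real.log (6 / 5 / 1) = 1 / Real.log (6 / 5 / 1) * Real.log M := by ring
      _ ≤ D * ((Real.log B + 16) * (1 + |t|) ^ (1 / 8 : ℝ)) := by
          gcongr
          simp only [D]; linarith
      _ = _ := by ring
  · refine (hTz z ?_ hfz).trans ?_
    · have : z - c = ((z.re - 13 / 10 : ℝ) : ℂ) := by
        apply Complex.ext
        · simp [hcre]
        · simp [hcim, hzt]
      rw [mem_closedBall_iff_norm, this, Complex.norm_real, Real.norm_eq_abs, abs_le]
      constructor <;> linarith
    · calc _ ≤ D * ((Real.log B + 16) * (1 + |t|) ^ (1 / 8 : ℝ)) := by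
            gcongr
            simp only [D]
            linarith [show 0 ≤ 1 / Real.log ((6 / 5 : ℝ) / 1) by positivity]
        _ = _ := by ring

theorem norm_le_two_add_abs_im {s : ℂ} (h0 : 0 ≤ s.re) (h : s.re ≤ 5 / 2) :
    ‖s‖ ≤ 5 / 2 * (1 + |s.im|) := by
  have := Complex.norm_le_abs_re_add_abs_im s
  rw [abs_of_nonneg h0] at this
  linarith [abs_nonneg s.im]

theorem norm_LFunction_chiMinusFour_le_sq (s : ℂ) (h : 1 / 10 ≤ s.re) (h' : s.re ≤ 5 / 2) :
    ‖DirichletCharacter.LFunction chiMinusFour s‖ ≤ 25 * (1 + |s.im|) ^ 2 := by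
  refine (norm_LFunction_chiMinusFour_le (by linarith)).trans ?_
  have h1 := norm_le_two_add_abs_im (by linarith) h'
  rw [div_le_iff₀ (by linarith)]
  nlinarith [abs_nonneg s.im]

theorem norm_riemannZeta₁_le_sq (s : ℂ) (h : 1 / 10 ≤ s.re) (h' : s.re ≤ 5 / 2) :
    ‖riemannZeta₁ s‖ ≤ 100 * (1 + |s.im|) ^ 2 := by
  refine (norm_riemannZeta₁_le (by linarith)).trans ?_
  have h1 := norm_le_two_add_abs_im (by linarith) h'
  have h2 : ‖s - 1‖ ≤ 7 / 2 * (1 + |s.im|) := by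
    have := norm_sub_le s 1
    rw [norm_one] at this
    linarith [abs_nonneg s.im]
  have h3 : ‖s - 1‖ / s.re ≤ 35 * (1 + |s.im|) := by
    rw [div_le_iff₀ (by linarith)]
    nlinarith [abs_nonneg s.im]
  calc ‖s‖ * (1 + ‖s - 1‖ / s.re) ≤ 5 / 2 * (1 + |s.im|) * (36 * (1 + |s.im|)) := by
        gcongr
        linarith [abs_nonneg s.im]
    _ ≤ _ := by nlinarith [abs_nonneg s.im]

/-- The zeros of `f` on the critical line satisfy a density bound in short vertical windows, and
they account for `f'/f` to its right, up to an error `K (1 + |t|)^(1/8)`. -/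
structure VerticalZeroBound (f : ℂ → ℂ) (K : ℝ) : Prop where
  pos : 0 < K
  exists_finset : ∀ t : ℝ, ∃ T : Finset ℂ,
      (∀ ρ, ρ ∈ T ↔ f ρ = 0 ∧ ρ.re = 1 / 2 ∧ |ρ.im - t| ≤ 3 / 5) ∧
      ∑ ρ ∈ T, (analyticOrderNatAt f ρ : ℝ) ≤ K * (1 + |t|) ^ (1 / 8 : ℝ) ∧
      ∀ z : ℂ, 1 / 2 ≤ z.re → z.re ≤ 2 → z.im = t → f z ≠ 0 →
        ‖logDeriv f z - ∑ ρ ∈ T, (analyticOrderNatAt f ρ : ℂ) / (z - ρ)‖ ≤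
          K * (1 + |t|) ^ (1 / 8 : ℝ)

theorem exists_verticalZeroBound {f : ℂ → ℂ} (hf : Differentiable ℂ f) {A c₀ : ℝ}
    (hA : 0 < A) (hc₀ : 0 < c₀) (hlow : ∀ s : ℂ, 13 / 10 ≤ s.re → c₀ ≤ ‖f s‖)
    (hup : ∀ s : ℂ, 1 / 10 ≤ s.re → s.re ≤ 5 / 2 → ‖f s‖ ≤ A * (1 + |s.im|) ^ 2)
    (hRH : ∀ ρ, f ρ = 0 → 0 < ρ.re → ρ.re = 1 / 2) : ∃ K, VerticalZeroBound f K := by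
  obtain ⟨K, hK, h⟩ := logDeriv_sub_sum_le_vertical hf hA hc₀ hlow hup
  refine ⟨K, hK, fun t => ?_⟩
  obtain ⟨T, hT, h1, h2⟩ := h t
  refine ⟨T, fun ρ => ?_, h1, h2⟩
  rw [hT, mem_closedBall_iff_norm]
  have hnorm : ‖ρ - (13 / 10 + t * Complex.I)‖ ^ 2 = (ρ.re - 13 / 10) ^ 2 + (ρ.im - t) ^ 2 := by
    rw [Complex.sq_norm, Complex.normSq_apply]
    simp
    ring
  constructor
  · rintro ⟨hb, h0⟩
    have hb2 : ‖ρ - (13 / 10 + t * Complex.I)‖ ^ 2 ≤ 1 := by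
      have := norm_nonneg (ρ - (13 / 10 + t * Complex.I)); nlinarith
    rw [hnorm] at hb2
    have hre := hRH ρ h0 (by nlinarith [sq_nonneg (ρ.im - t)])
    refine ⟨h0, hre, ?_⟩
    rw [hre] at hb2
    exact abs_le_of_sq_le_sq (by nlinarith) (by norm_num)
  · rintro ⟨h0, hre, him⟩
    refine ⟨?_, h0⟩
    have h3 := (sq_le_sq₀ (abs_nonneg _) (by norm_num)).2 him
    rw [sq_abs] at h3
    rw [hre] at hnorm
    nlinarith [norm_nonneg (ρ - (13 / 10 + t * Complex.I))]

theorem one_add_abs_rpow_le_four_mul {a b : ℝ} (h : |a - b| ≤ 3 / 5) :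
    (1 + |a|) ^ (-(15 / 8) : ℝ) ≤ 4 * (1 + |b|) ^ (-(15 / 8) : ℝ) := by
  have h1 := one_add_abs_rpow_neg_le b (a - b) (15 / 8) (by norm_num)
  rw [add_sub_cancel] at h1
  refine h1.trans ?_
  gcongr
  calc (1 + |a - b|) ^ (15 / 8 : ℝ) ≤ (1 + |a - b|) ^ (2 : ℝ) :=
        Real.rpow_le_rpow_of_exponent_le (by linarith [abs_nonneg (a - b)]) (by norm_num)
    _ = (1 + |a - b|) ^ 2 := by norm_cast
    _ ≤ 4 := by nlinarith [abs_nonneg (a - b)]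

theorem integrable_one_add_abs_rpow {p : ℝ} (hp : 1 < p) :
    Integrable fun t : ℝ => (1 + |t|) ^ (-p) := by
  have := integrable_one_add_norm (E := ℝ) (μ := volume) (r := p) (by simpa using hp)
  simpa using this

/-- The zeros of `f` with real part `1/2`. -/
def criticalZeros (f : ℂ → ℂ) : Set ℂ := {ρ | f ρ = 0 ∧ ρ.re = 1 / 2}

/-- The multiplicity of a zero, weighted by a power of its height. -/
noncomputable def zeroWeight (f : ℂ → ℂ) (ρ : ℂ) : ℝ :=
  analyticOrderNatAt f ρ * (1 + |ρ.im|) ^ (-(15 / 8) : ℝ)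

theorem zeroWeight_nonneg (f : ℂ → ℂ) (ρ : ℂ) : 0 ≤ zeroWeight f ρ := by
  unfold zeroWeight; positivity

theorem VerticalZeroBound.summable {f : ℂ → ℂ} {K : ℝ} (h : VerticalZeroBound f K) :
    Summable fun ρ : criticalZeros f => zeroWeight f ρ := by
  have hintg : Integrable fun t : ℝ => 4 * K * (1 + |t|) ^ (-(7 / 4) : ℝ) :=
    (integrable_one_add_abs_rpow (by norm_num)).const_mul _
  refine summable_of_sum_le (c := (∫ t : ℝ, 4 * K * (1 + |t|) ^ (-(7 / 4) : ℝ)) / (6 / 5))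
    (fun ρ => zeroWeight_nonneg f ρ) fun S => ?_
  rw [le_div_iff₀ (by norm_num), Finset.sum_mul]
  have h1 : ∀ ρ : criticalZeros f, zeroWeight f ρ * (6 / 5) =
      ∫ t : ℝ, (Set.Icc ((ρ : ℂ).im - 3 / 5) ((ρ : ℂ).im + 3 / 5)).indicator
        (fun _ => zeroWeight f ρ) t := by
    intro ρ
    rw [integral_indicator measurableSet_Icc, setIntegral_const]
    simp only [Measure.real, Real.volume_Icc, smul_eq_mul]
    rw [ENNReal.toReal_ofReal (by norm_num)]
    ring
  rw [Finset.sum_congr rfl fun ρ _ => h1 ρ, ← integral_finsetSum]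
  · refine integral_mono ?_ hintg fun t => ?_
    · refine integrable_finsetSum _ fun ρ _ => ?_
      rw [integrable_indicator_iff measurableSet_Icc]
      exact integrableOn_const (by simp)
    · obtain ⟨T, hT, hTs, -⟩ := h.exists_finset t
      have hstep : ∀ ρ ∈ S, (Set.Icc ((ρ : ℂ).im - 3 / 5) ((ρ : ℂ).im + 3 / 5)).indicator
          (fun _ => zeroWeight f ρ) t ≤
          if (ρ : ℂ) ∈ T then 4 * (1 + |t|) ^ (-(15 / 8) : ℝ) * analyticOrderNatAt f ρ else 0 := by
        intro ρ _
        by_cases ht : t ∈ Set.Icc ((ρ : ℂ).im - 3 / 5) ((ρ : ℂ).im + 3 / 5)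
        · have habs : |(ρ : ℂ).im - t| ≤ 3 / 5 := by
            rw [abs_le]; constructor <;> linarith [ht.1, ht.2]
          rw [Set.indicator_of_mem ht, if_pos ((hT _).2 ⟨ρ.2.1, ρ.2.2, habs⟩), zeroWeight,
            mul_comm]
          gcongr
          exact one_add_abs_rpow_le_four_mul habs
        · rw [Set.indicator_of_notMem ht]
          split_ifs <;> positivity
      calc (∑ ρ ∈ S, (Set.Icc ((ρ : ℂ).im - 3 / 5) ((ρ : ℂ).im + 3 / 5)).indicator
            (fun _ => zeroWeight f ρ) t)
          ≤ ∑ ρ ∈ S, if (ρ : ℂ) ∈ T then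
              4 * (1 + |t|) ^ (-(15 / 8) : ℝ) * analyticOrderNatAt f ρ else 0 :=
            Finset.sum_le_sum hstep
        _ = ∑ ρ ∈ S.map (Function.Embedding.subtype _), if ρ ∈ T then
              4 * (1 + |t|) ^ (-(15 / 8) : ℝ) * analyticOrderNatAt f ρ else 0 := by
            rw [Finset.sum_map]; rfl
        _ ≤ ∑ ρ ∈ T, 4 * (1 + |t|) ^ (-(15 / 8) : ℝ) * analyticOrderNatAt f ρ := by
            rw [← Finset.sum_filter]
            refine Finset.sum_le_sum_of_subset_of_nonneg ?_ fun _ _ _ => by positivity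
            intro x hx
            exact (Finset.mem_filter.1 hx).2
        _ ≤ 4 * (1 + |t|) ^ (-(15 / 8) : ℝ) * (K * (1 + |t|) ^ (1 / 8 : ℝ)) := by
            rw [← Finset.mul_sum]; gcongr
        _ = 4 * K * (1 + |t|) ^ (-(7 / 4) : ℝ) := by
            rw [show (-(7 / 4) : ℝ) = -(15 / 8) + 1 / 8 by norm_num,
              Real.rpow_add (by positivity)]
            ring
  · intro ρ _
    rw [integrable_indicator_iff measurableSet_Icc]
    exact integrableOn_const (by simp)

theorem lintegral_inv_sq_add_sq {σ : ℝ} (hσ : 0 < σ) (γ : ℝ) :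
    ∫⁻ t : ℝ, ENNReal.ofReal (1 / (σ ^ 2 + (t - γ) ^ 2)) = ENNReal.ofReal (Real.pi / σ) := by
  rw [lintegral_sub_right_eq_self (fun t : ℝ => ENNReal.ofReal (1 / (σ ^ 2 + t ^ 2))) γ,
    lintegral_comp_mul_pos _ hσ]
  have h1 : ∀ x : ℝ, ENNReal.ofReal (1 / (σ ^ 2 + (σ * x) ^ 2)) =
      ENNReal.ofReal (1 / σ ^ 2) * ENNReal.ofReal ((1 + x ^ 2)⁻¹) := by
    intro x
    rw [← ENNReal.ofReal_mul (by positivity)]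
    congr 1
    field_simp
  simp_rw [h1]
  rw [lintegral_const_mul _ (by fun_prop),
    ← ofReal_integral_eq_lintegral_ofReal integrable_inv_one_add_sq
      (Eventually.of_forall fun x => by positivity), integral_univ_inv_one_add_sq,
    ← ENNReal.ofReal_mul (by positivity), ← ENNReal.ofReal_mul hσ.le]
  congr 1
  field_simp

/-- The Laplace transform of the remainder in a truncated explicit formula. -/
noncomputable def truncatedTransform (f : ℂ → ℂ) (S : Finset ℂ) (s : ℂ) : ℂ :=
  -logDeriv f s / s + ∑ ρ ∈ S, (analyticOrderNatAt f ρ : ℂ) / ρ / (s - ρ)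

theorem mul_truncatedTransform {f : ℂ → ℂ} {S : Finset ℂ} (hS : ∀ ρ ∈ S, ρ.re = 1 / 2) {s : ℂ}
    (hs : 1 / 2 < s.re) :
    s * truncatedTransform f S s = -logDeriv f s + ∑ ρ ∈ S, (analyticOrderNatAt f ρ : ℂ) / ρ +
      ∑ ρ ∈ S, (analyticOrderNatAt f ρ : ℂ) / (s - ρ) := by
  have hs0 : s ≠ 0 := by rintro rfl; norm_num at hs
  rw [truncatedTransform, mul_add, mul_div_cancel₀ _ hs0, Finset.mul_sum, add_assoc,
    ← Finset.sum_add_distrib]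
  congr 1
  refine Finset.sum_congr rfl fun ρ hρ => ?_
  have h1 : ρ ≠ 0 := by rintro rfl; have := hS 0 hρ; norm_num at this
  have h2 : s - ρ ≠ 0 := by
    intro h; rw [sub_eq_zero] at h; rw [h, hS ρ hρ] at hs; exact lt_irrefl _ hs
  field_simp
  ring

theorem norm_mul_truncatedTransform_le {f : ℂ → ℂ} {K : ℝ}
    {S : Finset ℂ} (hS : ∀ ρ ∈ S, f ρ = 0 ∧ ρ.re = 1 / 2) {t : ℝ} {T : Finset ℂ}
    (hT : ∀ ρ, ρ ∈ T ↔ f ρ = 0 ∧ ρ.re = 1 / 2 ∧ |ρ.im - t| ≤ 3 / 5) {s : ℂ}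
    (hs : 1 / 2 < s.re) (hst : s.im = t)
    (hb : ‖logDeriv f s - ∑ ρ ∈ T, (analyticOrderNatAt f ρ : ℂ) / (s - ρ)‖ ≤
          K * (1 + |t|) ^ (1 / 8 : ℝ)) :
    ‖s * truncatedTransform f S s‖ ≤
      (K + ∑ ρ ∈ S, (analyticOrderNatAt f ρ / ‖ρ‖ + 2 * analyticOrderNatAt f ρ)) *
        (1 + |t|) ^ (1 / 8 : ℝ) + ∑ ρ ∈ T \ S, analyticOrderNatAt f ρ / ‖s - ρ‖ := by
  classical
  rw [mul_truncatedTransform (fun ρ hρ => (hS ρ hρ).2) hs]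
  have e1 : ∑ ρ ∈ T, (analyticOrderNatAt f ρ : ℂ) / (s - ρ) =
      ∑ ρ ∈ T \ S, (analyticOrderNatAt f ρ : ℂ) / (s - ρ) +
        ∑ ρ ∈ T ∩ S, (analyticOrderNatAt f ρ : ℂ) / (s - ρ) := by
    rw [add_comm, Finset.sum_inter_add_sum_sdiff]
  have e2 : ∑ ρ ∈ S, (analyticOrderNatAt f ρ : ℂ) / (s - ρ) =
      ∑ ρ ∈ S \ T, (analyticOrderNatAt f ρ : ℂ) / (s - ρ) +
        ∑ ρ ∈ T ∩ S, (analyticOrderNatAt f ρ : ℂ) / (s - ρ) := by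
    rw [add_comm, Finset.inter_comm, Finset.sum_inter_add_sum_sdiff]
  have hw : 1 ≤ (1 + |t|) ^ (1 / 8 : ℝ) :=
    Real.one_le_rpow (by linarith [abs_nonneg t]) (by norm_num)
  have b1 : ‖∑ ρ ∈ S, (analyticOrderNatAt f ρ : ℂ) / ρ‖ ≤
      ∑ ρ ∈ S, analyticOrderNatAt f ρ / ‖ρ‖ := by
    refine (norm_sum_le _ _).trans (le_of_eq ?_)
    simp
  have b2 : ‖∑ ρ ∈ S \ T, (analyticOrderNatAt f ρ : ℂ) / (s - ρ)‖ ≤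
      ∑ ρ ∈ S, 2 * (analyticOrderNatAt f ρ : ℝ) := by
    refine (norm_sum_le _ _).trans ?_
    refine (Finset.sum_le_sum (g := fun ρ => 2 * (analyticOrderNatAt f ρ : ℝ)) ?_).trans
      (Finset.sum_le_sum_of_subset_of_nonneg Finset.sdiff_subset fun _ _ _ => by positivity)
    intro ρ hρ
    obtain ⟨h1, h2⟩ := Finset.mem_sdiff.1 hρ
    have h3 : 3 / 5 < |ρ.im - t| := by
      by_contra! h
      exact h2 ((hT ρ).2 ⟨(hS ρ h1).1, (hS ρ h1).2, h⟩)
    have h4 : 3 / 5 < ‖s - ρ‖ := by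
      refine h3.trans_le ?_
      have := Complex.abs_im_le_norm (s - ρ)
      rwa [Complex.sub_im, hst, abs_sub_comm] at this
    rw [norm_div, Complex.norm_natCast, div_le_iff₀ (by linarith)]
    nlinarith [(Nat.cast_nonneg (analyticOrderNatAt f ρ) : (0:ℝ) ≤ _)]
  have b3 : ‖∑ ρ ∈ T \ S, (analyticOrderNatAt f ρ : ℂ) / (s - ρ)‖ ≤
      ∑ ρ ∈ T \ S, analyticOrderNatAt f ρ / ‖s - ρ‖ := by
    refine (norm_sum_le _ _).trans (le_of_eq ?_)
    simp
  rw [e1] at hb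
  rw [e2]
  set a := logDeriv f s
  set X := ∑ ρ ∈ T \ S, (analyticOrderNatAt f ρ : ℂ) / (s - ρ)
  set Y := ∑ ρ ∈ T ∩ S, (analyticOrderNatAt f ρ : ℂ) / (s - ρ)
  set P := ∑ ρ ∈ S, (analyticOrderNatAt f ρ : ℂ) / ρ
  set Q := ∑ ρ ∈ S \ T, (analyticOrderNatAt f ρ : ℂ) / (s - ρ)
  have hsplit : -a + P + (Q + Y) = -(a - (X + Y)) + P + Q - X := by ring
  rw [hsplit, Finset.sum_add_distrib]
  have hn1 : 0 ≤ ∑ ρ ∈ S, (analyticOrderNatAt f ρ : ℝ) / ‖ρ‖ :=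
    Finset.sum_nonneg fun _ _ => by positivity
  have hn2 : 0 ≤ ∑ ρ ∈ S, 2 * (analyticOrderNatAt f ρ : ℝ) :=
    Finset.sum_nonneg fun _ _ => by positivity
  calc ‖-(a - (X + Y)) + P + Q - X‖ ≤ ‖a - (X + Y)‖ + ‖P‖ + ‖Q‖ + ‖X‖ := by
        rw [← norm_neg (a - (X + Y))]
        exact (norm_sub_le _ _).trans (add_le_add (norm_add₃_le) le_rfl)
    _ ≤ _ := by nlinarith

theorem differentiableOn_truncatedTransform {f : ℂ → ℂ} (hf : Differentiable ℂ f)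
    (hRH : ∀ s : ℂ, 1 / 2 < s.re → f s ≠ 0) {S : Finset ℂ} (hS : ∀ ρ ∈ S, ρ.re = 1 / 2) :
    DifferentiableOn ℂ (truncatedTransform f S) {s | 1 / 2 < s.re} := by
  intro s hs
  have hs' : 1 / 2 < s.re := hs
  have hs0 : s ≠ 0 := by rintro rfl; norm_num at hs'
  have h1 : DifferentiableAt ℂ (deriv f) s := (hf.analyticAt s).deriv.differentiableAt
  have h2 : DifferentiableAt ℂ (logDeriv f) s := h1.div (hf s) (hRH s hs)
  refine DifferentiableAt.differentiableWithinAt ?_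
  unfold truncatedTransform
  refine (h2.neg.div differentiableAt_id hs0).add (DifferentiableAt.fun_sum fun ρ hρ => ?_)
  have h3 : s - ρ ≠ 0 := by
    intro h; rw [sub_eq_zero] at h; rw [h, hS ρ hρ] at hs'; exact lt_irrefl _ hs'
  fun_prop (disch := assumption)

theorem one_add_abs_im_sq_le {s : ℂ} (hs : 1 / 2 ≤ s.re) : (1 + |s.im|) ^ 2 ≤ 8 * ‖s‖ ^ 2 := by
  rw [Complex.sq_norm, Complex.normSq_apply]
  nlinarith [sq_abs s.im, sq_nonneg (1 - |s.im|)]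

theorem one_add_abs_im_le {s : ℂ} (hs : 1 / 2 ≤ s.re) : 1 + |s.im| ≤ 3 * ‖s‖ := by
  have := one_add_abs_im_sq_le hs
  nlinarith [norm_nonneg s, abs_nonneg s.im]

theorem norm_truncatedTransform_le {f : ℂ → ℂ} {K : ℝ} (hV : VerticalZeroBound f K)
    (hRH : ∀ s : ℂ, 1 / 2 < s.re → f s ≠ 0) {K₂ : ℝ}
    (hK₂ : ∀ s : ℂ, 13 / 10 ≤ s.re → ‖logDeriv f s‖ ≤ K₂) {S : Finset ℂ}
    (hS : ∀ ρ ∈ S, f ρ = 0 ∧ ρ.re = 1 / 2) (σ₀ : ℝ) (hσ₀ : 1 / 2 < σ₀) :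
    ∃ C : ℝ, ∀ s : ℂ, σ₀ ≤ s.re →
      ‖truncatedTransform f S s‖ ≤ C * (1 + |s.im|) ^ (-(3 / 4) : ℝ) := by
  set B := ∑ ρ ∈ S, ((analyticOrderNatAt f ρ : ℝ) / ‖ρ‖ + 2 * analyticOrderNatAt f ρ)
  have hB : 0 ≤ B := Finset.sum_nonneg fun _ _ => by positivity
  have hK := hV.pos
  have hd : 0 < σ₀ - 1 / 2 := by linarith
  have hK₂0 : 0 ≤ K₂ := (norm_nonneg _).trans (hK₂ 2 (by norm_num))
  set C := K + B + K / (σ₀ - 1 / 2) + K₂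
  have hCpos : 0 ≤ C := by positivity
  refine ⟨3 * C, fun s hs => ?_⟩
  have hs' : 1 / 2 < s.re := by linarith
  have hw : 1 ≤ (1 + |s.im|) ^ (1 / 8 : ℝ) :=
    Real.one_le_rpow (by linarith [abs_nonneg s.im]) (by norm_num)
  have main : ‖s * truncatedTransform f S s‖ ≤ C * (1 + |s.im|) ^ (1 / 8 : ℝ) := by
    rcases le_total s.re 2 with h2 | h2
    · obtain ⟨T, hT, hTs, hTz⟩ := hV.exists_finset s.im
      refine (norm_mul_truncatedTransform_le hS hT hs' rfl
        (hTz s hs'.le h2 rfl (hRH s hs'))).trans ?_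
      have h3 : ∑ ρ ∈ T \ S, (analyticOrderNatAt f ρ : ℝ) / ‖s - ρ‖ ≤
          K / (σ₀ - 1 / 2) * (1 + |s.im|) ^ (1 / 8 : ℝ) := by
        calc ∑ ρ ∈ T \ S, (analyticOrderNatAt f ρ : ℝ) / ‖s - ρ‖
            ≤ ∑ ρ ∈ T \ S, (analyticOrderNatAt f ρ : ℝ) / (σ₀ - 1 / 2) := by
              refine Finset.sum_le_sum fun ρ hρ => ?_
              have h4 := ((hT ρ).1 (Finset.mem_sdiff.1 hρ).1).2.1
              have h5 := (le_abs_self _).trans (Complex.abs_re_le_norm (s - ρ))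
              rw [Complex.sub_re, h4] at h5
              gcongr
              linarith
          _ ≤ ∑ ρ ∈ T, (analyticOrderNatAt f ρ : ℝ) / (σ₀ - 1 / 2) :=
              Finset.sum_le_sum_of_subset_of_nonneg Finset.sdiff_subset fun _ _ _ => by positivity
          _ ≤ K * (1 + |s.im|) ^ (1 / 8 : ℝ) / (σ₀ - 1 / 2) := by
              rw [← Finset.sum_div]; gcongr
          _ = _ := by ring
      simp only [C, B] at h3 ⊢
      nlinarith
    · rw [mul_truncatedTransform (fun ρ hρ => (hS ρ hρ).2) hs']
      have b1 : ‖∑ ρ ∈ S, (analyticOrderNatAt f ρ : ℂ) / ρ‖ ≤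
          ∑ ρ ∈ S, analyticOrderNatAt f ρ / ‖ρ‖ := by
        refine (norm_sum_le _ _).trans (le_of_eq ?_)
        simp
      have b2 : ‖∑ ρ ∈ S, (analyticOrderNatAt f ρ : ℂ) / (s - ρ)‖ ≤
          ∑ ρ ∈ S, 2 * (analyticOrderNatAt f ρ : ℝ) := by
        refine (norm_sum_le _ _).trans (Finset.sum_le_sum fun ρ hρ => ?_)
        have h5 := (le_abs_self _).trans (Complex.abs_re_le_norm (s - ρ))
        rw [Complex.sub_re, (hS ρ hρ).2] at h5
        rw [norm_div, Complex.norm_natCast, div_le_iff₀ (by linarith)]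
        nlinarith [(Nat.cast_nonneg (analyticOrderNatAt f ρ) : (0:ℝ) ≤ _)]
      have b3 := hK₂ s (by linarith)
      calc _ ≤ ‖logDeriv f s‖ + ‖∑ ρ ∈ S, (analyticOrderNatAt f ρ : ℂ) / ρ‖ +
            ‖∑ ρ ∈ S, (analyticOrderNatAt f ρ : ℂ) / (s - ρ)‖ := by
            rw [← norm_neg (logDeriv f s)]; exact norm_add₃_le
        _ ≤ K₂ + B := by
            simp only [B]; rw [Finset.sum_add_distrib]; linarith
        _ ≤ C := by
            simp only [C]; linarith [show 0 ≤ K / (σ₀ - 1 / 2) by positivity]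
        _ ≤ _ := by nlinarith
  have hs3 := one_add_abs_im_le hs'.le
  have hspos : 0 < ‖s‖ := by nlinarith [abs_nonneg s.im]
  rw [norm_mul] at main
  have hmono : (1 + |s.im|) ^ (1 / 8 : ℝ) ≤ (1 + |s.im|) ^ (-(3 / 4) : ℝ) * (1 + |s.im|) := by
    nth_rewrite 3 [← Real.rpow_one (1 + |s.im|)]
    rw [← Real.rpow_add (by positivity)]
    exact Real.rpow_le_rpow_of_exponent_le (by linarith [abs_nonneg s.im]) (by norm_num)
  have hfin : ‖s‖ * ‖truncatedTransform f S s‖ ≤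
      ‖s‖ * (3 * C * (1 + |s.im|) ^ (-(3 / 4) : ℝ)) := by
    calc _ ≤ C * ((1 + |s.im|) ^ (-(3 / 4) : ℝ) * (1 + |s.im|)) :=
          main.trans (by gcongr)
      _ ≤ C * ((1 + |s.im|) ^ (-(3 / 4) : ℝ) * (3 * ‖s‖)) := by gcongr
      _ = _ := by ring
  exact le_of_mul_le_mul_left hfin hspos

theorem countable_criticalZeros {f : ℂ → ℂ} (hf : Differentiable ℂ f) {c : ℂ} (hc : f c ≠ 0) :
    (criticalZeros f).Countable := by
  have h : criticalZeros f ⊆ ⋃ n : ℕ, {z | z ∈ closedBall (0 : ℂ) n ∧ f z = 0} := by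
    intro z hz
    obtain ⟨n, hn⟩ := exists_nat_ge ‖z‖
    exact Set.mem_iUnion.2 ⟨n, by simpa using hn, hz.1⟩
  refine Set.Countable.mono h (Set.countable_iUnion fun n => ?_)
  exact (hf.finite_zeros hc (isCompact_closedBall _ _)).countable

theorem norm_sq_truncatedTransform_le {f : ℂ → ℂ} {K : ℝ} (hV : VerticalZeroBound f K)
    (hRH : ∀ s : ℂ, 1 / 2 < s.re → f s ≠ 0) {S : Finset ℂ}
    (hS : ∀ ρ ∈ S, f ρ = 0 ∧ ρ.re = 1 / 2) {σ : ℝ} (hσ : 0 < σ) (hσ1 : σ ≤ 1) (t : ℝ) :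
    ‖truncatedTransform f S (((1 / 2 + σ : ℝ) : ℂ) + t * Complex.I)‖ₑ ^ 2 ≤
      ENNReal.ofReal (16 * (K + ∑ ρ ∈ S, ((analyticOrderNatAt f ρ : ℝ) / ‖ρ‖ +
        2 * analyticOrderNatAt f ρ)) ^ 2 * (1 + |t|) ^ (-(7 / 4) : ℝ)) +
      ∑' ρ : criticalZeros f, (if (ρ : ℂ) ∈ S then 0 else ENNReal.ofReal (zeroWeight f ρ)) *
        (ENNReal.ofReal (64 * K) * ENNReal.ofReal (1 / (σ ^ 2 + (t - (ρ : ℂ).im) ^ 2))) := by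
  classical
  set s : ℂ := ((1 / 2 + σ : ℝ) : ℂ) + t * Complex.I with hsdef
  have hsre : s.re = 1 / 2 + σ := by simp [hsdef]
  have hsim : s.im = t := by simp [hsdef]
  have hs' : 1 / 2 < s.re := by linarith
  have hK := hV.pos
  set B := ∑ ρ ∈ S, ((analyticOrderNatAt f ρ : ℝ) / ‖ρ‖ + 2 * analyticOrderNatAt f ρ)
  have hB : 0 ≤ B := Finset.sum_nonneg fun _ _ => by positivity
  obtain ⟨T, hT, hTs, hTz⟩ := hV.exists_finset t
  have h1 := norm_mul_truncatedTransform_le hS hT hs' hsim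
    (hTz s hs'.le (by linarith) hsim (hRH s hs'))
  set w := (1 + |t|) ^ (1 / 8 : ℝ) with hw
  have hw0 : 0 < w := by positivity
  set X := ∑ ρ ∈ T \ S, (analyticOrderNatAt f ρ : ℝ) / ‖s - ρ‖
  set Y := ∑ ρ ∈ T \ S, (analyticOrderNatAt f ρ : ℝ) / ‖s - ρ‖ ^ 2 with hY
  have hY0 : 0 ≤ Y := Finset.sum_nonneg fun _ _ => by positivity
  have hX0 : 0 ≤ X := Finset.sum_nonneg fun _ _ => by positivity
  have hXY : X ^ 2 ≤ K * w * Y := by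
    have hcs := Finset.sum_sq_le_sum_mul_sum_of_sq_le_mul (T \ S)
      (r := fun ρ => (analyticOrderNatAt f ρ : ℝ) / ‖s - ρ‖)
      (f := fun ρ => (analyticOrderNatAt f ρ : ℝ))
      (g := fun ρ => (analyticOrderNatAt f ρ : ℝ) / ‖s - ρ‖ ^ 2)
      (fun _ _ => by positivity) (fun _ _ => by positivity) (fun _ _ => le_of_eq (by ring))
    refine hcs.trans ?_
    gcongr
    refine le_trans ?_ hTs
    exact Finset.sum_le_sum_of_subset_of_nonneg Finset.sdiff_subset fun _ _ _ => by positivity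
  rw [norm_mul] at h1
  set g := ‖truncatedTransform f S s‖ with hg
  have hg0 : 0 ≤ g := norm_nonneg _
  have h2 : (‖s‖ * g) ^ 2 ≤ 2 * ((K + B) * w) ^ 2 + 2 * (K * w * Y) := by
    have h3 : (‖s‖ * g) ^ 2 ≤ ((K + B) * w + X) ^ 2 := by gcongr
    nlinarith [sq_nonneg ((K + B) * w - X)]
  have h4 : (1 + |t|) ^ 2 * g ^ 2 ≤ 16 * (K + B) ^ 2 * w ^ 2 + 16 * K * w * Y := by
    have h5 := one_add_abs_im_sq_le hs'.le
    rw [hsim] at h5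
    have h6 : (1 + |t|) ^ 2 * g ^ 2 ≤ 8 * ‖s‖ ^ 2 * g ^ 2 := by gcongr
    nlinarith
  have hpos : 0 < 1 + |t| := by positivity
  have e1 : (1 + |t|) ^ (-(7 / 4) : ℝ) * (1 + |t|) ^ 2 = w ^ 2 := by
    rw [hw, ← Real.rpow_natCast, ← Real.rpow_natCast, ← Real.rpow_add hpos,
      ← Real.rpow_mul hpos.le]
    norm_num
  have e2 : (1 + |t|) ^ (-(15 / 8) : ℝ) * (1 + |t|) ^ 2 = w := by
    rw [hw, ← Real.rpow_natCast, ← Real.rpow_add hpos]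
    norm_num
  have h7 : g ^ 2 ≤ 16 * (K + B) ^ 2 * (1 + |t|) ^ (-(7 / 4) : ℝ) +
      16 * K * (1 + |t|) ^ (-(15 / 8) : ℝ) * Y := by
    refine le_of_mul_le_mul_left ?_ (show 0 < (1 + |t|) ^ 2 by positivity)
    calc _ ≤ _ := h4
      _ = _ := by linear_combination (-(16 * (K + B) ^ 2)) * e1 - 16 * K * Y * e2
  have h8 : 16 * K * (1 + |t|) ^ (-(15 / 8) : ℝ) * Y ≤
      ∑ ρ ∈ T \ S, zeroWeight f ρ * (64 * K * (1 / (σ ^ 2 + (t - ρ.im) ^ 2))) := by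
    rw [hY, Finset.mul_sum]
    refine Finset.sum_le_sum fun ρ hρ => ?_
    obtain ⟨-, hre, him⟩ := (hT ρ).1 (Finset.mem_sdiff.1 hρ).1
    have hn : ‖s - ρ‖ ^ 2 = σ ^ 2 + (t - ρ.im) ^ 2 := by
      rw [Complex.sq_norm, Complex.normSq_apply, Complex.sub_re, Complex.sub_im, hsre, hsim, hre]
      ring
    have h9 := one_add_abs_rpow_le_four_mul (a := t) (b := ρ.im) (by rwa [abs_sub_comm])
    rw [hn, zeroWeight]
    calc 16 * K * (1 + |t|) ^ (-(15 / 8) : ℝ) *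
          ((analyticOrderNatAt f ρ : ℝ) / (σ ^ 2 + (t - ρ.im) ^ 2))
        ≤ 16 * K * (4 * (1 + |ρ.im|) ^ (-(15 / 8) : ℝ)) *
          ((analyticOrderNatAt f ρ : ℝ) / (σ ^ 2 + (t - ρ.im) ^ 2)) := by gcongr
      _ = _ := by ring
  have h10 : ENNReal.ofReal (∑ ρ ∈ T \ S,
      zeroWeight f ρ * (64 * K * (1 / (σ ^ 2 + (t - ρ.im) ^ 2)))) ≤
      ∑' ρ : criticalZeros f, (if (ρ : ℂ) ∈ S then 0 else ENNReal.ofReal (zeroWeight f ρ)) *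
        (ENNReal.ofReal (64 * K) * ENNReal.ofReal (1 / (σ ^ 2 + (t - (ρ : ℂ).im) ^ 2))) := by
    rw [ENNReal.ofReal_sum_of_nonneg fun ρ _ =>
      mul_nonneg (zeroWeight_nonneg f ρ) (by positivity),
      ← Finset.sum_subtype_of_mem (p := (· ∈ criticalZeros f)) _ fun ρ hρ => by
        obtain ⟨h0, hre, -⟩ := (hT ρ).1 (Finset.mem_sdiff.1 hρ).1
        exact ⟨h0, hre⟩]
    refine le_trans (le_of_eq ?_) (ENNReal.sum_le_tsum
      (Finset.subtype (· ∈ criticalZeros f) (T \ S)))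
    refine Finset.sum_congr rfl fun ρ hρ => ?_
    have hρS : (ρ : ℂ) ∉ S := (Finset.mem_sdiff.1 (Finset.mem_subtype.1 hρ)).2
    rw [if_neg hρS, ← ENNReal.ofReal_mul (by positivity),
      ← ENNReal.ofReal_mul (zeroWeight_nonneg f ρ)]
  calc ‖truncatedTransform f S s‖ₑ ^ 2 = ENNReal.ofReal (g ^ 2) := by
        rw [← ofReal_norm, ← ENNReal.ofReal_pow (norm_nonneg _)]
    _ ≤ ENNReal.ofReal (16 * (K + B) ^ 2 * (1 + |t|) ^ (-(7 / 4) : ℝ) +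
        16 * K * (1 + |t|) ^ (-(15 / 8) : ℝ) * Y) := ENNReal.ofReal_le_ofReal h7
    _ ≤ ENNReal.ofReal (16 * (K + B) ^ 2 * (1 + |t|) ^ (-(7 / 4) : ℝ)) +
        ENNReal.ofReal (16 * K * (1 + |t|) ^ (-(15 / 8) : ℝ) * Y) := ENNReal.ofReal_add_le
    _ ≤ _ := by
        gcongr
        exact (ENNReal.ofReal_le_ofReal h8).trans h10

/-- The weight of the zeros on the critical line outside `S`. -/
noncomputable def tailWeight (f : ℂ → ℂ) (S : Finset ℂ) : ENNReal :=
  open Classical in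
  ∑' ρ : criticalZeros f, (if (ρ : ℂ) ∈ S then 0 else ENNReal.ofReal (zeroWeight f ρ))

theorem exists_tailWeight_le {f : ℂ → ℂ} (hsum : Summable fun ρ : criticalZeros f => zeroWeight f ρ)
    {ε : ENNReal} (hε : 0 < ε) :
    ∃ S₀ : Finset ℂ, (∀ ρ ∈ S₀, f ρ = 0 ∧ ρ.re = 1 / 2) ∧
      ∀ S : Finset ℂ, S₀ ⊆ S → tailWeight f S ≤ ε := by
  have htop : ∑' ρ : criticalZeros f, ENNReal.ofReal (zeroWeight f ρ) ≠ ⊤ :=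
    hsum.tsum_ofReal_ne_top
  have h := (ENNReal.tendsto_tsum_compl_atTop_zero htop).eventually (gt_mem_nhds hε)
  obtain ⟨S₁, hS₁⟩ := h.exists
  refine ⟨S₁.map (Function.Embedding.subtype _), ?_, fun S hS => ?_⟩
  · intro ρ hρ
    obtain ⟨x, -, rfl⟩ := Finset.mem_map.1 hρ
    exact x.2
  · refine le_trans ?_ hS₁.le
    rw [show (∑' b : {x // x ∉ S₁}, ENNReal.ofReal (zeroWeight f ((b : criticalZeros f) : ℂ))) =
      ∑' b, {x | x ∉ S₁}.indicator (fun b : criticalZeros f => ENNReal.ofReal (zeroWeight f b)) b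
      from tsum_subtype {x | x ∉ S₁}
        (fun b : criticalZeros f => ENNReal.ofReal (zeroWeight f b)), tailWeight]
    refine ENNReal.tsum_le_tsum fun ρ => ?_
    by_cases hρ : (ρ : ℂ) ∈ S
    · simp [hρ]
    · rw [if_neg hρ, Set.indicator_of_mem]
      intro h
      exact hρ (hS (Finset.mem_map.2 ⟨ρ, h, rfl⟩))

theorem exists_lintegral_truncatedTransform_le {f : ℂ → ℂ} (hf : Differentiable ℂ f) {K : ℝ}
    (hV : VerticalZeroBound f K) (hRH : ∀ s : ℂ, 1 / 2 < s.re → f s ≠ 0) {S : Finset ℂ}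
    (hS : ∀ ρ ∈ S, f ρ = 0 ∧ ρ.re = 1 / 2) :
    ∃ A : ℝ, 0 ≤ A ∧ ∀ σ : ℝ, 0 < σ → σ ≤ 1 →
      ∫⁻ t : ℝ, ‖truncatedTransform f S (((1 / 2 + σ : ℝ) : ℂ) + t * Complex.I)‖ₑ ^ 2 ≤
        ENNReal.ofReal A + tailWeight f S * ENNReal.ofReal (64 * K * Real.pi / σ) := by
  classical
  have hK := hV.pos
  set D := 16 * (K + ∑ ρ ∈ S, ((analyticOrderNatAt f ρ : ℝ) / ‖ρ‖ +
        2 * analyticOrderNatAt f ρ)) ^ 2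
  have hintg : Integrable fun t : ℝ => D * (1 + |t|) ^ (-(7 / 4) : ℝ) :=
    (integrable_one_add_abs_rpow (by norm_num)).const_mul _
  have hnn : ∀ t : ℝ, 0 ≤ D * (1 + |t|) ^ (-(7 / 4) : ℝ) := fun t => by positivity
  have hcount : Countable (criticalZeros f) :=
    (countable_criticalZeros hf (hRH 2 (by norm_num))).to_subtype
  refine ⟨∫ t : ℝ, D * (1 + |t|) ^ (-(7 / 4) : ℝ), integral_nonneg hnn, fun σ hσ hσ1 => ?_⟩
  refine (lintegral_mono fun t => norm_sq_truncatedTransform_le hV hRH hS hσ hσ1 t).trans ?_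
  rw [lintegral_add_left (by fun_prop),
    ← ofReal_integral_eq_lintegral_ofReal hintg (Eventually.of_forall hnn),
    lintegral_tsum fun ρ => by fun_prop]
  refine add_le_add le_rfl (le_of_eq ?_)
  rw [tailWeight, ← ENNReal.tsum_mul_right]
  refine tsum_congr fun ρ => ?_
  rw [lintegral_const_mul _ (by fun_prop), lintegral_const_mul _ (by fun_prop),
    lintegral_inv_sq_add_sq hσ, ← ENNReal.ofReal_mul (by positivity)]
  congr 2
  ring

/-- The mean of `‖h‖²` over `(0, U]` is eventually at most `ε`. -/
def MeanSquareLE {E : Type*} [NormedAddCommGroup E] (h : ℝ → E) (ε : ℝ) : Prop :=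
  ∀ᶠ U : ℝ in atTop, ∫⁻ u in Set.Ioc 0 U, ‖h u‖ₑ ^ 2 ≤ ENNReal.ofReal (ε * U)

theorem lintegral_Ioc_norm_sq_le (g : ℝ → ℂ) (a : ℝ) {U : ℝ} (hU : 0 < U) :
    ∫⁻ u in Set.Ioc 0 U, ‖g u * Real.exp (-(a * u))‖ₑ ^ 2 ≤ ENNReal.ofReal (Real.exp 2) *
      ∫⁻ u in Set.Ioi (0 : ℝ), ENNReal.ofReal (‖g u‖ ^ 2 * Real.exp (-2 * (a + 1 / U) * u)) := by
  rw [← lintegral_const_mul' _ _ ENNReal.ofReal_ne_top]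
  refine le_trans ?_ (lintegral_mono_set (Set.Ioc_subset_Ioi_self (b := (0:ℝ)) (a := U)))
  refine setLIntegral_mono' measurableSet_Ioc fun u hu => ?_
  rw [← ENNReal.ofReal_mul (by positivity), ← ofReal_norm,
    ← ENNReal.ofReal_pow (norm_nonneg _)]
  refine ENNReal.ofReal_le_ofReal ?_
  have h1 : u / U ≤ 1 := (div_le_one hU).2 hu.2
  have h2 : ‖g u * (Real.exp (-(a * u)) : ℂ)‖ ^ 2 = ‖g u‖ ^ 2 * Real.exp (-2 * a * u) := by
    rw [norm_mul, Complex.norm_real, Real.norm_of_nonneg (Real.exp_pos _).le, mul_pow,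
      ← Real.exp_nat_mul]
    congr 2; push_cast; ring
  rw [h2, mul_left_comm, ← Real.exp_add]
  gcongr
  have : -2 * (a + 1 / U) * u = -2 * a * u - 2 * (u / U) := by ring
  linarith

theorem exists_meanSquareLE_truncated {f : ℂ → ℂ} (hf : Differentiable ℂ f) {K : ℝ}
    (hV : VerticalZeroBound f K) (hRH : ∀ s : ℂ, 1 / 2 < s.re → f s ≠ 0) {K₂ : ℝ}
    (hK₂ : ∀ s : ℂ, 13 / 10 ≤ s.re → ‖logDeriv f s‖ ≤ K₂) {g : ℝ → ℂ} (hg : Measurable g)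
    {C : ℝ} (hC : ∀ u > 0, ‖g u‖ ≤ C * Real.exp (1 * u))
    (hgl : ∀ s : ℂ, 1 < s.re → laplaceTransform g s = -logDeriv f s / s) {ε : ℝ} (hε : 0 < ε) :
    ∃ S₀ : Finset ℂ, (∀ ρ ∈ S₀, f ρ = 0 ∧ ρ.re = 1 / 2) ∧ ∀ S : Finset ℂ, S₀ ⊆ S →
      (∀ ρ ∈ S, f ρ = 0 ∧ ρ.re = 1 / 2) →
      MeanSquareLE (fun u : ℝ => (g u + ∑ ρ ∈ S, (analyticOrderNatAt f ρ : ℂ) / ρ *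
        Complex.exp (ρ * u)) * Real.exp (-(1 / 2 * u))) ε := by
  have hK := hV.pos
  have hpi := Real.pi_pos
  have he2 := Real.exp_pos 2
  set η : ℝ := ε / (64 * K * Real.exp 2) with hη
  obtain ⟨S₀, hS₀, htail⟩ := exists_tailWeight_le hV.summable
    (ε := ENNReal.ofReal η) (by rw [ENNReal.ofReal_pos]; positivity)
  refine ⟨S₀, hS₀, fun S hSS hS => ?_⟩
  obtain ⟨A, hA0, hA⟩ := exists_lintegral_truncatedTransform_le hf hV hRH hS
  set g' : ℝ → ℂ := fun u => g u + ∑ ρ ∈ S, (analyticOrderNatAt f ρ : ℂ) / ρ *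
    Complex.exp (ρ * u) with hg'
  have hg'm : Measurable g' := by fun_prop
  set B := ∑ ρ ∈ S, ‖(analyticOrderNatAt f ρ : ℂ) / ρ‖
  have hexp : ∀ ρ ∈ S, ∀ u : ℝ, ‖Complex.exp (ρ * u)‖ = Real.exp (1 / 2 * u) := by
    intro ρ hρ u
    rw [Complex.norm_exp]; simp [(hS ρ hρ).2]
  have hg'C : ∀ u > 0, ‖g' u‖ ≤ (C + B) * Real.exp (1 * u) := by
    intro u hu
    refine (norm_add_le _ _).trans ?_
    rw [add_mul]
    refine add_le_add (hC u hu) ((norm_sum_le _ _).trans ?_)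
    rw [Finset.sum_mul]
    refine Finset.sum_le_sum fun ρ hρ => ?_
    rw [norm_mul, hexp ρ hρ]
    gcongr
    norm_num
  have hG : ∀ s : ℂ, 1 < s.re → truncatedTransform f S s = laplaceTransform g' s := by
    intro s hs
    have hintg := integrableOn_laplaceTransform hg hC hs
    have hint2 : ∀ ρ ∈ S, IntegrableOn (fun u : ℝ => (analyticOrderNatAt f ρ : ℂ) / ρ *
        (Complex.exp (ρ * u) * Complex.exp (-s * u))) (Set.Ioi 0) := by
      intro ρ hρ
      refine Integrable.const_mul (integrableOn_laplaceTransform (b := 1 / 2) (C := 1)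
        (by fun_prop) (fun u _ => ?_) (by linarith)) _
      rw [hexp ρ hρ, one_mul]
    have h1 : laplaceTransform g' s = laplaceTransform g s + ∑ ρ ∈ S,
        (analyticOrderNatAt f ρ : ℂ) / ρ *
          laplaceTransform (fun u => Complex.exp (ρ * u)) s := by
      unfold laplaceTransform
      simp_rw [← integral_const_mul]
      rw [← integral_finsetSum _ hint2, ← integral_add hintg (integrable_finsetSum _ hint2)]
      refine setIntegral_congr_fun measurableSet_Ioi fun u _ => ?_
      simp only [hg', add_mul, Finset.sum_mul, mul_assoc]
    rw [h1, hgl s hs, truncatedTransform]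
    congr 1
    refine Finset.sum_congr rfl fun ρ hρ => ?_
    rw [laplaceTransform_exp (by rw [(hS ρ hρ).2]; linarith), mul_one_div]
  have hS' : ∀ ρ ∈ S, ρ.re = 1 / 2 := fun ρ hρ => (hS ρ hρ).2
  have hplan : ∀ U : ℝ, 1 ≤ U → ∫⁻ u in Set.Ioc 0 U, ‖g' u * Real.exp (-(1 / 2 * u))‖ₑ ^ 2 ≤
      ENNReal.ofReal (Real.exp 2 * (A + η * (64 * K * Real.pi * U)) / (2 * Real.pi)) := by
    intro U hU
    have hU0 : 0 < U := by linarith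
    have hU1 : 1 / U ≤ 1 := (div_le_one hU0).2 hU
    refine (lintegral_Ioc_norm_sq_le g' (1 / 2) hU0).trans ?_
    have h1 := lintegral_laplaceTransform_extension hg'm hg'C
      (differentiableOn_truncatedTransform hf hRH hS') hG
      (norm_truncatedTransform_le hV hRH hK₂ hS) (σ := 1 / 2 + 1 / U)
      (by linarith [show 0 < 1 / U by positivity])
    have h2 := hA (1 / U) (by positivity) hU1
    rw [← h1] at h2
    have h3 : ENNReal.ofReal A + tailWeight f S * ENNReal.ofReal (64 * K * Real.pi / (1 / U)) ≤
        ENNReal.ofReal (A + η * (64 * K * Real.pi * U)) := by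
      rw [ENNReal.ofReal_add hA0 (by positivity), ENNReal.ofReal_mul (by positivity)]
      gcongr
      · exact htail S hSS
      · apply le_of_eq; field_simp
    have h4 := h2.trans h3
    rw [mul_comm, ← ENNReal.le_div_iff_mul_le (by simp [hpi]) (by simp),
      ← ENNReal.ofReal_div_of_pos (by positivity)] at h4
    refine (mul_le_mul_right h4 _).trans ?_
    rw [← ENNReal.ofReal_mul he2.le]
    apply le_of_eq; congr 1; ring
  filter_upwards [eventually_ge_atTop (1 : ℝ),
    eventually_ge_atTop (Real.exp 2 * A / (2 * Real.pi) / (ε / 2))] with U hU hU2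
  refine (hplan U hU).trans (ENNReal.ofReal_le_ofReal ?_)
  rw [div_le_iff₀ (by positivity)] at hU2
  have : Real.exp 2 * (A + η * (64 * K * Real.pi * U)) / (2 * Real.pi) =
      Real.exp 2 * A / (2 * Real.pi) + ε / 2 * U := by
    rw [hη]; field_simp
  linarith

theorem sum_vonMangoldt_le (n : ℕ) :
    ∑ k ∈ Finset.Icc 1 n, ArithmeticFunction.vonMangoldt k ≤ (Real.log 4 + 4) * n := by
  have h := Chebyshev.psi_le_const_mul_self (x := n) (Nat.cast_nonneg n)
  rw [Chebyshev.psi, Nat.floor_natCast] at h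
  exact h

/-- The summatory function of the von Mangoldt function twisted by `χ₋₄`, at `exp u`. -/
noncomputable def psiChi (u : ℝ) : ℂ :=
  ∑ k ∈ Finset.Icc 1 ⌊Real.exp u⌋₊,
    chiMinusFour (k : ZMod 4) * (ArithmeticFunction.vonMangoldt k : ℂ)

theorem sum_norm_twist_vonMangoldt_le (n : ℕ) :
    ∑ k ∈ Finset.Icc 1 n, ‖chiMinusFour (k : ZMod 4) * (ArithmeticFunction.vonMangoldt k : ℂ)‖ ≤
      (Real.log 4 + 4) * n := by
  refine le_trans (Finset.sum_le_sum fun k _ => ?_) (sum_vonMangoldt_le n)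
  rw [norm_mul, Complex.norm_real, Real.norm_of_nonneg ArithmeticFunction.vonMangoldt_nonneg]
  exact mul_le_of_le_one_left ArithmeticFunction.vonMangoldt_nonneg (norm_chiMinusFour_le k)

theorem measurable_psiChi : Measurable psiChi :=
  measurable_summatory_exp
    (fun k => chiMinusFour (k : ZMod 4) * (ArithmeticFunction.vonMangoldt k : ℂ))

theorem norm_psiChi_le (u : ℝ) : ‖psiChi u‖ ≤ (Real.log 4 + 4) * Real.exp (1 * u) := by
  have h4 : 0 ≤ Real.log 4 := Real.log_nonneg (by norm_num)
  refine (norm_sum_le _ _).trans ((sum_norm_twist_vonMangoldt_le _).trans ?_)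
  rw [one_mul]
  gcongr
  exact Nat.floor_le (Real.exp_pos u).le

theorem LSeries_twist_vonMangoldt_chiMinusFour {s : ℂ} (hs : 1 < s.re) :
    LSeries (fun k => chiMinusFour (k : ZMod 4) * (ArithmeticFunction.vonMangoldt k : ℂ)) s =
      -logDeriv (DirichletCharacter.LFunction chiMinusFour) s := by
  have h := DirichletCharacter.LSeries_twist_vonMangoldt_eq chiMinusFour hs
  rw [← DirichletCharacter.deriv_LFunction_eq_deriv_LSeries _ hs,
    ← DirichletCharacter.LFunction_eq_LSeries _ hs, neg_div] at h
  exact h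

theorem laplaceTransform_psiChi {s : ℂ} (hs : 1 < s.re) :
    laplaceTransform psiChi s =
      -logDeriv (DirichletCharacter.LFunction chiMinusFour) s / s := by
  have hs0 : s ≠ 0 := by rintro rfl; norm_num at hs
  rw [← LSeries_twist_vonMangoldt_chiMinusFour hs,
    LSeries_eq_mul_laplaceTransform sum_norm_twist_vonMangoldt_le hs, mul_div_cancel_left₀ _ hs0]
  rfl

theorem exists_norm_logDeriv_LFunction_le : ∃ K₂ : ℝ, ∀ s : ℂ, 13 / 10 ≤ s.re →
    ‖logDeriv (DirichletCharacter.LFunction chiMinusFour) s‖ ≤ K₂ := by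
  have h13 : (1 : ℝ) < ((13 / 10 : ℝ) : ℂ).re := by rw [Complex.ofReal_re]; norm_num
  obtain ⟨K, -, hb⟩ := exists_norm_LSeries_le (DirichletCharacter.LSeriesSummable_mul chiMinusFour
    (ArithmeticFunction.LSeriesSummable_vonMangoldt h13))
  refine ⟨K, fun s hs => ?_⟩
  rw [← norm_neg, ← LSeries_twist_vonMangoldt_chiMinusFour (by linarith)]
  exact hb s hs

/-- The Riemann hypothesis for `L(s, χ₋₄)`. -/
def RHChi : Prop := ∀ ρ : ℂ, DirichletCharacter.LFunction chiMinusFour ρ = 0 →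
  0 < ρ.re → ρ.re < 1 → ρ.re = 1 / 2

theorem RHChi.re_eq (h : RHChi) {ρ : ℂ} (h0 : DirichletCharacter.LFunction chiMinusFour ρ = 0)
    (hre : 0 < ρ.re) : ρ.re = 1 / 2 := by
  by_contra hne
  have h1 : 1 ≤ ρ.re := by
    by_contra! hlt
    exact hne (h ρ h0 hre hlt)
  exact DirichletCharacter.LFunction_ne_zero_of_one_le_re chiMinusFour
    (Or.inl chiMinusFour_ne_one) h1 h0

theorem RHChi.exists_verticalZeroBound (h : RHChi) :
    ∃ K, VerticalZeroBound (DirichletCharacter.LFunction chiMinusFour) K := by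
  obtain ⟨c₀, hc₀, hlow⟩ := exists_le_norm_LFunction_chiMinusFour
  exact _root_.exists_verticalZeroBound
    (DirichletCharacter.differentiable_LFunction chiMinusFour_ne_one) (A := 25) (by norm_num) hc₀
    hlow norm_LFunction_chiMinusFour_le_sq fun ρ h0 hre => h.re_eq h0 hre

theorem RHChi.exists_meanSquareLE (h : RHChi) {ε : ℝ} (hε : 0 < ε) :
    ∃ S₀ : Finset ℂ, (∀ ρ ∈ S₀, DirichletCharacter.LFunction chiMinusFour ρ = 0 ∧ ρ.re = 1 / 2) ∧
      ∀ S : Finset ℂ, S₀ ⊆ S →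
      (∀ ρ ∈ S, DirichletCharacter.LFunction chiMinusFour ρ = 0 ∧ ρ.re = 1 / 2) →
      MeanSquareLE (fun u : ℝ => (psiChi u + ∑ ρ ∈ S,
        (analyticOrderNatAt (DirichletCharacter.LFunction chiMinusFour) ρ : ℂ) / ρ *
        Complex.exp (ρ * u)) * Real.exp (-(1 / 2 * u))) ε := by
  obtain ⟨K, hK⟩ := h.exists_verticalZeroBound
  obtain ⟨K₂, hK₂⟩ := exists_norm_logDeriv_LFunction_le
  refine exists_meanSquareLE_truncated
    (DirichletCharacter.differentiable_LFunction chiMinusFour_ne_one) hK ?_ hK₂ measurable_psiChi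
    (fun u _ => norm_psiChi_le u) (fun s hs => laplaceTransform_psiChi hs) hε
  intro s hs h0
  have := h.re_eq h0 (by linarith)
  linarith

theorem logDeriv_riemannZeta {s : ℂ} (hs : 1 < s.re) :
    logDeriv riemannZeta s = logDeriv riemannZeta₁ s - 1 / (s - 1) := by
  have hne : s ≠ 1 := by rintro rfl; simp at hs
  have hsub : s - 1 ≠ 0 := sub_ne_zero.2 hne
  have h0 : riemannZeta s ≠ 0 := riemannZeta_ne_zero_of_one_lt_re hs
  have h1 : riemannZeta₁ =ᶠ[𝓝 s] fun z => (z - 1) * riemannZeta z := by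
    filter_upwards [isOpen_ne.mem_nhds hne] with z hz
    rw [riemannZeta_eq_inv_sub_mul hz, mul_inv_cancel_left₀ (sub_ne_zero.2 hz)]
  have h2 : logDeriv riemannZeta₁ s = logDeriv (fun z => (z - 1) * riemannZeta z) s := by
    rw [logDeriv_apply, logDeriv_apply, h1.deriv_eq, h1.eq_of_nhds]
  rw [h2, logDeriv_mul (f := fun z => z - 1) (g := riemannZeta) s hsub h0 (by fun_prop)
    (differentiableAt_riemannZeta hne)]
  rw [logDeriv_apply (fun z : ℂ => z - 1)]
  simp

theorem laplaceTransform_psi_sub {s : ℂ} (hs : 1 < s.re) :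
    laplaceTransform (fun u => ((Chebyshev.psi (Real.exp u) - Real.exp u : ℝ) : ℂ)) s =
      -(logDeriv riemannZeta₁ s + 1) / s := by
  have hs0 : s ≠ 0 := by rintro rfl; norm_num at hs
  have hne : s ≠ 1 := by rintro rfl; simp at hs
  have hsub : s - 1 ≠ 0 := sub_ne_zero.2 hne
  have hnorm : ∀ n : ℕ, ∑ k ∈ Finset.Icc 1 n, ‖(ArithmeticFunction.vonMangoldt k : ℂ)‖ ≤
      (Real.log 4 + 4) * n := by
    intro n
    refine le_trans (le_of_eq (Finset.sum_congr rfl fun k _ => ?_)) (sum_vonMangoldt_le n)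
    rw [Complex.norm_real, Real.norm_of_nonneg ArithmeticFunction.vonMangoldt_nonneg]
  have h4 : 0 ≤ Real.log 4 := Real.log_nonneg (by norm_num)
  have h1 := LSeries_eq_mul_laplaceTransform hnorm hs
  rw [ArithmeticFunction.LSeries_vonMangoldt_eq_deriv_riemannZeta_div hs, neg_div,
    ← logDeriv_apply, logDeriv_riemannZeta hs] at h1
  have h2 : laplaceTransform (fun u => ((Chebyshev.psi (Real.exp u) - Real.exp u : ℝ) : ℂ)) s =
      laplaceTransform (fun u => ∑ k ∈ Finset.Icc 1 ⌊Real.exp u⌋₊,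
        (ArithmeticFunction.vonMangoldt k : ℂ)) s -
      laplaceTransform (fun u => Complex.exp (1 * u)) s := by
    unfold laplaceTransform
    rw [← integral_sub]
    · refine setIntegral_congr_fun measurableSet_Ioi fun u _ => ?_
      simp only [one_mul, Chebyshev.psi, ← sub_mul]
      push_cast
      rfl
    · refine integrableOn_laplaceTransform (b := 1) (C := Real.log 4 + 4)
        (measurable_summatory_exp _) (fun u _ => ?_) hs
      refine (norm_sum_le _ _).trans ((hnorm _).trans ?_)
      rw [one_mul]
      gcongr
      exact Nat.floor_le (Real.exp_pos u).le
    · exact integrableOn_laplaceTransform (b := 1) (C := 1) (by fun_prop)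
        (fun u _ => by simp [Complex.norm_exp]) hs
  rw [h2, laplaceTransform_exp (by simpa using hs)]
  field_simp
  field_simp at h1
  linear_combination -h1

/-- The Riemann hypothesis for `ζ`. -/
def RHZeta : Prop := ∀ ρ : ℂ, riemannZeta ρ = 0 → 0 < ρ.re → ρ.re < 1 → ρ.re = 1 / 2

theorem RHZeta.re_eq (h : RHZeta) {ρ : ℂ} (h0 : riemannZeta₁ ρ = 0)
    (hre : 0 < ρ.re) : ρ.re = 1 / 2 := by
  have hne : ρ ≠ 1 := by rintro rfl; simp at h0
  have hz : riemannZeta ρ = 0 := by rw [riemannZeta_eq_inv_sub_mul hne, h0, mul_zero]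
  by_contra hne'
  have h1 : 1 ≤ ρ.re := by
    by_contra! hlt
    exact hne' (h ρ hz hre hlt)
  exact riemannZeta_ne_zero_of_one_le_re h1 hz

theorem RHZeta.exists_norm_logDeriv_le (h : RHZeta) : ∃ K > 0, ∀ s : ℂ, 1 ≤ s.re → s.re ≤ 2 →
    ‖logDeriv riemannZeta₁ s‖ ≤ K * (1 + |s.im|) ^ (1 / 8 : ℝ) := by
  obtain ⟨c₀, hc₀, hlow⟩ := exists_le_norm_riemannZeta₁
  obtain ⟨K, hV⟩ := exists_verticalZeroBound differentiable_riemannZeta₁ (A := 100)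
    (by norm_num) hc₀ hlow norm_riemannZeta₁_le_sq fun ρ h0 hre => h.re_eq h0 hre
  have hK := hV.pos
  refine ⟨3 * K, by positivity, fun s hs hs2 => ?_⟩
  obtain ⟨T, hT, hTs, hTz⟩ := hV.exists_finset s.im
  have hb := hTz s (by linarith) hs2 rfl fun h0 => by
    have := h.re_eq h0 (by linarith); linarith
  have h2 : ‖∑ ρ ∈ T, (analyticOrderNatAt riemannZeta₁ ρ : ℂ) / (s - ρ)‖ ≤
      2 * (K * (1 + |s.im|) ^ (1 / 8 : ℝ)) := by
    refine (norm_sum_le _ _).trans ?_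
    calc _ ≤ ∑ ρ ∈ T, 2 * (analyticOrderNatAt riemannZeta₁ ρ : ℝ) := by
          refine Finset.sum_le_sum fun ρ hρ => ?_
          have h5 := (le_abs_self _).trans (Complex.abs_re_le_norm (s - ρ))
          rw [Complex.sub_re, ((hT ρ).1 hρ).2.1] at h5
          rw [norm_div, Complex.norm_natCast, div_le_iff₀ (by linarith)]
          nlinarith [(Nat.cast_nonneg (analyticOrderNatAt riemannZeta₁ ρ) : (0:ℝ) ≤ _)]
      _ ≤ _ := by rw [← Finset.mul_sum]; gcongr
  have := norm_le_norm_sub_add (logDeriv riemannZeta₁ s)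
    (∑ ρ ∈ T, (analyticOrderNatAt riemannZeta₁ ρ : ℂ) / (s - ρ))
  linarith

theorem RHZeta.exists_lintegral_psi_sub_le (h : RHZeta) : ∃ A : ℝ, ∀ U : ℝ, 1 ≤ U →
    ∫⁻ u in Set.Ioc 0 U, ‖((Chebyshev.psi (Real.exp u) - Real.exp u : ℝ) : ℂ) *
      Real.exp (-(1 * u))‖ₑ ^ 2 ≤ ENNReal.ofReal A := by
  obtain ⟨K, hK, hb⟩ := h.exists_norm_logDeriv_le
  set g : ℝ → ℂ := fun u => ((Chebyshev.psi (Real.exp u) - Real.exp u : ℝ) : ℂ) with hgdef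
  have hgm : Measurable g := by
    have h1 : Measurable fun u => Chebyshev.psi (Real.exp u) :=
      Chebyshev.psi_mono.measurable.comp Real.measurable_exp
    exact Complex.measurable_ofReal.comp (h1.sub Real.measurable_exp)
  have h4 : 0 ≤ Real.log 4 := Real.log_nonneg (by norm_num)
  have hgC : ∀ u > 0, ‖g u‖ ≤ (Real.log 4 + 4 + 1) * Real.exp (1 * u) := by
    intro u _
    simp only [hgdef]
    rw [Complex.norm_real, one_mul, Real.norm_eq_abs]
    have h1 := Chebyshev.psi_le_const_mul_self (x := Real.exp u) (Real.exp_pos u).le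
    have h2 := Chebyshev.psi_nonneg (Real.exp u)
    have h3 := Real.exp_pos u
    rw [abs_le]
    constructor <;> nlinarith
  have hintg : Integrable fun t : ℝ => (3 * (K + 1)) ^ 2 * (1 + |t|) ^ (-(7 / 4) : ℝ) :=
    (integrable_one_add_abs_rpow (by norm_num)).const_mul _
  set A := ∫ t : ℝ, (3 * (K + 1)) ^ 2 * (1 + |t|) ^ (-(7 / 4) : ℝ)
  refine ⟨Real.exp 2 * (A / (2 * Real.pi)), fun U hU => ?_⟩
  have hU0 : 0 < U := by linarith
  have hU1 : 1 / U ≤ 1 := (div_le_one hU0).2 hU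
  have hU2 : 0 < 1 / U := by positivity
  refine (lintegral_Ioc_norm_sq_le g 1 hU0).trans ?_
  have h1 := lintegral_laplaceTransform_sq hgm hgC (σ := 1 + 1 / U) (by linarith)
  have h2 : ∫⁻ t : ℝ, ‖laplaceTransform g (((1 + 1 / U : ℝ) : ℂ) + t * Complex.I)‖ₑ ^ 2 ≤
      ENNReal.ofReal A := by
    rw [ofReal_integral_eq_lintegral_ofReal hintg (Eventually.of_forall fun t => by positivity)]
    refine lintegral_mono fun t => ?_
    set s : ℂ := ((1 + 1 / U : ℝ) : ℂ) + t * Complex.I with hsdef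
    have hsre : s.re = 1 + 1 / U := by simp [hsdef]
    have hsim : s.im = t := by simp [hsdef]
    have hs3 := one_add_abs_im_le (s := s) (by linarith)
    have hb' := hb s (by linarith) (by linarith)
    rw [hsim] at hs3 hb'
    have hw : 1 ≤ (1 + |t|) ^ (1 / 8 : ℝ) :=
      Real.one_le_rpow (by linarith [abs_nonneg t]) (by norm_num)
    have hspos : 0 < ‖s‖ := by nlinarith [abs_nonneg t]
    rw [laplaceTransform_psi_sub (by linarith), ← ofReal_norm,
      ← ENNReal.ofReal_pow (norm_nonneg _)]
    refine ENNReal.ofReal_le_ofReal ?_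
    have h3 : ‖-(logDeriv riemannZeta₁ s + 1) / s‖ ≤
        3 * (K + 1) * (1 + |t|) ^ (-(7 / 8) : ℝ) := by
      rw [norm_div, norm_neg, div_le_iff₀ hspos]
      have h5 : (1 + |t|) ^ (1 / 8 : ℝ) = (1 + |t|) ^ (-(7 / 8) : ℝ) * (1 + |t|) := by
        nth_rewrite 3 [← Real.rpow_one (1 + |t|)]
        rw [← Real.rpow_add (by positivity)]
        norm_num
      calc ‖logDeriv riemannZeta₁ s + 1‖ ≤ ‖logDeriv riemannZeta₁ s‖ + 1 := by
            simpa using norm_add_le (logDeriv riemannZeta₁ s) 1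
        _ ≤ (K + 1) * ((1 + |t|) ^ (-(7 / 8) : ℝ) * (1 + |t|)) := by rw [← h5]; nlinarith
        _ ≤ (K + 1) * ((1 + |t|) ^ (-(7 / 8) : ℝ) * (3 * ‖s‖)) := by gcongr
        _ = _ := by ring
    calc _ ≤ (3 * (K + 1) * (1 + |t|) ^ (-(7 / 8) : ℝ)) ^ 2 := by gcongr
      _ = _ := by
          rw [mul_pow, ← Real.rpow_natCast ((1 + |t|) ^ (-(7 / 8) : ℝ)),
            ← Real.rpow_mul (by positivity)]
          norm_num
  rw [h1, mul_comm, ← ENNReal.le_div_iff_mul_le (by simp [Real.pi_pos]) (by simp),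
      ← ENNReal.ofReal_div_of_pos (by positivity)] at h2
  refine (mul_le_mul_right h2 _).trans ?_
  rw [← ENNReal.ofReal_mul (by positivity)]

/-- The real-valued version of `chiMinusFour` on natural numbers. -/
noncomputable def chiReal (n : ℕ) : ℝ := if n % 4 = 1 then 1 else if n % 4 = 3 then -1 else 0

theorem chiMinusFour_eq_chiReal (n : ℕ) : chiMinusFour (n : ZMod 4) = (chiReal n : ℂ) := by
  rw [chiMinusFour_natCast_eq, chiReal]
  split_ifs <;> simp

theorem abs_chiReal_le (n : ℕ) : |chiReal n| ≤ 1 := by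
  rw [chiReal]; split_ifs <;> simp

theorem chiReal_sq_of_prime {p : ℕ} (hp : p.Prime) : chiReal (p ^ 2) = if p = 2 then 0 else 1 := by
  split_ifs with h
  · subst h; simp [chiReal]
  · have h1 := (hp.eq_two_or_odd).resolve_left h
    have h2 : p ^ 2 % 4 = 1 := by
      have h3 : p % 4 = 1 ∨ p % 4 = 3 := by omega
      rcases h3 with h3 | h3 <;> simp [Nat.pow_mod, h3]
    simp [chiReal, h2]

/-- The first Chebyshev function twisted by the nonprincipal character modulo `4`. -/
noncomputable def thetaChi (x : ℝ) : ℝ :=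
  ∑ p ∈ Finset.Ioc 0 ⌊x⌋₊ with p.Prime, chiReal p * Real.log p

open ArithmeticFunction in
theorem psiChi_eq_ofReal (u : ℝ) :
    psiChi u = ((∑ n ∈ Finset.Ioc 0 ⌊Real.exp u⌋₊, chiReal n * vonMangoldt n : ℝ) : ℂ) := by
  rw [psiChi, Complex.ofReal_sum]
  refine Finset.sum_congr (by ext; simp [Nat.succ_le_iff]) fun n _ => ?_
  rw [chiMinusFour_eq_chiReal]
  push_cast
  rfl

open ArithmeticFunction in
theorem sum_chiReal_mul_vonMangoldt_eq {x : ℝ} (hx : 0 ≤ x) {N : ℕ}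
    (hN : ⌊Real.log x / Real.log 2⌋₊ ≤ N) :
    ∑ n ∈ Finset.Ioc 0 ⌊x⌋₊, chiReal n * vonMangoldt n =
      ∑ k ∈ Finset.Icc 1 N, ∑ p ∈ Finset.Ioc 0 ⌊x ^ ((1 : ℝ) / k)⌋₊ with p.Prime,
        chiReal (p ^ k) * Real.log p := by
  have h := Chebyshev.sum_PrimePow_eq_sum_sum' (fun n => chiReal n * Real.log n.minFac) hx hN
  rw [Finset.sum_filter] at h
  simp_rw [vonMangoldt_apply, mul_ite, mul_zero]
  rw [h]
  refine Finset.sum_congr rfl fun k hk => Finset.sum_congr rfl fun p hp => ?_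
  rw [Nat.Prime.pow_minFac (Finset.mem_filter.1 hp).2 (by linarith [Finset.mem_Icc.mp hk])]

theorem abs_sum_chiReal_prime_pow_le (x : ℝ) (k : ℕ) :
    |∑ p ∈ Finset.Ioc 0 ⌊x⌋₊ with p.Prime, chiReal (p ^ k) * Real.log p| ≤ Chebyshev.theta x := by
  refine (Finset.abs_sum_le_sum_abs _ _).trans (Finset.sum_le_sum fun p _ => ?_)
  have h0 : 0 ≤ Real.log p := Real.log_natCast_nonneg p
  rw [abs_mul, abs_of_nonneg h0]
  exact mul_le_of_le_one_left h0 (abs_chiReal_le _)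

theorem abs_thetaChi_le (x : ℝ) : |thetaChi x| ≤ Chebyshev.theta x := by
  simpa [thetaChi] using abs_sum_chiReal_prime_pow_le x 1

theorem abs_sum_chiReal_prime_sq_sub_theta_le (x : ℝ) :
    |∑ p ∈ Finset.Ioc 0 ⌊x⌋₊ with p.Prime, chiReal (p ^ 2) * Real.log p - Chebyshev.theta x| ≤
      Real.log 2 := by
  rw [Chebyshev.theta, ← Finset.sum_sub_distrib]
  have h2 : 0 ≤ Real.log 2 := Real.log_nonneg (by norm_num)
  have : ∀ p ∈ (Finset.Ioc 0 ⌊x⌋₊).filter Nat.Prime,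
      chiReal (p ^ 2) * Real.log p - Real.log p = if p = 2 then -Real.log 2 else 0 := by
    intro p hp
    rw [chiReal_sq_of_prime (Finset.mem_filter.1 hp).2]
    split_ifs with h
    · subst h; simp
    · simp
  rw [Finset.sum_congr rfl this, Finset.sum_ite_eq']
  split_ifs
  · rw [abs_neg, abs_of_nonneg h2]
  · simpa using h2

open ArithmeticFunction in
theorem abs_psiChi_sub_thetaChi_sub_theta_sqrt_le {x : ℝ} (hx : 1 ≤ x) :
    |∑ n ∈ Finset.Ioc 0 ⌊x⌋₊, chiReal n * vonMangoldt n - thetaChi x - Chebyshev.theta (√x)| ≤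
      Real.log 2 + (Real.log x / Real.log 2 + 2) * (Real.log 4 * x ^ (1 / 3 : ℝ)) := by
  set N := ⌊Real.log x / Real.log 2⌋₊ with hN
  have hl2 : 0 < Real.log 2 := Real.log_pos (by norm_num)
  have hl4 : 0 < Real.log 4 := Real.log_pos (by norm_num)
  have hlx : 0 ≤ Real.log x / Real.log 2 := div_nonneg (Real.log_nonneg hx) hl2.le
  have hsplit : ∀ F : ℕ → ℝ, ∑ k ∈ Finset.Icc 1 (N + 2), F k =
      F 1 + (F 2 + ∑ k ∈ Finset.Ioc 2 (N + 2), F k) := by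
    intro F
    rw [Finset.add_sum_Ioc_eq_sum_Icc (by omega), ← Finset.add_sum_Ioc_eq_sum_Icc (by omega)]
    rfl
  rw [sum_chiReal_mul_vonMangoldt_eq (by linarith) (N := N + 2) (by omega), hsplit]
  have e1 : ∑ p ∈ Finset.Ioc 0 ⌊x ^ ((1 : ℝ) / (1 : ℕ))⌋₊ with p.Prime,
        chiReal (p ^ 1) * Real.log p = thetaChi x := by
    simp [thetaChi]
  have e2 := abs_sum_chiReal_prime_sq_sub_theta_le (√x)
  have e3 : |∑ k ∈ Finset.Ioc 2 (N + 2), ∑ p ∈ Finset.Ioc 0 ⌊x ^ ((1 : ℝ) / k)⌋₊ with p.Prime,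
        chiReal (p ^ k) * Real.log p| ≤
      (Real.log x / Real.log 2 + 2) * (Real.log 4 * x ^ (1 / 3 : ℝ)) := by
    refine (Finset.abs_sum_le_sum_abs _ _).trans ?_
    have : ∀ k ∈ Finset.Ioc 2 (N + 2), |∑ p ∈ Finset.Ioc 0 ⌊x ^ ((1 : ℝ) / k)⌋₊ with p.Prime,
        chiReal (p ^ k) * Real.log p| ≤ Real.log 4 * x ^ (1 / 3 : ℝ) := by
      intro k hk
      have hk3 : 3 ≤ k := (Finset.mem_Ioc.1 hk).1
      refine (abs_sum_chiReal_prime_pow_le _ k).trans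
        ((Chebyshev.theta_le_log4_mul_x (by positivity)).trans ?_)
      gcongr
      · exact_mod_cast hk3
    refine (Finset.sum_le_card_nsmul _ _ _ this).trans ?_
    rw [nsmul_eq_mul, Nat.card_Ioc]
    gcongr
    have := Nat.floor_le hlx
    push_cast [Nat.add_sub_cancel]
    linarith
  rw [e1]
  rw [Real.sqrt_eq_rpow] at e2 ⊢
  push_cast
  rw [abs_le] at *
  constructor <;> linarith [e2.1, e2.2, e3.1, e3.2]

section MeanSquare

variable {E F : Type*} [NormedAddCommGroup E] [NormedAddCommGroup F]

theorem MeanSquareLE.mono {f : ℝ → E} {g : ℝ → F} {ε ε' : ℝ} (h : MeanSquareLE g ε)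
    (hfg : ∀ u > 0, ‖f u‖ ≤ ‖g u‖) (hε : ε ≤ ε') : MeanSquareLE f ε' := by
  filter_upwards [h, eventually_gt_atTop 0] with U hU hU0
  refine (setLIntegral_mono' measurableSet_Ioc fun u hu => ?_).trans
    (hU.trans (ENNReal.ofReal_le_ofReal (by gcongr)))
  have := hfg u hu.1
  gcongr
  rw [← ofReal_norm, ← ofReal_norm]
  exact ENNReal.ofReal_le_ofReal this

theorem enorm_add_sq_le (a b : E) : ‖a + b‖ₑ ^ 2 ≤ 2 * ‖a‖ₑ ^ 2 + 2 * ‖b‖ₑ ^ 2 := by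
  simp_rw [← ofReal_norm, ← ENNReal.ofReal_pow (norm_nonneg _)]
  rw [← ENNReal.ofReal_ofNat 2, ← ENNReal.ofReal_mul (by norm_num),
    ← ENNReal.ofReal_mul (by norm_num), ← ENNReal.ofReal_add (by positivity) (by positivity)]
  refine ENNReal.ofReal_le_ofReal ?_
  have h := norm_add_le a b
  have h0 := norm_nonneg (a + b)
  nlinarith [sq_nonneg (‖a‖ - ‖b‖)]

theorem MeanSquareLE.add [MeasurableSpace E] [BorelSpace E] {f g : ℝ → E} {ε ε' : ℝ}
    (hf : MeanSquareLE f ε)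
    (hg : MeanSquareLE g ε') (hm : Measurable f) (hε : 0 ≤ ε) (hε' : 0 ≤ ε') :
    MeanSquareLE (fun u => f u + g u) (2 * ε + 2 * ε') := by
  filter_upwards [hf, hg, eventually_gt_atTop 0] with U hU hU' hU0
  refine (lintegral_mono fun u => enorm_add_sq_le _ _).trans ?_
  rw [lintegral_add_left (by fun_prop), lintegral_const_mul' _ _ (by simp),
    lintegral_const_mul' _ _ (by simp)]
  refine (add_le_add (mul_le_mul_right hU 2) (mul_le_mul_right hU' 2)).trans ?_
  rw [← ENNReal.ofReal_ofNat 2, ← ENNReal.ofReal_mul (by norm_num),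
    ← ENNReal.ofReal_mul (by norm_num), ← ENNReal.ofReal_add (by positivity) (by positivity)]
  refine ENNReal.ofReal_le_ofReal (le_of_eq (by ring))

theorem MeanSquareLE.of_bounded {f : ℝ → E} {B : ℝ} (hf : ∀ u > 0, ‖f u‖ ≤ B) :
    MeanSquareLE f (B ^ 2) := by
  filter_upwards [eventually_gt_atTop 0] with U hU0
  calc ∫⁻ u in Set.Ioc 0 U, ‖f u‖ₑ ^ 2 ≤ ∫⁻ u in Set.Ioc 0 U, ENNReal.ofReal (B ^ 2) := by
        refine setLIntegral_mono' measurableSet_Ioc fun u hu => ?_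
        rw [← ofReal_norm, ← ENNReal.ofReal_pow (norm_nonneg _)]
        have := hf u hu.1
        gcongr
    _ = _ := by
        rw [setLIntegral_const, Real.volume_Ioc, ← ENNReal.ofReal_mul (by positivity), sub_zero]

theorem MeanSquareLE.of_tendsto_zero {f : ℝ → E} (hf : Tendsto f atTop (𝓝 0))
    (hb : ∀ V, ∃ B, ∀ u ∈ Set.Ioc 0 V, ‖f u‖ ≤ B) {ε : ℝ} (hε : 0 < ε) : MeanSquareLE f ε := by
  have h1 : ∀ᶠ u in atTop, ‖f u‖ ^ 2 < ε / 2 := by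
    have := (hf.norm.pow 2)
    rw [norm_zero, zero_pow (by norm_num)] at this
    exact this.eventually (gt_mem_nhds (by positivity))
  obtain ⟨V, hV⟩ := eventually_atTop.1 h1
  obtain ⟨B, hB⟩ := hb (max V 0)
  filter_upwards [eventually_gt_atTop 0, eventually_ge_atTop (2 * (B ^ 2 * max V 0) / ε)]
    with U hU0 hU
  rw [div_le_iff₀ hε] at hU
  calc ∫⁻ u in Set.Ioc 0 U, ‖f u‖ₑ ^ 2
      ≤ ∫⁻ u in Set.Ioc 0 U, (ENNReal.ofReal (ε / 2) +
          (Set.Ioc 0 (max V 0)).indicator (fun _ => ENNReal.ofReal (B ^ 2)) u) := by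
        refine setLIntegral_mono' measurableSet_Ioc fun u hu => ?_
        rw [← ofReal_norm, ← ENNReal.ofReal_pow (norm_nonneg _)]
        by_cases huV : u ≤ max V 0
        · rw [Set.indicator_of_mem (show u ∈ Set.Ioc 0 (max V 0) from ⟨hu.1, huV⟩)]
          have := hB u ⟨hu.1, huV⟩
          refine le_trans ?_ le_add_self
          gcongr
        · refine le_trans ?_ le_self_add
          exact ENNReal.ofReal_le_ofReal (hV u (le_trans (le_max_left _ _) (not_le.1 huV).le)).le
    _ ≤ ENNReal.ofReal (ε / 2 * U) + ENNReal.ofReal (B ^ 2 * max V 0) := by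
        rw [lintegral_add_left (by fun_prop)]
        gcongr
        · rw [setLIntegral_const, Real.volume_Ioc, ← ENNReal.ofReal_mul (by positivity), sub_zero]
        · refine (setLIntegral_le_lintegral _ _).trans ?_
          rw [lintegral_indicator measurableSet_Ioc, setLIntegral_const, Real.volume_Ioc,
            ← ENNReal.ofReal_mul (by positivity), sub_zero]
    _ ≤ _ := by
        rw [← ENNReal.ofReal_add (by positivity) (by positivity)]
        exact ENNReal.ofReal_le_ofReal (by linarith)

end MeanSquare

theorem RHZeta.meanSquareLE_theta (h : RHZeta) {ε : ℝ} (hε : 0 < ε) :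
    MeanSquareLE (fun u : ℝ => Chebyshev.theta (Real.exp (u / 2)) * Real.exp (-(u / 2)) - 1) ε := by
  obtain ⟨A, hA⟩ := h.exists_lintegral_psi_sub_le
  obtain ⟨C, hC⟩ := Chebyshev.psi_sub_theta_le_mul_sqrt
  have hθm : Measurable fun u : ℝ => Chebyshev.theta (Real.exp (u / 2)) :=
    Chebyshev.theta_mono.measurable.comp (by fun_prop)
  have hψm : Measurable fun u : ℝ => Chebyshev.psi (Real.exp (u / 2)) :=
    Chebyshev.psi_mono.measurable.comp (by fun_prop)
  have h1 : MeanSquareLE (fun u : ℝ =>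
      Chebyshev.psi (Real.exp (u / 2)) * Real.exp (-(u / 2)) - 1) (ε / 4) := by
    filter_upwards [eventually_ge_atTop 2, eventually_ge_atTop (2 * A / (ε / 4))] with U hU hU'
    rw [div_le_iff₀ (by positivity)] at hU'
    set G : ℝ → ENNReal := fun v => (Set.Ioc 0 (U / 2)).indicator (fun v =>
      ‖((Chebyshev.psi (Real.exp v) - Real.exp v : ℝ) : ℂ) * Real.exp (-(1 * v))‖ₑ ^ 2) v with hG
    have hGm : ∫⁻ v, G v ≤ ENNReal.ofReal A := by
      rw [hG, lintegral_indicator measurableSet_Ioc]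
      exact hA _ (by linarith)
    have h2 := lintegral_comp_mul_pos (fun v => G (1 / 2 * v)) (a := 2) (by norm_num)
    simp only [← mul_assoc, one_div, inv_mul_cancel₀ (two_ne_zero' ℝ), one_mul] at h2
    calc _ = ∫⁻ u in Set.Ioc 0 U, G (1 / 2 * u) := by
          refine setLIntegral_congr_fun measurableSet_Ioc fun u hu => ?_
          have : 1 / 2 * u ∈ Set.Ioc 0 (U / 2) := ⟨by linarith [hu.1], by linarith [hu.2]⟩
          simp only [hG]
          rw [Set.indicator_of_mem this, ← Complex.ofReal_mul, ← ofReal_norm,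
            ← ofReal_norm, Complex.norm_real, one_div_mul_eq_div, sub_mul, one_mul,
            ← Real.exp_add, add_neg_cancel, Real.exp_zero]
      _ ≤ ∫⁻ u, G (1 / 2 * u) := setLIntegral_le_lintegral _ _
      _ ≤ ENNReal.ofReal (2 * A) := by
          rw [one_div, h2, ENNReal.ofReal_mul (by norm_num)]
          gcongr
      _ ≤ _ := ENNReal.ofReal_le_ofReal (by linarith)
  have hbound : ∀ u : ℝ, ‖-((Chebyshev.psi (Real.exp (u / 2)) - Chebyshev.theta (Real.exp (u / 2)))
      * Real.exp (-(u / 2)))‖ ≤ C * Real.exp (-(u / 4)) := by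
    intro u
    have h3 := hC (Real.exp (u / 2))
    have h4 := Chebyshev.theta_le_psi (Real.exp (u / 2))
    rw [norm_neg, Real.norm_eq_abs, abs_of_nonneg (by positivity [sub_nonneg.2 h4])]
    calc _ ≤ C * √(Real.exp (u / 2)) * Real.exp (-(u / 2)) := by gcongr
      _ = _ := by
        rw [Real.exp_half (u / 2) |>.symm, mul_assoc, ← Real.exp_add]
        ring_nf
  have h5 : MeanSquareLE (fun u : ℝ => -((Chebyshev.psi (Real.exp (u / 2)) -
      Chebyshev.theta (Real.exp (u / 2))) * Real.exp (-(u / 2)))) (ε / 4) := by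
    refine MeanSquareLE.of_tendsto_zero ?_ ?_ (by positivity)
    · refine squeeze_zero_norm hbound ?_
      have : Tendsto (fun u : ℝ => Real.exp (-(u / 4))) atTop (𝓝 0) :=
        Real.tendsto_exp_neg_atTop_nhds_zero.comp (tendsto_id.atTop_div_const (by norm_num))
      simpa using this.const_mul C
    · intro V
      refine ⟨|C|, fun u hu => (hbound u).trans ?_⟩
      have : Real.exp (-(u / 4)) ≤ 1 := Real.exp_le_one_iff.2 (by linarith [hu.1])
      have h0 := Real.exp_pos (-(u / 4))
      calc _ ≤ |C| * Real.exp (-(u / 4)) := by gcongr; exact le_abs_self C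
        _ ≤ |C| * 1 := by gcongr
        _ = _ := mul_one _
  refine (h1.add h5 (by fun_prop) (by positivity) (by positivity)).mono (fun u _ => ?_)
    (by linarith)
  refine le_of_eq (congrArg _ ?_)
  ring

/-- The sum of the nonprincipal character modulo `4` over the primes up to `x`. -/
noncomputable def piChi (x : ℝ) : ℝ :=
  ∑ p ∈ Finset.Ioc 0 ⌊x⌋₊ with p.Prime, chiReal p

theorem abs_piChi_le {x : ℝ} (hx : 0 ≤ x) : |piChi x| ≤ x := by
  refine (Finset.abs_sum_le_sum_abs _ _).trans ?_
  refine (Finset.sum_le_card_nsmul _ _ 1 fun p _ => abs_chiReal_le p).trans ?_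
  rw [nsmul_eq_mul, mul_one]
  refine le_trans ?_ (Nat.floor_le hx)
  exact_mod_cast (Finset.card_filter_le _ _).trans (by simp)

theorem primePiMod_sub_primePiMod (x : ℝ) :
    (primePiMod x 4 3 : ℝ) - primePiMod x 4 1 = -piChi x := by
  rw [piChi, primePiMod, primePiMod, Finset.card_filter, Finset.card_filter]
  push_cast
  rw [← Finset.sum_sub_distrib, ← Finset.sum_neg_distrib, Finset.sum_filter,
    Finset.range_eq_Ico, Finset.sum_eq_sum_Ico_succ_bot (by omega)]
  simp only [Nat.not_prime_zero, false_and, if_false, sub_zero, zero_add]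
  refine Finset.sum_congr (by ext; simp [Nat.succ_le_iff]) fun n _ => ?_
  rw [chiReal]
  by_cases hn : n.Prime
  · simp only [hn, true_and, if_true]
    split_ifs <;> first | omega | norm_num
  · simp [hn]

theorem piChi_eq_thetaChi_div_log_add_integral (x : ℝ) :
    piChi x = thetaChi x / Real.log x +
      ∫ t in Set.Ioc 2 x, thetaChi t / (t * Real.log t ^ 2) := by
  let a : ℕ → ℝ := Set.indicator (Set.ofPred Nat.Prime) (fun n ↦ chiReal n * Real.log n)
  have ha : ∀ y : ℝ, ∑ n ∈ Finset.Icc 0 ⌊y⌋₊, a n = thetaChi y := by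
    intro y
    rw [← Finset.add_sum_Ioc_eq_sum_Icc (by omega), thetaChi, Finset.sum_filter]
    simp [a, Set.indicator_apply]
  have h1 : piChi x = ∑ n ∈ Finset.Icc 0 ⌊x⌋₊, (Real.log n)⁻¹ * a n := by
    rw [← Finset.add_sum_Ioc_eq_sum_Icc (by omega), piChi, Finset.sum_filter]
    simp only [CharP.cast_eq_zero, Real.log_zero, inv_zero, zero_mul, zero_add]
    refine Finset.sum_congr rfl fun n hn ↦ ?_
    split_ifs with h
    · have : Real.log n ≠ 0 :=
        Real.log_ne_zero_of_pos_of_ne_one (mod_cast h.pos) (mod_cast h.ne_one)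
      simp [a, h, field]
    · simp [a, h]
  rw [h1, sum_mul_eq_sub_integral_mul₁ a (f := fun n ↦ (Real.log n)⁻¹) (by simp [a]) (by simp [a])]
  · simp only [ha, Real.deriv_inv_log]
    rw [sub_eq_add_neg, ← integral_neg, inv_mul_eq_div]
    congr 1
    refine setIntegral_congr_fun measurableSet_Ioc fun t _ => ?_
    ring
  · intro z ⟨_, _⟩
    exact Real.differentiableAt_inv_log (by linarith) (by linarith) (by linarith)
  · refine ContinuousOn.integrableOn_Icc fun z ⟨_, _⟩ ↦ ContinuousWithinAt.congr ?_
      (fun _ _ ↦ Real.deriv_inv_log_apply) Real.deriv_inv_log_apply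
    have : z ≠ 0 := by linarith
    have : Real.log z ^ 2 ≠ 0 :=
      pow_ne_zero _ (Real.log_ne_zero_of_pos_of_ne_one (by linarith) (by linarith))
    fun_prop

theorem lintegral_Ioc_exp (F : ℝ → ENNReal) (a b : ℝ) :
    ∫⁻ t in Set.Ioc (Real.exp a) (Real.exp b), F t =
      ∫⁻ v in Set.Ioc a b, ENNReal.ofReal (Real.exp v) * F (Real.exp v) := by
  have himg : Real.exp '' Set.Ioc a b = Set.Ioc (Real.exp a) (Real.exp b) := by
    ext t
    constructor
    · rintro ⟨v, hv, rfl⟩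
      exact ⟨Real.exp_lt_exp.2 hv.1, Real.exp_le_exp.2 hv.2⟩
    · intro ht
      have h0 : 0 < t := (Real.exp_pos a).trans ht.1
      exact ⟨Real.log t, ⟨(Real.lt_log_iff_exp_lt h0).2 ht.1, (Real.log_le_iff_le_exp h0).2 ht.2⟩,
        Real.exp_log h0⟩
  rw [← himg, lintegral_image_eq_lintegral_abs_deriv_mul measurableSet_Ioc
    (fun v _ => (Real.hasDerivAt_exp v).hasDerivWithinAt) (Real.exp_injective.injOn)]
  simp_rw [abs_of_pos (Real.exp_pos _)]

theorem mul_exp_div_sq_le {u v : ℝ} (hv : 1 / 2 ≤ v) (huv : v ≤ u) :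
    u * Real.exp (-(u / 2)) * (Real.exp (v / 2) / v ^ 2) ≤
      256 / u * Real.exp (-((u - v) / 4)) := by
  have hv0 : 0 < v := by linarith
  have hu0 : 0 < u := by linarith
  have h1 : u / v ≤ 16 * Real.exp ((u - v) / 8) := by
    have h2 := Real.add_one_le_exp ((u - v) / 8)
    rw [div_le_iff₀ hv0]
    nlinarith
  have h3 : (u / v) ^ 2 ≤ 256 * Real.exp ((u - v) / 4) := by
    calc (u / v) ^ 2 ≤ (16 * Real.exp ((u - v) / 8)) ^ 2 := by gcongr
      _ = _ := by
        rw [mul_pow, ← Real.exp_nat_mul]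
        norm_num
        ring_nf
  calc u * Real.exp (-(u / 2)) * (Real.exp (v / 2) / v ^ 2)
      = (u / v) ^ 2 * (Real.exp (-(u / 2)) * Real.exp (v / 2)) / u := by field_simp
    _ ≤ 256 * Real.exp ((u - v) / 4) * (Real.exp (-(u / 2)) * Real.exp (v / 2)) / u := by gcongr
    _ = _ := by
      rw [mul_assoc, ← Real.exp_add, ← Real.exp_add]
      ring_nf

theorem lintegral_Ioc_exp_sub_le (u : ℝ) :
    ∫⁻ v in Set.Ioc 0 u, ENNReal.ofReal (Real.exp (-((u - v) / 2))) ≤ 2 := by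
  have h : ∫⁻ v in Set.Iic u, ENNReal.ofReal (Real.exp (-((u - v) / 2))) = 2 := by
    have h1 : IntegrableOn (fun v : ℝ => Real.exp (1 / 2 * v)) (Set.Iic u) :=
      integrableOn_exp_mul_Iic (by norm_num) u
    have he : ∀ v : ℝ, Real.exp (-((u - v) / 2)) = Real.exp (-(u / 2)) * Real.exp (1 / 2 * v) := by
      intro v; rw [← Real.exp_add]; ring_nf
    simp_rw [he]
    rw [← ofReal_integral_eq_lintegral_ofReal (h1.const_mul _)
      (Eventually.of_forall fun v => by positivity), integral_const_mul,
      integral_exp_mul_Iic (by norm_num)]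
    rw [mul_div_assoc', ← Real.exp_add]
    ring_nf
    simp
  rw [← h]
  exact lintegral_mono_set fun v hv => hv.2

theorem measurable_thetaChi_exp : Measurable fun v : ℝ => thetaChi (Real.exp v) := by
  have : (fun v : ℝ => thetaChi (Real.exp v)) = fun v => (∑ k ∈ Finset.Icc 1 ⌊Real.exp v⌋₊,
      (if k.Prime then ((chiReal k * Real.log k : ℝ) : ℂ) else 0)).re := by
    ext v
    rw [thetaChi, Finset.sum_filter, Complex.re_sum]
    refine Finset.sum_congr (by ext; simp [Nat.succ_le_iff]) fun n _ => ?_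
    split_ifs
    · rw [Complex.ofReal_re]
    · simp
  rw [this]
  exact Complex.measurable_re.comp (measurable_summatory_exp _)

theorem enorm_piChi_sub_thetaChi_le {u : ℝ} (hu : 1 ≤ u) :
    ‖u * Real.exp (-(u / 2)) * (piChi (Real.exp u) - thetaChi (Real.exp u) / u)‖ₑ ≤
      ∫⁻ v in Set.Ioc 0 u, ENNReal.ofReal (256 / u * Real.exp (-((u - v) / 4)) *
        ‖thetaChi (Real.exp v) * Real.exp (-(v / 2))‖) := by
  have hl2 : 1 / 2 ≤ Real.log 2 := by linarith [Real.log_two_gt_d9]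
  rw [piChi_eq_thetaChi_div_log_add_integral, Real.log_exp, add_sub_cancel_left, enorm_mul]
  calc _ ≤ ‖u * Real.exp (-(u / 2))‖ₑ *
        ∫⁻ t in Set.Ioc 2 (Real.exp u), ‖thetaChi t / (t * Real.log t ^ 2)‖ₑ := by
        gcongr
        exact enorm_integral_le_lintegral_enorm _
    _ = ∫⁻ v in Set.Ioc (Real.log 2) u, ‖u * Real.exp (-(u / 2))‖ₑ *
          (ENNReal.ofReal (Real.exp v) *
          ‖thetaChi (Real.exp v) / (Real.exp v * v ^ 2)‖ₑ) := by
        rw [lintegral_const_mul' _ _ enorm_ne_top]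
        congr 1
        have := lintegral_Ioc_exp (fun t => ‖thetaChi t / (t * Real.log t ^ 2)‖ₑ) (Real.log 2) u
        rw [Real.exp_log (by norm_num)] at this
        simpa using this
    _ ≤ ∫⁻ v in Set.Ioc (Real.log 2) u, ENNReal.ofReal (256 / u * Real.exp (-((u - v) / 4)) *
        ‖thetaChi (Real.exp v) * Real.exp (-(v / 2))‖) := by
        refine setLIntegral_mono' measurableSet_Ioc fun v hv => ?_
        have hv0 : 0 < v := by linarith [hv.1]
        rw [← ofReal_norm, ← ofReal_norm, ← ENNReal.ofReal_mul (by positivity),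
          ← ENNReal.ofReal_mul (by positivity)]
        refine ENNReal.ofReal_le_ofReal ?_
        have h1 := mul_exp_div_sq_le (u := u) (v := v) (by linarith [hv.1]) hv.2
        have h2 : ‖thetaChi (Real.exp v)‖ = ‖thetaChi (Real.exp v) * Real.exp (-(v / 2))‖ *
            Real.exp (v / 2) := by
          rw [norm_mul, mul_assoc, Real.norm_of_nonneg (Real.exp_pos _).le, ← Real.exp_add]
          simp
        rw [norm_div, h2, norm_mul (Real.exp v), Real.norm_of_nonneg (Real.exp_pos v).le,
          Real.norm_of_nonneg (by positivity : 0 ≤ v ^ 2),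
          Real.norm_of_nonneg (by positivity : 0 ≤ u * Real.exp (-(u / 2)))]
        set g := ‖thetaChi (Real.exp v) * Real.exp (-(v / 2))‖
        calc _ = u * Real.exp (-(u / 2)) * (Real.exp (v / 2) / v ^ 2) * g := by
              have := Real.exp_pos v
              field_simp
          _ ≤ _ := by gcongr
    _ ≤ _ := lintegral_mono_set (Set.Ioc_subset_Ioc_left (by linarith))

theorem tendsto_piChi_sub_thetaChi {A : ℝ} (hA0 : 0 ≤ A)
    (hA : MeanSquareLE (fun v : ℝ => thetaChi (Real.exp v) * Real.exp (-(v / 2))) A) :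
    Tendsto (fun u : ℝ => u * Real.exp (-(u / 2)) *
      (piChi (Real.exp u) - thetaChi (Real.exp u) / u)) atTop (𝓝 0) := by
  refine squeeze_zero_norm' (a := fun u : ℝ => 128 * (A + 2) * u ^ (-(1 / 2) : ℝ)) ?_ ?_
  · filter_upwards [hA, eventually_ge_atTop 1] with u hu hu1
    have hu0 : 0 < u := by linarith
    have h := enorm_piChi_sub_thetaChi_le hu1
    rw [← ofReal_norm] at h
    set l : ℝ := u ^ (-(1 / 2) : ℝ) with hl
    have hl0 : 0 < l := by positivity
    have hll : l * l * u = 1 := by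
      rw [hl, ← Real.rpow_add hu0]
      norm_num
      rw [Real.rpow_neg_one, inv_mul_cancel₀ hu0.ne']
    refine (ENNReal.ofReal_le_ofReal_iff (by positivity)).1 (h.trans ?_)
    calc _ ≤ ∫⁻ v in Set.Ioc 0 u, (ENNReal.ofReal (128 / u * l) *
          ‖thetaChi (Real.exp v) * Real.exp (-(v / 2))‖ₑ ^ 2 +
          ENNReal.ofReal (128 / u / l) * ENNReal.ofReal (Real.exp (-((u - v) / 2)))) := by
          refine setLIntegral_mono' measurableSet_Ioc fun v hv => ?_
          rw [← ofReal_norm, ← ENNReal.ofReal_pow (norm_nonneg _),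
            ← ENNReal.ofReal_mul (by positivity), ← ENNReal.ofReal_mul (by positivity),
            ← ENNReal.ofReal_add (by positivity) (by positivity)]
          refine ENNReal.ofReal_le_ofReal ?_
          set g := ‖thetaChi (Real.exp v) * Real.exp (-(v / 2))‖
          have he : Real.exp (-((u - v) / 2)) = Real.exp (-((u - v) / 4)) ^ 2 := by
            rw [← Real.exp_nat_mul]; ring_nf
          rw [he]
          set e := Real.exp (-((u - v) / 4))
          have h2 : 2 * (e * g) ≤ l * g ^ 2 + e ^ 2 / l := by
            rw [← sub_nonneg]
            have : l * g ^ 2 + e ^ 2 / l - 2 * (e * g) = (l * g - e) ^ 2 / l := by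
              field_simp; ring
            rw [this]; positivity
          calc 256 / u * e * g = 128 / u * (2 * (e * g)) := by ring
            _ ≤ 128 / u * (l * g ^ 2 + e ^ 2 / l) := by gcongr
            _ = _ := by ring
      _ ≤ ENNReal.ofReal (128 / u * l) * ENNReal.ofReal (A * u) +
          ENNReal.ofReal (128 / u / l) * 2 := by
          rw [lintegral_add_right _ (by fun_prop), lintegral_const_mul' _ _ (by simp),
            lintegral_const_mul' _ _ (by simp)]
          gcongr
          exact lintegral_Ioc_exp_sub_le u
      _ = _ := by
          rw [← ENNReal.ofReal_ofNat 2, ← ENNReal.ofReal_mul (by positivity),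
            ← ENNReal.ofReal_mul (by positivity),
            ← ENNReal.ofReal_add (by positivity) (by positivity)]
          congr 1
          have h3 : 128 / u / l = 128 * l := by
            field_simp; linarith
          rw [h3]
          field_simp
  · have := tendsto_rpow_neg_atTop (y := 1 / 2) (by norm_num)
    simpa using this.const_mul (128 * (A + 2))

/-- The normalised contribution to `psiChi` of the prime powers with exponent at least `3`. -/
noncomputable def higherPowerError (u : ℝ) : ℝ :=
  ((psiChi u).re - thetaChi (Real.exp u) - Chebyshev.theta (Real.exp (u / 2))) *
    Real.exp (-(u / 2))

/-- The normalised error made in passing from `thetaChi` to `piChi`. -/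
noncomputable def abelError (u : ℝ) : ℝ :=
  u * Real.exp (-(u / 2)) * (piChi (Real.exp u) - thetaChi (Real.exp u) / u)

theorem exists_abs_higherPowerError_le :
    ∃ C, 0 ≤ C ∧ ∀ u > 0, |higherPowerError u| ≤ C * Real.exp (-(u / 12)) := by
  have hl2 : 0 < Real.log 2 := Real.log_pos (by norm_num)
  have hl4 : 0 < Real.log 4 := Real.log_pos (by norm_num)
  refine ⟨Real.log 2 + (12 / Real.log 2 + 2) * Real.log 4, by positivity, fun u hu => ?_⟩
  have h := abs_psiChi_sub_thetaChi_sub_theta_sqrt_le (x := Real.exp u)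
    (Real.one_le_exp hu.le)
  rw [higherPowerError, psiChi_eq_ofReal, Complex.ofReal_re, abs_mul, abs_of_pos (Real.exp_pos _),
    Real.exp_half]
  rw [Real.log_exp, ← Real.exp_mul] at h
  have h1 : Real.exp (-(u / 2)) ≤ Real.exp (-(u / 12)) := Real.exp_le_exp.2 (by linarith)
  have h2 : u ≤ 12 * Real.exp (u / 12) := by linarith [Real.add_one_le_exp (u / 12)]
  have h3 : 1 ≤ Real.exp (u / 12) := Real.one_le_exp (by positivity)
  calc _ ≤ (Real.log 2 + (u / Real.log 2 + 2) * (Real.log 4 * Real.exp (u * (1 / 3)))) *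
        Real.exp (-(u / 2)) := by gcongr
    _ = Real.log 2 * Real.exp (-(u / 2)) + (u / Real.log 2 + 2) * Real.log 4 *
        (Real.exp (u * (1 / 3)) * Real.exp (-(u / 2))) := by ring
    _ ≤ Real.log 2 * Real.exp (-(u / 12)) +
        (12 * Real.exp (u / 12) / Real.log 2 + 2 * Real.exp (u / 12)) * Real.log 4 *
        (Real.exp (u * (1 / 3)) * Real.exp (-(u / 2))) := by gcongr; linarith
    _ = Real.log 2 * Real.exp (-(u / 12)) + (12 / Real.log 2 + 2) * Real.log 4 *
        (Real.exp (u / 12) * (Real.exp (u * (1 / 3)) * Real.exp (-(u / 2)))) := by ring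
    _ = _ := by
        rw [← Real.exp_add, ← Real.exp_add]
        ring_nf

theorem meanSquareLE_higherPowerError {ε : ℝ} (hε : 0 < ε) : MeanSquareLE higherPowerError ε := by
  obtain ⟨C, hC0, hC⟩ := exists_abs_higherPowerError_le
  refine MeanSquareLE.of_tendsto_zero ?_ (fun V => ⟨C, fun u hu => (hC u hu.1).trans ?_⟩) hε
  · refine squeeze_zero_norm' (eventually_gt_atTop 0 |>.mono hC) ?_
    have : Tendsto (fun u : ℝ => Real.exp (-(u / 12))) atTop (𝓝 0) :=
      Real.tendsto_exp_neg_atTop_nhds_zero.comp (tendsto_id.atTop_div_const (by norm_num))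
    simpa using this.const_mul C
  · exact mul_le_of_le_one_right hC0 (Real.exp_le_one_iff.2 (by linarith [hu.1]))

theorem measurable_higherPowerError : Measurable higherPowerError := by
  have h1 : Measurable fun u : ℝ => Chebyshev.theta (Real.exp (u / 2)) :=
    Chebyshev.theta_mono.measurable.comp (by fun_prop)
  have h2 := measurable_thetaChi_exp
  have h3 := Complex.measurable_re.comp measurable_psiChi
  exact ((h3.sub h2).sub h1).mul (by fun_prop)

theorem exists_norm_sum_exp_le {S : Finset ℂ} (hS : ∀ ρ ∈ S, ρ.re = 1 / 2) (c : ℂ → ℂ) (u : ℝ) :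
    ‖(∑ ρ ∈ S, c ρ * Complex.exp (ρ * u)) * Real.exp (-(1 / 2 * u))‖ ≤ ∑ ρ ∈ S, ‖c ρ‖ := by
  rw [Finset.sum_mul]
  refine (norm_sum_le _ _).trans (Finset.sum_le_sum fun ρ hρ => le_of_eq ?_)
  rw [norm_mul, norm_mul, Complex.norm_exp, Complex.norm_real, Real.norm_of_nonneg
    (Real.exp_pos _).le, mul_assoc, ← Real.exp_add]
  simp [hS ρ hρ]

theorem RHChi.exists_meanSquareLE_thetaChi (h : RHChi) :
    ∃ A, 0 ≤ A ∧ MeanSquareLE (fun v : ℝ => thetaChi (Real.exp v) * Real.exp (-(v / 2))) A := by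
  obtain ⟨S, hS, hms⟩ := h.exists_meanSquareLE one_pos
  have h1 := hms S subset_rfl hS
  set c : ℂ → ℂ := fun ρ =>
    (analyticOrderNatAt (DirichletCharacter.LFunction chiMinusFour) ρ : ℂ) / ρ with hc
  obtain ⟨C, hC0, hC⟩ := exists_abs_higherPowerError_le
  set B := ∑ ρ ∈ S, ‖c ρ‖ with hB
  have hB0 : 0 ≤ B := by positivity
  have hl4 : 0 ≤ Real.log 4 := Real.log_nonneg (by norm_num)
  set e : ℝ → ℝ := fun u => -((∑ ρ ∈ S, c ρ * Complex.exp (ρ * u)) * Real.exp (-(1 / 2 * u))).re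
    - higherPowerError u - Chebyshev.theta (Real.exp (u / 2)) * Real.exp (-(u / 2)) with he
  have h2 : MeanSquareLE e ((B + C + Real.log 4) ^ 2) := by
    refine MeanSquareLE.of_bounded fun u hu => ?_
    have e1 := (Complex.abs_re_le_norm _).trans
      (exists_norm_sum_exp_le (fun ρ hρ => (hS ρ hρ).2) c u)
    have e2 : |higherPowerError u| ≤ C := (hC u hu).trans
      (mul_le_of_le_one_right hC0 (Real.exp_le_one_iff.2 (by linarith)))
    have e3 : |Chebyshev.theta (Real.exp (u / 2)) * Real.exp (-(u / 2))| ≤ Real.log 4 := by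
      rw [abs_of_nonneg (by positivity)]
      calc _ ≤ Real.log 4 * Real.exp (u / 2) * Real.exp (-(u / 2)) := by
            gcongr
            exact Chebyshev.theta_le_log4_mul_x (Real.exp_pos _).le
        _ = _ := by rw [mul_assoc, ← Real.exp_add]; simp
    rw [Real.norm_eq_abs, he]
    simp only
    rw [abs_le] at *
    constructor <;> linarith [e1.1, e1.2, e2.1, e2.2, e3.1, e3.2]
  set a : ℝ → ℝ := fun u => ((psiChi u + ∑ ρ ∈ S, c ρ * Complex.exp (ρ * u)) *
    Real.exp (-(1 / 2 * u))).re with ha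
  have h3 : MeanSquareLE a 1 := h1.mono (fun u _ => Complex.abs_re_le_norm _) le_rfl
  have ham : Measurable a := by
    have := measurable_psiChi
    fun_prop
  refine ⟨_, ?_, (h3.add h2 ham (by positivity) (by positivity)).mono (fun u _ => ?_) le_rfl⟩
  · positivity
  · refine le_of_eq (congrArg _ ?_)
    have hexp : Real.exp (-(1 / 2 * u)) = Real.exp (-(u / 2)) := by ring_nf
    simp only [ha, he, higherPowerError, add_mul, Complex.add_re, Complex.re_mul_ofReal, hexp]
    generalize (∑ ρ ∈ S, c ρ * Complex.exp (ρ * u)).re = Z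
    ring

theorem RHChi.meanSquareLE_abelError (h : RHChi) {ε : ℝ} (hε : 0 < ε) :
    MeanSquareLE abelError ε := by
  obtain ⟨A, hA0, hA⟩ := h.exists_meanSquareLE_thetaChi
  have hl4 : 0 ≤ Real.log 4 := Real.log_nonneg (by norm_num)
  refine MeanSquareLE.of_tendsto_zero (tendsto_piChi_sub_thetaChi hA0 hA) (fun V =>
    ⟨V * Real.exp V + Real.log 4 * Real.exp V, fun u hu => ?_⟩) hε
  have hu0 : 0 < u := hu.1
  have hV0 : 0 < V := hu.1.trans_le hu.2
  have huV : Real.exp u ≤ Real.exp V := Real.exp_le_exp.2 hu.2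
  have e1 := abs_piChi_le (Real.exp_pos u).le
  have e2 := (abs_thetaChi_le (Real.exp u)).trans
    (Chebyshev.theta_le_log4_mul_x (Real.exp_pos u).le)
  have e3 : Real.exp (-(u / 2)) ≤ 1 := Real.exp_le_one_iff.2 (by linarith)
  have e4 : abelError u = Real.exp (-(u / 2)) *
      (u * piChi (Real.exp u) - thetaChi (Real.exp u)) := by
    rw [abelError]; field_simp
  change ‖abelError u‖ ≤ _
  rw [e4, norm_mul, Real.norm_of_nonneg (Real.exp_pos _).le]
  calc _ ≤ 1 * ‖u * piChi (Real.exp u) - thetaChi (Real.exp u)‖ := by gcongr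
    _ ≤ u * |piChi (Real.exp u)| + |thetaChi (Real.exp u)| := by
        rw [one_mul]
        refine (norm_sub_le _ _).trans ?_
        rw [norm_mul, Real.norm_of_nonneg hu0.le, Real.norm_eq_abs, Real.norm_eq_abs]
    _ ≤ V * Real.exp V + Real.log 4 * Real.exp V := by
        gcongr
        · exact hu.2
        · exact e1.trans huV
        · exact e2.trans (by gcongr)

/-- The normalised difference `u e^{-u/2} (π(e^u;4,3) - π(e^u;4,1))`. -/
noncomputable def raceFunction (u : ℝ) : ℝ := -(u * Real.exp (-(u / 2)) * piChi (Real.exp u))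

theorem measurable_raceFunction : Measurable raceFunction := by
  have : (fun v : ℝ => piChi (Real.exp v)) = fun v => (∑ k ∈ Finset.Icc 1 ⌊Real.exp v⌋₊,
      (if k.Prime then ((chiReal k : ℝ) : ℂ) else 0)).re := by
    ext v
    rw [piChi, Finset.sum_filter, Complex.re_sum]
    refine Finset.sum_congr (by ext; simp [Nat.succ_le_iff]) fun n _ => ?_
    split_ifs
    · rw [Complex.ofReal_re]
    · simp
  have h1 : Measurable fun v : ℝ => piChi (Real.exp v) := by
    rw [this]
    exact Complex.measurable_re.comp (measurable_summatory_exp _)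
  unfold raceFunction
  fun_prop

theorem exists_meanSquareLE_raceFunction (h : RHChi) (hz : RHZeta) {ε : ℝ} (hε : 0 < ε) :
    ∃ S₀ : Finset ℂ,
      (∀ ρ ∈ S₀, DirichletCharacter.LFunction chiMinusFour ρ = 0 ∧ ρ.re = 1 / 2) ∧
      ∀ S : Finset ℂ, S₀ ⊆ S →
      (∀ ρ ∈ S, DirichletCharacter.LFunction chiMinusFour ρ = 0 ∧ ρ.re = 1 / 2) →
      MeanSquareLE (fun u : ℝ => raceFunction u - 1 - ((∑ ρ ∈ S,
        (analyticOrderNatAt (DirichletCharacter.LFunction chiMinusFour) ρ : ℂ) / ρ *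
          Complex.exp (ρ * u)) * Real.exp (-(1 / 2 * u))).re) ε := by
  obtain ⟨S₀, hS₀, hms⟩ := h.exists_meanSquareLE (ε := ε / 32) (by positivity)
  refine ⟨S₀, hS₀, fun S hSS hS => ?_⟩
  have h1 := hms S hSS hS
  set c : ℂ → ℂ := fun ρ =>
    (analyticOrderNatAt (DirichletCharacter.LFunction chiMinusFour) ρ : ℂ) / ρ with hc
  set a : ℝ → ℝ := fun u => -((psiChi u + ∑ ρ ∈ S, c ρ * Complex.exp (ρ * u)) *
    Real.exp (-(1 / 2 * u))).re with ha
  have h2 : MeanSquareLE a (ε / 32) := h1.mono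
    (fun u _ => by rw [ha, norm_neg]; exact Complex.abs_re_le_norm _) le_rfl
  have ham : Measurable a := by
    have := measurable_psiChi
    fun_prop
  have h3 : MeanSquareLE (fun u => -abelError u) (ε / 32) :=
    (h.meanSquareLE_abelError (ε := ε / 32) (by positivity)).mono
      (fun u _ => by rw [norm_neg]) le_rfl
  have h4 := hz.meanSquareLE_theta (ε := ε / 32) (by positivity)
  have h4m : Measurable (fun u : ℝ =>
      Chebyshev.theta (Real.exp (u / 2)) * Real.exp (-(u / 2)) - 1) := by
    have h1 : Measurable fun u : ℝ => Chebyshev.theta (Real.exp (u / 2)) :=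
      Chebyshev.theta_mono.measurable.comp (by fun_prop)
    fun_prop
  have h5 := meanSquareLE_higherPowerError (ε := ε / 32) (by positivity)
  have h6 := h2.add (h5.add (h4.add h3 h4m (by positivity) (by positivity))
    measurable_higherPowerError (by positivity) (by positivity)) ham (by positivity) (by positivity)
  refine h6.mono (fun u hu => le_of_eq (congrArg _ ?_)) (by linarith)
  have hu0 : u ≠ 0 := hu.ne'
  have hexp : Real.exp (-(1 / 2 * u)) = Real.exp (-(u / 2)) := by ring_nf
  simp only [ha, higherPowerError, abelError, raceFunction, hexp, add_mul, Complex.add_re,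
    Complex.re_mul_ofReal]
  generalize (∑ ρ ∈ S, c ρ * Complex.exp (ρ * u)).re = Z
  field_simp
  ring

section Ordinates

open scoped ComplexConjugate

theorem LFunction_chiMinusFour_conj {s : ℂ} (hs : 0 < s.re) :
    DirichletCharacter.LFunction chiMinusFour (conj s) =
      conj (DirichletCharacter.LFunction chiMinusFour s) := by
  rw [LFunction_chiMinusFour_eq hs, LFunction_chiMinusFour_eq (by simpa using hs), map_mul,
    laplaceTransform, laplaceTransform, ← integral_conj]
  refine congrArg (conj s * ·) (integral_congr_ae (Eventually.of_forall fun u => ?_))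
  have h1 : conj (∑ k ∈ Finset.Icc 1 ⌊Real.exp u⌋₊, chiMinusFour (k : ZMod 4)) =
      ∑ k ∈ Finset.Icc 1 ⌊Real.exp u⌋₊, chiMinusFour (k : ZMod 4) := by
    rw [map_sum]
    refine Finset.sum_congr rfl fun n _ => ?_
    rw [chiMinusFour_eq_chiReal, Complex.conj_ofReal]
  simp only [map_mul, ← Complex.exp_conj, h1, map_neg, Complex.conj_ofReal]

/-- The positive ordinates of the zeros of `L(s, χ₋₄)` on the critical line. -/
def chiOrdinates : Set ℝ :=
  {γ | 0 < γ ∧ DirichletCharacter.LFunction chiMinusFour (1 / 2 + γ * Complex.I) = 0}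

/-- The coefficient of `e^{iγu}` in the limiting distribution of `raceFunction`. -/
noncomputable def raceCoeff (γ : ℝ) : ℂ :=
  ((analyticOrderNatAt (DirichletCharacter.LFunction chiMinusFour) (1 / 2 + γ * Complex.I) : ℂ) +
    analyticOrderNatAt (DirichletCharacter.LFunction chiMinusFour) (1 / 2 - γ * Complex.I)) /
    (1 / 2 + γ * Complex.I)

theorem LFunction_chiMinusFour_half_sub {γ : ℝ}
    (h : DirichletCharacter.LFunction chiMinusFour (1 / 2 + γ * Complex.I) = 0) :
    DirichletCharacter.LFunction chiMinusFour (1 / 2 - γ * Complex.I) = 0 := by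
  have h1 := LFunction_chiMinusFour_conj (s := 1 / 2 + γ * Complex.I) (by simp)
  rw [h, map_zero] at h1
  rw [← h1]
  congr 1
  simp [Complex.ext_iff]

theorem re_zero_pair (m n : ℂ) (γ u : ℝ) (hn : n.im = 0) :
    ((m / (1 / 2 + γ * Complex.I) * Complex.exp ((1 / 2 + γ * Complex.I) * u) +
      n / (1 / 2 - γ * Complex.I) * Complex.exp ((1 / 2 - γ * Complex.I) * u)) *
        Real.exp (-(1 / 2 * u))).re =
      ((m + n) / (1 / 2 + γ * Complex.I) * Complex.exp (γ * u * Complex.I)).re := by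
  have e1 : Complex.exp ((1 / 2 + γ * Complex.I) * u) * Real.exp (-(1 / 2 * u)) =
      Complex.exp (γ * u * Complex.I) := by
    rw [Complex.ofReal_exp, ← Complex.exp_add]; push_cast; ring_nf
  have e2 : n / (1 / 2 - γ * Complex.I) *
      (Complex.exp ((1 / 2 - γ * Complex.I) * u) * Real.exp (-(1 / 2 * u))) =
      conj (n / (1 / 2 + γ * Complex.I) * Complex.exp (γ * u * Complex.I)) := by
    rw [Complex.ofReal_exp, ← Complex.exp_add, map_mul, map_div₀, ← Complex.exp_conj,
      Complex.conj_eq_iff_im.2 hn]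
    simp only [map_add, map_div₀, map_one, map_ofNat, map_mul, Complex.conj_ofReal, Complex.conj_I]
    push_cast
    ring_nf
  rw [add_mul, mul_assoc, mul_assoc, e1, e2, Complex.add_re, Complex.conj_re, add_div, add_mul,
    Complex.add_re]

theorem exists_meanSquareLE_ordinates (h : RHChi) (hz : RHZeta)
    (h0 : DirichletCharacter.LFunction chiMinusFour (1 / 2) ≠ 0) {ε : ℝ} (hε : 0 < ε) :
    ∃ T₀ : Finset ℝ, (T₀ : Set ℝ) ⊆ chiOrdinates ∧
      ∀ T : Finset ℝ, T₀ ⊆ T → (T : Set ℝ) ⊆ chiOrdinates →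
      MeanSquareLE (fun u : ℝ => raceFunction u - 1 -
        ∑ γ ∈ T, (raceCoeff γ * Complex.exp (γ * u * Complex.I)).re) ε := by
  classical
  obtain ⟨S₀, hS₀, hms⟩ := exists_meanSquareLE_raceFunction h hz hε
  have hrep : ∀ ρ : ℂ, ρ.re = 1 / 2 → ρ = 1 / 2 + ρ.im * Complex.I := by
    intro ρ hρ; apply Complex.ext <;> simp [hρ]
  have habs : ∀ ρ : ℂ, DirichletCharacter.LFunction chiMinusFour ρ = 0 → ρ.re = 1 / 2 →
      |ρ.im| ∈ chiOrdinates := by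
    intro ρ hρ hre
    have h1 := hrep ρ hre
    refine ⟨abs_pos.2 fun him => h0 ?_, ?_⟩
    · rw [h1, him] at hρ; simpa using hρ
    · rcases abs_choice ρ.im with h2 | h2
      · rw [h2, ← h1, hρ]
      · rw [h2]
        rw [h1] at hρ
        convert LFunction_chiMinusFour_half_sub hρ using 2
        push_cast; ring
  refine ⟨S₀.image fun ρ => |ρ.im|, ?_, fun T hT hTΓ => ?_⟩
  · intro γ hγ
    simp only [Finset.coe_image, Set.mem_image, Finset.mem_coe] at hγ
    obtain ⟨ρ, hρ, rfl⟩ := hγ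
    exact habs ρ (hS₀ ρ hρ).1 (hS₀ ρ hρ).2
  set f₁ : ℝ → ℂ := fun γ => 1 / 2 + γ * Complex.I with hf₁
  set f₂ : ℝ → ℂ := fun γ => 1 / 2 - γ * Complex.I with hf₂
  have him₁ : ∀ γ, (f₁ γ).im = γ := by intro γ; simp [hf₁]
  have him₂ : ∀ γ, (f₂ γ).im = -γ := by intro γ; simp [hf₂]
  have hdisj : Disjoint (T.image f₁) (T.image f₂) := by
    rw [Finset.disjoint_left]
    intro ρ h1 h2
    obtain ⟨a, ha, rfl⟩ := Finset.mem_image.1 h1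
    obtain ⟨b, hb, hab⟩ := Finset.mem_image.1 h2
    have h3 := congrArg Complex.im hab
    rw [him₁, him₂] at h3
    have := (hTΓ ha).1
    have := (hTΓ hb).1
    linarith
  have hinj₁ : Function.Injective f₁ := fun a b hab => by rw [← him₁ a, hab, him₁]
  have hinj₂ : Function.Injective f₂ := fun a b hab => by
    have := congrArg Complex.im hab
    rw [him₂, him₂] at this
    linarith
  have hsub : S₀ ⊆ T.image f₁ ∪ T.image f₂ := by
    intro ρ hρ
    have h1 : |ρ.im| ∈ T := hT (Finset.mem_image_of_mem _ hρ)
    have h2 := hrep ρ (hS₀ ρ hρ).2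
    rw [Finset.mem_union]
    rcases abs_choice ρ.im with h3 | h3
    · exact Or.inl (Finset.mem_image.2 ⟨_, h1, by rw [h3, h2]; simp [hf₁]⟩)
    · refine Or.inr (Finset.mem_image.2 ⟨_, h1, ?_⟩)
      rw [h3, h2]; simp [hf₂]
  have hzero : ∀ ρ ∈ T.image f₁ ∪ T.image f₂,
      DirichletCharacter.LFunction chiMinusFour ρ = 0 ∧ ρ.re = 1 / 2 := by
    intro ρ hρ
    rcases Finset.mem_union.1 hρ with h1 | h1
    · obtain ⟨a, ha, rfl⟩ := Finset.mem_image.1 h1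
      exact ⟨(hTΓ ha).2, by simp [hf₁]⟩
    · obtain ⟨a, ha, rfl⟩ := Finset.mem_image.1 h1
      exact ⟨LFunction_chiMinusFour_half_sub (hTΓ ha).2, by simp [hf₂]⟩
  refine (hms _ hsub hzero).mono (fun u _ => le_of_eq (congrArg _ ?_)) le_rfl
  congr 1
  rw [Finset.sum_union hdisj, Finset.sum_image hinj₁.injOn, Finset.sum_image hinj₂.injOn,
    ← Finset.sum_add_distrib, Finset.sum_mul, Complex.re_sum]
  refine Finset.sum_congr rfl fun γ _ => ?_
  rw [raceCoeff, ← re_zero_pair _ _ _ _ (by simp)]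

end Ordinates

/-- The linear flow on a torus with frequencies in `S`. -/
noncomputable def torusFlow (S : Finset ℝ) (u : ℝ) : UnitAddTorus S :=
  fun γ => (((γ : ℝ) * u / (2 * Real.pi) : ℝ) : UnitAddCircle)

theorem continuous_torusFlow (S : Finset ℝ) : Continuous (torusFlow S) := by
  refine continuous_pi fun γ => (AddCircle.continuous_mk' 1).comp ?_
  fun_prop

theorem mFourier_torusFlow (S : Finset ℝ) (n : S → ℤ) (u : ℝ) :
    UnitAddTorus.mFourier n (torusFlow S u) =
      Complex.exp ((∑ γ : S, (n γ : ℝ) * γ : ℝ) * Complex.I * u) := by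
  simp only [UnitAddTorus.mFourier, ContinuousMap.coe_mk, torusFlow, fourier_coe_apply]
  rw [← Complex.exp_sum]
  congr 1
  push_cast
  rw [Finset.sum_mul, Finset.sum_mul]
  refine Finset.sum_congr rfl fun γ _ => ?_
  have : (Real.pi : ℂ) ≠ 0 := by exact_mod_cast Real.pi_ne_zero
  field_simp

/-- The uniform probability measure on the infinite-dimensional torus. -/
noncomputable def torusMeasure : Measure (ℝ → UnitAddCircle) :=
  Measure.infinitePi fun _ => AddCircle.haarAddCircle

noncomputable instance : IsProbabilityMeasure torusMeasure := by
  unfold torusMeasure; infer_instance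

theorem integral_fourier_eq_zero {n : ℤ} (hn : n ≠ 0) :
    ∫ x : UnitAddCircle, fourier n x ∂AddCircle.haarAddCircle = 0 :=
  integral_eq_zero_of_add_right_eq_neg (fourier_add_half_inv_index hn (by norm_num))

theorem integral_mFourier_eq_zero (S : Finset ℝ) {n : S → ℤ} (hn : n ≠ 0) :
    ∫ x, UnitAddTorus.mFourier n x
      ∂(Measure.pi fun _ : S => (AddCircle.haarAddCircle : Measure UnitAddCircle)) = 0 := by
  obtain ⟨i, hi⟩ := Function.ne_iff.1 hn
  simp only [UnitAddTorus.mFourier, ContinuousMap.coe_mk]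
  rw [integral_fintype_prod_eq_prod (𝕜 := ℂ) (fun i x => fourier (n i) x)]
  exact Finset.prod_eq_zero (Finset.mem_univ i) (integral_fourier_eq_zero hi)

theorem tendsto_mean_exp {a : ℝ} (ha : a ≠ 0) :
    Tendsto (fun U : ℝ => ((1 / U : ℝ) : ℂ) * ∫ u in (0 : ℝ)..U, Complex.exp (a * Complex.I * u))
      atTop (𝓝 0) := by
  have haI : (a * Complex.I : ℂ) ≠ 0 := by simp [ha]
  refine squeeze_zero_norm' (a := fun U : ℝ => 2 / |a| * U⁻¹) ?_ ?_
  · filter_upwards [eventually_gt_atTop 0] with U hU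
    rw [integral_exp_mul_complex haI, norm_mul, Complex.norm_real,
      Real.norm_of_nonneg (by positivity : (0 : ℝ) ≤ 1 / U), norm_div, norm_mul,
      Complex.norm_I, mul_one, Complex.norm_real, Real.norm_eq_abs, mul_comm, one_div]
    gcongr
    refine (norm_sub_le _ _).trans ?_
    have h1 : ∀ t : ℝ, ‖Complex.exp (a * Complex.I * t)‖ = 1 := by
      intro t
      rw [show (a * Complex.I * t : ℂ) = ((a * t : ℝ) : ℂ) * Complex.I by push_cast; ring,
        Complex.norm_exp_ofReal_mul_I]
    rw [h1, h1]; norm_num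
  · simpa using tendsto_inv_atTop_zero.const_mul (2 / |a|)

theorem tendsto_mean_mFourier {S : Finset ℝ} (hS : LinearIndependent ℚ fun γ : S => (γ : ℝ))
    (n : S → ℤ) :
    Tendsto (fun U : ℝ => ((1 / U : ℝ) : ℂ) *
      ∫ u in (0 : ℝ)..U, UnitAddTorus.mFourier n (torusFlow S u)) atTop
      (𝓝 (∫ x, UnitAddTorus.mFourier n x
        ∂(Measure.pi fun _ : S => (AddCircle.haarAddCircle : Measure UnitAddCircle)))) := by
  by_cases hn : n = 0
  · subst hn
    rw [UnitAddTorus.mFourier_zero]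
    simp only [ContinuousMap.one_apply, integral_const, intervalIntegral.integral_const, sub_zero]
    refine tendsto_const_nhds.congr' ?_
    filter_upwards [eventually_gt_atTop 0] with U hU
    simp [hU.ne']
  · rw [integral_mFourier_eq_zero S hn]
    simp_rw [mFourier_torusFlow]
    refine tendsto_mean_exp fun h0 => hn ?_
    rw [Fintype.linearIndependent_iff] at hS
    have := hS (fun γ => (n γ : ℚ)) (by simpa [Rat.smul_def] using h0)
    ext γ
    exact_mod_cast this γ

theorem norm_mean_le {F : ℝ → ℂ} {B : ℝ} (hF : ∀ u, ‖F u‖ ≤ B) {U : ℝ} (hU : 0 < U) :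
    ‖((1 / U : ℝ) : ℂ) * ∫ u in (0 : ℝ)..U, F u‖ ≤ B := by
  have h := intervalIntegral.norm_integral_le_of_norm_le_const (a := 0) (b := U) (C := B)
    (f := F) fun u _ => hF u
  rw [norm_mul, Complex.norm_real, Real.norm_of_nonneg (by positivity), one_div]
  rw [sub_zero, abs_of_pos hU] at h
  rw [inv_mul_le_iff₀ hU]
  linarith

/-- Weyl's equidistribution theorem for a linear flow with independent frequencies. -/
theorem tendsto_mean_torusFlow {S : Finset ℝ} (hS : LinearIndependent ℚ fun γ : S => (γ : ℝ))
    (F : C(UnitAddTorus S, ℂ)) :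
    Tendsto (fun U : ℝ => ((1 / U : ℝ) : ℂ) * ∫ u in (0 : ℝ)..U, F (torusFlow S u)) atTop
      (𝓝 (∫ x, F x
        ∂(Measure.pi fun _ : S => (AddCircle.haarAddCircle : Measure UnitAddCircle)))) := by
  set μ := Measure.pi fun _ : S => (AddCircle.haarAddCircle : Measure UnitAddCircle)
  have hcont : ∀ G : C(UnitAddTorus S, ℂ), Continuous fun u => G (torusFlow S u) :=
    fun G => G.continuous.comp (continuous_torusFlow S)
  have hii : ∀ (G : C(UnitAddTorus S, ℂ)) (a b : ℝ),
      IntervalIntegrable (fun u => G (torusFlow S u)) volume a b :=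
    fun G a b => (hcont G).intervalIntegrable a b
  have hintg : ∀ G : C(UnitAddTorus S, ℂ), Integrable G μ := fun G =>
    G.continuous.integrable_of_hasCompactSupport (HasCompactSupport.of_compactSpace _)
  have hspan : ∀ G ∈ Submodule.span ℂ (Set.range (UnitAddTorus.mFourier (d := S))),
      Tendsto (fun U : ℝ => ((1 / U : ℝ) : ℂ) * ∫ u in (0 : ℝ)..U, G (torusFlow S u)) atTop
        (𝓝 (∫ x, G x ∂μ)) := by
    intro G hG
    induction hG using Submodule.span_induction with
    | mem G h => obtain ⟨n, rfl⟩ := h; exact tendsto_mean_mFourier hS n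
    | zero => simp
    | add G H _ _ hG hH =>
      have h := hG.add hH
      rw [← integral_add (hintg G) (hintg H)] at h
      refine h.congr fun U => ?_
      simp only [ContinuousMap.add_apply]
      rw [intervalIntegral.integral_add (hii G _ _) (hii H _ _), mul_add]
    | smul c G _ hG =>
      have h := hG.const_mul c
      rw [← integral_const_mul] at h
      refine h.congr fun U => ?_
      simp only [ContinuousMap.smul_apply, smul_eq_mul]
      rw [intervalIntegral.integral_const_mul]
      ring
  rw [Metric.tendsto_nhds]
  intro ε hε
  have hF :
      F ∈ (Submodule.span ℂ (Set.range (UnitAddTorus.mFourier (d := S)))).topologicalClosure := by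
    rw [UnitAddTorus.span_mFourier_closure_eq_top]; trivial
  obtain ⟨G, hG, hFG⟩ := Metric.mem_closure_iff.1 hF (ε / 3) (by positivity)
  filter_upwards [Metric.tendsto_nhds.1 (hspan G hG) (ε / 3) (by positivity),
    eventually_gt_atTop 0] with U hU hU0
  rw [dist_eq_norm] at hFG hU ⊢
  have hpt : ∀ x, ‖(F - G) x‖ ≤ ‖F - G‖ := fun x => ContinuousMap.norm_coe_le_norm _ x
  have h1 := norm_mean_le (F := fun u => (F - G) (torusFlow S u)) (fun u => hpt _) hU0
  have h2 : ‖∫ x, (F - G) x ∂μ‖ ≤ ‖F - G‖ := by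
    simpa using norm_integral_le_of_norm_le_const (μ := μ) (Eventually.of_forall hpt)
  simp only [ContinuousMap.sub_apply] at h1 h2
  rw [intervalIntegral.integral_sub (hii F _ _) (hii G _ _), mul_sub] at h1
  rw [integral_sub (hintg F) (hintg G)] at h2
  set p := ((1 / U : ℝ) : ℂ) * ∫ u in (0 : ℝ)..U, F (torusFlow S u)
  set q := ((1 / U : ℝ) : ℂ) * ∫ u in (0 : ℝ)..U, G (torusFlow S u)
  calc ‖p - ∫ x, F x ∂μ‖ = ‖(p - q) + (q - ∫ x, G x ∂μ) - (∫ x, F x ∂μ - ∫ x, G x ∂μ)‖ := by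
        congr 1; ring
    _ ≤ ‖p - q‖ + ‖q - ∫ x, G x ∂μ‖ + ‖∫ x, F x ∂μ - ∫ x, G x ∂μ‖ :=
        (norm_sub_le _ _).trans (by gcongr; exact norm_add_le _ _)
    _ < ε := by linarith

/-- The random trigonometric sum `∑ Re (c_γ e(ω_γ))` with independent uniform phases. -/
noncomputable def waveSum (c : ℝ → ℂ) (S : Finset ℝ) (ω : ℝ → UnitAddCircle) : ℝ :=
  ∑ γ ∈ S, (c γ * fourier 1 (ω γ)).re

theorem measurable_wave (c : ℂ) :
    Measurable fun x : UnitAddCircle => (c * fourier 1 x).re := by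
  refine Continuous.measurable ?_
  fun_prop

theorem measurable_waveSum (c : ℝ → ℂ) (S : Finset ℝ) : Measurable (waveSum c S) := by
  unfold waveSum
  exact Finset.measurable_sum _ fun γ _ => (measurable_wave (c γ)).comp (measurable_pi_apply γ)

theorem waveSum_eq_restrict (c : ℝ → ℂ) (S : Finset ℝ) (ω : ℝ → UnitAddCircle) :
    waveSum c S ω = ∑ γ : S, (c γ * fourier 1 (S.restrict ω γ)).re := by
  rw [waveSum, ← Finset.sum_coe_sort]
  rfl

theorem waveSum_neg (c : ℝ → ℂ) (S : Finset ℝ) (ω : ℝ → UnitAddCircle) :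
    waveSum (fun γ => -c γ) S ω = -waveSum c S ω := by
  simp [waveSum]

theorem tendsto_mean_waveSum {S : Finset ℝ} (hS : LinearIndependent ℚ fun γ : S => (γ : ℝ))
    (c : ℝ → ℂ) {G : ℝ → ℝ} (hG : Continuous G) :
    Tendsto (fun U : ℝ => 1 / U *
      ∫ u in (0 : ℝ)..U, G (∑ γ ∈ S, (c γ * Complex.exp (γ * u * Complex.I)).re)) atTop
      (𝓝 (∫ ω, G (waveSum c S ω) ∂torusMeasure)) := by
  let H : UnitAddTorus S → ℝ := fun x => G (∑ γ : S, (c γ * fourier 1 (x γ)).re)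
  have hH : Continuous H := by
    refine hG.comp (continuous_finsetSum _ fun γ _ => ?_)
    fun_prop
  have h := tendsto_mean_torusFlow hS ⟨fun x => (H x : ℂ), Complex.continuous_ofReal.comp hH⟩
  simp only [ContinuousMap.coe_mk] at h
  have h2 := (Complex.continuous_re.tendsto _).comp h
  rw [integral_complex_ofReal, Complex.ofReal_re] at h2
  have e1 : ∫ x, H x ∂(Measure.pi fun _ : S => (AddCircle.haarAddCircle : Measure UnitAddCircle)) =
      ∫ ω, G (waveSum c S ω) ∂torusMeasure := by
    simp_rw [waveSum_eq_restrict]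
    exact (integral_restrict_infinitePi (X := fun _ => UnitAddCircle)
      (fun _ => AddCircle.haarAddCircle) (f := H) (s := S) hH.aestronglyMeasurable).symm
  rw [e1] at h2
  refine h2.congr fun U => ?_
  simp only [Function.comp_apply]
  rw [intervalIntegral.integral_ofReal, ← Complex.ofReal_mul, Complex.ofReal_re]
  congr 1
  refine intervalIntegral.integral_congr fun u _ => ?_
  simp only [H]
  congr 1
  rw [← Finset.sum_coe_sort S]
  refine Finset.sum_congr rfl fun γ _ => ?_
  simp only [torusFlow]
  rw [fourier_coe_apply]
  congr 3
  have : (Real.pi : ℂ) ≠ 0 := by exact_mod_cast Real.pi_ne_zero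
  push_cast
  field_simp

theorem map_add_half_torusMeasure :
    torusMeasure.map (fun ω γ => ω γ + (((1 / 2 : ℝ) : UnitAddCircle))) = torusMeasure := by
  unfold torusMeasure
  rw [Measure.infinitePi_map_pi (f := fun _ x => x + ((1 / 2 : ℝ) : UnitAddCircle)) _
    (fun _ => measurable_add_const _)]
  congr 1
  ext1 γ
  exact map_add_right_eq_self _ _

theorem waveSum_add_half (c : ℝ → ℂ) (S : Finset ℝ) (ω : ℝ → UnitAddCircle) :
    waveSum c S (fun γ => ω γ + ((1 / 2 : ℝ) : UnitAddCircle)) = -waveSum c S ω := by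
  have h : ∀ x : UnitAddCircle, (fourier 1 (x + ((1 / 2 : ℝ) : UnitAddCircle)) : ℂ) =
      -fourier 1 x := by
    intro x
    have := fourier_add_half_inv_index (T := 1) (n := 1) one_ne_zero (by norm_num) x
    simpa using this
  simp only [waveSum, h, mul_neg, Complex.neg_re, Finset.sum_neg_distrib]

theorem torusMeasure_waveSum_neg (c : ℝ → ℂ) (S : Finset ℝ) {A : Set ℝ} (hA : MeasurableSet A) :
    torusMeasure.real {ω | -waveSum c S ω ∈ A} = torusMeasure.real {ω | waveSum c S ω ∈ A} := by
  conv_rhs => rw [← map_add_half_torusMeasure]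
  rw [map_measureReal_apply _ (show MeasurableSet {ω | waveSum c S ω ∈ A} from
    measurable_waveSum c S hA)]
  · simp only [Set.preimage_ofPred_eq, waveSum_add_half]
  · exact measurable_pi_lambda _ fun γ => (measurable_pi_apply γ).add_const _

theorem exists_mul_fourier_eq (c : ℂ) (θ : ℝ) :
    ∃ x : UnitAddCircle, c * fourier 1 x = ‖c‖ * Complex.exp (θ * Complex.I) := by
  refine ⟨(((θ - c.arg) / (2 * Real.pi) : ℝ) : UnitAddCircle), ?_⟩
  rw [fourier_coe_apply]
  nth_rewrite 1 [← Complex.norm_mul_exp_arg_mul_I c]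
  rw [mul_assoc, ← Complex.exp_add]
  congr 2
  have : (Real.pi : ℂ) ≠ 0 := by exact_mod_cast Real.pi_ne_zero
  push_cast
  field_simp
  ring

theorem torusMeasure_waveSum_pos (c : ℝ → ℂ) (S : Finset ℝ) (θ : ℝ) {A : Set ℝ} (hA : IsOpen A)
    (h : Real.cos θ * ∑ γ ∈ S, ‖c γ‖ ∈ A) :
    0 < torusMeasure.real {ω | waveSum c S ω ∈ A} := by
  let H : UnitAddTorus S → ℝ := fun x => ∑ γ : S, (c γ * fourier 1 (x γ)).re
  have hH : Continuous H := by
    refine continuous_finsetSum _ fun γ _ => ?_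
    fun_prop
  have e : {ω | waveSum c S ω ∈ A} = S.restrict ⁻¹' (H ⁻¹' A) := by
    ext ω
    simp only [Set.mem_ofPred_eq, Set.mem_preimage, H, waveSum_eq_restrict]
  have hO : IsOpen (H ⁻¹' A) := hA.preimage hH
  rw [e, Measure.real, ENNReal.toReal_pos_iff]
  refine ⟨?_, measure_lt_top _ _⟩
  rw [← Measure.map_apply (Finset.measurable_restrict S) hO.measurableSet, torusMeasure,
    Measure.infinitePi_map_restrict]
  refine hO.measure_pos _ ?_
  choose x hx using fun γ => exists_mul_fourier_eq (c γ) θ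
  refine ⟨fun γ => x γ, ?_⟩
  simp only [Set.mem_preimage, H, hx]
  convert h using 1
  rw [Finset.mul_sum, ← Finset.sum_coe_sort S]
  refine Finset.sum_congr rfl fun γ _ => ?_
  rw [Complex.re_ofReal_mul, Complex.exp_ofReal_mul_I_re, mul_comm]

theorem indepFun_waveSum (c : ℝ → ℂ) {S T : Finset ℝ} (h : Disjoint S T) :
    ProbabilityTheory.IndepFun (waveSum c S) (waveSum c T) torusMeasure := by
  have hi : ProbabilityTheory.iIndepFun
      (fun (γ : ℝ) (ω : ℝ → UnitAddCircle) => (c γ * fourier 1 (ω γ)).re) torusMeasure :=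
    ProbabilityTheory.iIndepFun_infinitePi (X := fun γ x => (c γ * fourier 1 x).re)
      fun γ => measurable_wave (c γ)
  have h1 := hi.indepFun_finset S T h
    fun γ => (measurable_wave (c γ)).comp (measurable_pi_apply γ)
  have hm : ∀ R : Finset ℝ, Measurable fun x : R → ℝ => ∑ γ : R, x γ := fun R =>
    Finset.measurable_sum _ fun γ _ => measurable_pi_apply γ
  have h2 := h1.comp (hm S) (hm T)
  have e : ∀ R : Finset ℝ, (fun x : R → ℝ => ∑ γ : R, x γ) ∘ (fun (ω : ℝ → UnitAddCircle)
      (i : R) => (c i * fourier 1 (ω i)).re) = waveSum c R := by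
    intro R
    ext ω
    simp only [Function.comp_apply, waveSum]
    exact Finset.sum_coe_sort R fun γ => (c γ * fourier 1 (ω γ)).re
  rwa [e, e] at h2

theorem exists_measure_closedBall_le (ν : Measure ℝ) [IsProbabilityMeasure ν] [NullSingletonClass ν]
    {e : ℝ} (he : 0 < e) : ∃ η > 0, ∀ a, ν (closedBall a η) ≤ ENNReal.ofReal e := by
  let D : ℕ → Set (ℝ × ℝ) := fun n => {p | dist p.1 p.2 ≤ 1 / ((n : ℝ) + 1)}
  have hDm : ∀ n, MeasurableSet (D n) := fun n =>
    (isClosed_le (by fun_prop) (by fun_prop)).measurableSet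
  have hDa : Antitone D := by
    intro m n hmn p hp
    simp only [D, Set.mem_ofPred_eq] at hp ⊢
    refine hp.trans ?_
    gcongr
  have hlim := tendsto_measure_iInter_atTop (μ := ν.prod ν)
    (fun n => (hDm n).nullMeasurableSet) hDa ⟨0, measure_ne_top _ _⟩
  have hI : (⋂ n, D n) = {p : ℝ × ℝ | p.1 = p.2} := by
    ext p
    simp only [D, Set.mem_iInter, Set.mem_ofPred_eq]
    constructor
    · intro h
      rw [← dist_le_zero]
      exact ge_of_tendsto' tendsto_one_div_add_atTop_nhds_zero_nat h
    · intro h n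
      rw [h, dist_self]; positivity
  have h0 : (ν.prod ν) {p : ℝ × ℝ | p.1 = p.2} = 0 := by
    rw [Measure.measure_prod_null (isClosed_eq continuous_fst continuous_snd).measurableSet]
    refine Eventually.of_forall fun x => ?_
    have : Prod.mk x ⁻¹' {p : ℝ × ℝ | p.1 = p.2} = {x} := by ext y; simp [eq_comm]
    simp only [this, measure_singleton, Pi.zero_apply]
  rw [hI, h0] at hlim
  obtain ⟨n, hn⟩ := (hlim.eventually
    (gt_mem_nhds (show (0 : ENNReal) < ENNReal.ofReal e ^ 2 by positivity))).exists
  refine ⟨1 / (2 * ((n : ℝ) + 1)), by positivity, fun a => ?_⟩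
  set B := closedBall a (1 / (2 * ((n : ℝ) + 1)))
  have hsub : B ×ˢ B ⊆ D n := by
    rintro ⟨x, y⟩ ⟨hx, hy⟩
    simp only [D, Set.mem_ofPred_eq]
    have := dist_triangle_right x y a
    have h1 : dist x a ≤ _ := hx
    have h2 : dist y a ≤ _ := hy
    calc dist x y ≤ _ := this
      _ ≤ _ := add_le_add h1 h2
      _ = _ := by field_simp; norm_num
  have h1 : ν B ^ 2 ≤ ENNReal.ofReal e ^ 2 := by
    rw [sq, ← Measure.prod_prod]
    exact (measure_mono hsub).trans hn.le
  exact le_of_not_gt fun h => h1.not_gt (by gcongr)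

theorem finite_wave_level {c : ℂ} (hc : c ≠ 0) (a : ℝ) :
    {x : UnitAddCircle | (c * fourier 1 x).re = a}.Finite := by
  let p : Polynomial ℂ := Polynomial.C c * Polynomial.X ^ 2 - Polynomial.C (2 * (a : ℂ)) *
    Polynomial.X + Polynomial.C (starRingEnd ℂ c)
  have hp : p ≠ 0 := by
    intro h
    have := congrArg (fun q => Polynomial.coeff q 2) h
    simp [p] at this
    exact hc this
  refine Set.Finite.subset (Set.Finite.preimage (f := fun x : UnitAddCircle => (fourier 1 x : ℂ))
    ?_ (Polynomial.finite_setOfPred_isRoot hp)) ?_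
  · intro x _ y _ hxy
    simp only [fourier_one] at hxy
    exact AddCircle.injective_toCircle one_ne_zero (Circle.ext hxy)
  · intro x hx
    simp only [Set.mem_ofPred_eq, Set.mem_preimage, Polynomial.IsRoot.def] at hx ⊢
    simp only [p, Polynomial.eval_add, Polynomial.eval_sub, Polynomial.eval_mul,
      Polynomial.eval_C, Polynomial.eval_pow, Polynomial.eval_X]
    set z : ℂ := fourier 1 x
    have hz : z * starRingEnd ℂ z = 1 := by
      rw [Complex.mul_conj, Complex.normSq_eq_norm_sq]
      have : ‖z‖ = 1 := by simp only [z, fourier_apply]; exact Circle.norm_coe _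
      simp [this]
    have h2 : c * z + starRingEnd ℂ c * starRingEnd ℂ z = 2 * a := by
      rw [← map_mul, Complex.add_conj, hx]; push_cast; ring
    linear_combination z * h2 - (starRingEnd ℂ c) * hz

theorem haarAddCircle_singleton (x : UnitAddCircle) :
    (AddCircle.haarAddCircle : Measure UnitAddCircle) {x} = 0 := by
  have h : (volume : Measure UnitAddCircle) {x} = 0 := by
    refine le_antisymm (ENNReal.le_of_forall_pos_le_add fun e he _ => ?_) zero_le
    have h1 := AddCircle.volume_closedBall (T := 1) (x := x) ((e : ℝ) / 2)
    calc volume {x} ≤ volume (closedBall x ((e : ℝ) / 2)) :=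
          measure_mono (Set.singleton_subset_iff.2 (mem_closedBall_self (by positivity)))
      _ ≤ _ := by
        rw [h1, zero_add, ← ENNReal.ofReal_coe_nnreal]
        refine ENNReal.ofReal_le_ofReal ((min_le_right _ _).trans (by linarith))
  have h2 := AddCircle.volume_eq_smul_haarAddCircle (T := 1)
  rw [h2] at h
  simpa using h

/-- A sum containing a fixed nondegenerate wave does not concentrate. -/
theorem exists_torusMeasure_waveSum_le (c : ℝ → ℂ) {γ₀ : ℝ} (hc : c γ₀ ≠ 0) {e : ℝ} (he : 0 < e) :
    ∃ η > 0, ∀ S : Finset ℝ, γ₀ ∈ S → ∀ a,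
      torusMeasure.real {ω | |waveSum c S ω - a| ≤ η} ≤ e := by
  set ν := torusMeasure.map (waveSum c {γ₀}) with hν
  have : IsProbabilityMeasure ν :=
    Measure.isProbabilityMeasure_map (measurable_waveSum c _).aemeasurable
  have : NullSingletonClass ν := by
    refine ⟨fun a => ?_⟩
    have e1 : waveSum c {γ₀} ⁻¹' {a} =
        (fun ω : ℝ → UnitAddCircle => ω γ₀) ⁻¹' {x | (c γ₀ * fourier 1 x).re = a} := by
      ext ω; simp [waveSum]
    have hf := finite_wave_level hc a
    rw [hν, Measure.map_apply (measurable_waveSum c _) (measurableSet_singleton a), e1,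
      ← Measure.map_apply (measurable_pi_apply γ₀) hf.measurableSet, torusMeasure,
      Measure.infinitePi_map_eval]
    rw [← Set.biUnion_of_singleton {x : UnitAddCircle | (c γ₀ * fourier 1 x).re = a}]
    exact (measure_biUnion_null_iff hf.countable).2 fun x _ => haarAddCircle_singleton x
  obtain ⟨η, hη, h⟩ := exists_measure_closedBall_le ν he
  refine ⟨η, hη, fun S hS a => ?_⟩
  have hind := indepFun_waveSum c (S := S.erase γ₀) (T := {γ₀})
    (Finset.disjoint_singleton_right.2 (Finset.notMem_erase γ₀ S))
  rw [ProbabilityTheory.indepFun_iff_map_prod_eq_prod_map_map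
    (measurable_waveSum c _).aemeasurable (measurable_waveSum c _).aemeasurable] at hind
  let E : Set (ℝ × ℝ) := {p | |p.1 + p.2 - a| ≤ η}
  have hE : MeasurableSet E := (isClosed_le (by fun_prop) (by fun_prop)).measurableSet
  have hset : {ω | |waveSum c S ω - a| ≤ η} =
      (fun ω => (waveSum c (S.erase γ₀) ω, waveSum c {γ₀} ω)) ⁻¹' E := by
    ext ω
    simp only [E, Set.mem_ofPred_eq, Set.mem_preimage]
    have : waveSum c S ω = waveSum c (S.erase γ₀) ω + waveSum c {γ₀} ω := by
      simp only [waveSum, Finset.sum_singleton]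
      rw [Finset.sum_erase_add _ _ hS]
    rw [this]
  rw [hset, Measure.real, ← Measure.map_apply
    ((measurable_waveSum c _).prodMk (measurable_waveSum c _)) hE, hind,
    Measure.prod_apply hE]
  have : IsProbabilityMeasure (torusMeasure.map (waveSum c (S.erase γ₀))) :=
    Measure.isProbabilityMeasure_map (measurable_waveSum c _).aemeasurable
  refine ENNReal.toReal_le_of_le_ofReal he.le ?_
  calc _ ≤ ∫⁻ _ : ℝ, ENNReal.ofReal e ∂(torusMeasure.map (waveSum c (S.erase γ₀))) := by
        refine lintegral_mono fun x => ?_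
        refine le_trans (measure_mono ?_) (h (a - x))
        intro y hy
        simp only [E, Set.mem_preimage, Set.mem_ofPred_eq] at hy
        rw [mem_closedBall, Real.dist_eq]
        convert hy using 2
        ring
    _ = _ := by simp

theorem eventually_density_le {f : ℝ → ℝ} (hf : Measurable f) {S : Finset ℝ}
    (hS : LinearIndependent ℚ fun γ : S => (γ : ℝ)) {c : ℝ → ℂ} {a ε η e : ℝ} (hε : 0 ≤ ε)
    (hms : MeanSquareLE
      (fun u => f u - a - ∑ γ ∈ S, (c γ * Complex.exp (γ * u * Complex.I)).re) ε)
    (hη : 0 < η) (he : 0 < e) :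
    ∀ᶠ U in atTop, volume.real ({u | 0 ≤ f u} ∩ Set.Ioc 0 U) / U ≤
      torusMeasure.real {ω | -(2 * η) ≤ a + waveSum c S ω} + ε / η ^ 2 + e := by
  set s : ℝ → ℝ := fun u => ∑ γ ∈ S, (c γ * Complex.exp (γ * u * Complex.I)).re with hs
  have hsc : Continuous s := by
    refine continuous_finsetSum _ fun γ _ => ?_
    fun_prop
  let G : ℝ → ℝ := fun x => max 0 (min 1 ((a + x) / η + 2))
  have hG : Continuous G := by fun_prop
  have hG0 : ∀ x, 0 ≤ G x := fun x => le_max_left _ _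
  have hG1 : ∀ x, G x ≤ 1 := fun x => max_le zero_le_one (min_le_left _ _)
  have hGone : ∀ x, -η ≤ a + x → 1 ≤ G x := by
    intro x hx
    refine le_max_of_le_right (le_min le_rfl ?_)
    have : -1 ≤ (a + x) / η := by rw [le_div_iff₀ hη]; linarith
    linarith
  have hGzero : ∀ x, a + x < -(2 * η) → G x = 0 := by
    intro x hx
    refine max_eq_left ((min_le_right _ _).trans ?_)
    have : (a + x) / η ≤ -2 := by rw [div_le_iff₀ hη]; linarith
    linarith
  have hA : MeasurableSet {ω | -(2 * η) ≤ a + waveSum c S ω} :=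
    measurableSet_le measurable_const ((measurable_waveSum c S).const_add a)
  have hGP : ∫ ω, G (waveSum c S ω) ∂torusMeasure ≤
      torusMeasure.real {ω | -(2 * η) ≤ a + waveSum c S ω} := by
    rw [← integral_indicator_one hA]
    refine integral_mono_of_nonneg (Eventually.of_forall fun ω => hG0 _)
      ((integrable_const (1 : ℝ)).indicator hA) (Eventually.of_forall fun ω => ?_)
    by_cases h : ω ∈ {ω | -(2 * η) ≤ a + waveSum c S ω}
    · simp only [Set.indicator_of_mem h]; exact hG1 _
    · simp only [Set.indicator_of_notMem h]
      exact (hGzero _ (not_le.1 h)).le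
  have hlim := tendsto_mean_waveSum hS c hG
  filter_upwards [hlim.eventually (gt_mem_nhds (lt_add_of_pos_right _ he)), hms,
    eventually_gt_atTop 0] with U hU hUms hU0
  have h1 : volume.real ({u | η ≤ |f u - a - s u|} ∩ Set.Ioc 0 U) ≤ ε / η ^ 2 * U := by
    refine ENNReal.toReal_le_of_le_ofReal (by positivity) ?_
    have hm : Measurable fun u => ‖f u - a - s u‖ₑ ^ 2 :=
      ((hf.sub_const a).sub hsc.measurable).enorm.pow_const 2
    have h2 := mul_meas_ge_le_lintegral (μ := volume.restrict (Set.Ioc 0 U)) hm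
      (ENNReal.ofReal (η ^ 2))
    have h3 := h2.trans hUms
    rw [Measure.restrict_apply' measurableSet_Ioc] at h3
    have h4 : {u | ENNReal.ofReal (η ^ 2) ≤ ‖f u - a - s u‖ₑ ^ 2} = {u | η ≤ |f u - a - s u|} := by
      ext u
      simp only [Set.mem_ofPred_eq]
      rw [← ofReal_norm, ← ENNReal.ofReal_pow (norm_nonneg _),
        ENNReal.ofReal_le_ofReal_iff (by positivity), Real.norm_eq_abs,
        pow_le_pow_iff_left₀ hη.le (abs_nonneg _) two_ne_zero]
    rw [h4] at h3
    have hη2 : 0 < η ^ 2 := by positivity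
    rw [div_mul_eq_mul_div, ENNReal.ofReal_div_of_pos hη2]
    rw [ENNReal.le_div_iff_mul_le (by simp [hη.ne']) (by simp), mul_comm]
    exact h3
  have h2 : volume.real ({u | -η ≤ a + s u} ∩ Set.Ioc 0 U) ≤ ∫ u in (0 : ℝ)..U, G (s u) := by
    have hGi : IntegrableOn (fun u => G (s u)) (Set.Ioc 0 U) :=
      ((hG.comp hsc).intervalIntegrable 0 U).1
    refine ENNReal.toReal_le_of_le_ofReal
      (intervalIntegral.integral_nonneg hU0.le fun u _ => hG0 _) ?_
    rw [intervalIntegral.integral_of_le hU0.le,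
      ofReal_integral_eq_lintegral_ofReal hGi (Eventually.of_forall fun u => hG0 _),
      ← Measure.restrict_apply' measurableSet_Ioc]
    refine meas_le_lintegral₀ (hG.comp hsc).measurable.ennreal_ofReal.aemeasurable fun u hu => ?_
    rw [← ENNReal.ofReal_one]
    exact ENNReal.ofReal_le_ofReal (hGone _ hu)
  have h3 : volume.real ({u | 0 ≤ f u} ∩ Set.Ioc 0 U) ≤
      volume.real ({u | η ≤ |f u - a - s u|} ∩ Set.Ioc 0 U) +
        volume.real ({u | -η ≤ a + s u} ∩ Set.Ioc 0 U) := by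
    refine (measureReal_mono ?_ ?_).trans (measureReal_union_le _ _)
    · rintro u ⟨hu, hu'⟩
      by_cases h : η ≤ |f u - a - s u|
      · exact Or.inl ⟨h, hu'⟩
      · refine Or.inr ⟨?_, hu'⟩
        have := (abs_lt.1 (not_le.1 h)).2
        simp only [Set.mem_ofPred_eq] at hu ⊢
        linarith
    · refine ne_top_of_le_ne_top (measure_Ioc_lt_top (a := (0 : ℝ)) (b := U)).ne
        (measure_mono (Set.union_subset Set.inter_subset_right Set.inter_subset_right))
  rw [div_le_iff₀ hU0]
  have h4 : ∫ u in (0 : ℝ)..U, G (s u) ≤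
      (torusMeasure.real {ω | -(2 * η) ≤ a + waveSum c S ω} + e) * U := by
    have h5 := hU.le.trans (add_le_add hGP le_rfl)
    rwa [one_div, inv_mul_le_iff₀ hU0, mul_comm U] at h5
  linarith

theorem integral_waveSum_sq_le {S : Finset ℝ}
    (hS : LinearIndependent ℚ fun γ : S => (γ : ℝ)) {c : ℝ → ℂ} {ε : ℝ} (hε : 0 ≤ ε)
    (hms : MeanSquareLE
      (fun u : ℝ => ∑ γ ∈ S, (c γ * Complex.exp (γ * u * Complex.I)).re) ε) :
    ∫ ω, waveSum c S ω ^ 2 ∂torusMeasure ≤ ε := by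
  refine le_of_tendsto (tendsto_mean_waveSum hS c (G := fun x => x ^ 2) (by fun_prop)) ?_
  filter_upwards [hms, eventually_gt_atTop 0] with U hU hU0
  set s : ℝ → ℝ := fun u => ∑ γ ∈ S, (c γ * Complex.exp (γ * u * Complex.I)).re with hs
  have hsc : Continuous s := by
    refine continuous_finsetSum _ fun γ _ => ?_
    fun_prop
  rw [one_div, inv_mul_le_iff₀ hU0, mul_comm U, intervalIntegral.integral_of_le hU0.le]
  change ∫ u in Set.Ioc 0 U, s u ^ 2 ≤ _
  have hi : IntegrableOn (fun u => s u ^ 2) (Set.Ioc 0 U) :=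
    ((hsc.pow 2).intervalIntegrable 0 U).1
  rw [← ENNReal.ofReal_le_ofReal_iff (by positivity), ofReal_integral_eq_lintegral_ofReal
    hi (Eventually.of_forall fun u => sq_nonneg _)]
  refine le_trans (le_of_eq (lintegral_congr fun u => ?_)) hU
  rw [← ofReal_norm, ← ENNReal.ofReal_pow (norm_nonneg _), Real.norm_eq_abs, sq_abs]

theorem abs_waveSum_le (c : ℝ → ℂ) (S : Finset ℝ) (ω : ℝ → UnitAddCircle) :
    |waveSum c S ω| ≤ ∑ γ ∈ S, ‖c γ‖ := by
  refine (Finset.abs_sum_le_sum_abs _ _).trans (Finset.sum_le_sum fun γ _ => ?_)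
  refine (Complex.abs_re_le_norm _).trans ?_
  rw [norm_mul, fourier_apply, Circle.norm_coe, mul_one]

theorem half_le_torusMeasure_waveSum {S : Finset ℝ}
    (hS : LinearIndependent ℚ fun γ : S => (γ : ℝ)) {c : ℝ → ℂ}
    (hms : MeanSquareLE
      (fun u : ℝ => ∑ γ ∈ S, (c γ * Complex.exp (γ * u * Complex.I)).re) (1 / 32)) :
    1 / 2 ≤ torusMeasure.real {ω | |waveSum c S ω| < 1 / 4} := by
  have h1 := integral_waveSum_sq_le hS (by norm_num) hms
  have hi : Integrable (fun ω => waveSum c S ω ^ 2) torusMeasure := by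
    refine Integrable.of_bound (C := (∑ γ ∈ S, ‖c γ‖) ^ 2)
      ((measurable_waveSum c S).pow_const 2).aestronglyMeasurable
      (Eventually.of_forall fun ω => ?_)
    rw [norm_pow, Real.norm_eq_abs]
    gcongr
    exact abs_waveSum_le c S ω
  have h2 := mul_meas_ge_le_integral_of_nonneg (μ := torusMeasure)
    (Eventually.of_forall fun ω => sq_nonneg (waveSum c S ω)) hi (1 / 16)
  have h3 : {ω | |waveSum c S ω| < 1 / 4} = {ω | 1 / 16 ≤ waveSum c S ω ^ 2}ᶜ := by
    ext ω
    simp only [Set.mem_ofPred_eq, Set.mem_compl_iff, not_le]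
    rw [← sq_abs, show (1 / 16 : ℝ) = (1 / 4) ^ 2 by norm_num,
      pow_lt_pow_iff_left₀ (abs_nonneg _) (by norm_num) two_ne_zero]
  rw [h3, probReal_compl_eq_one_sub
    (measurableSet_le measurable_const ((measurable_waveSum c S).pow_const 2))]
  linarith

theorem half_mul_torusMeasure_le {S T : Finset ℝ} (hST : Disjoint S T)
    (hT : LinearIndependent ℚ fun γ : T => (γ : ℝ)) {c : ℝ → ℂ}
    (hms : MeanSquareLE
      (fun u : ℝ => ∑ γ ∈ T, (c γ * Complex.exp (γ * u * Complex.I)).re) (1 / 32))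
    {A B : Set ℝ} (hA : MeasurableSet A) (hAB : ∀ x ∈ A, ∀ y, |y| < 1 / 4 → x + y ∈ B) :
    torusMeasure.real {ω | waveSum c S ω ∈ A} / 2 ≤
      torusMeasure.real {ω | waveSum c (S ∪ T) ω ∈ B} := by
  have h1 := half_le_torusMeasure_waveSum hT hms
  have h2 := (indepFun_waveSum c hST).measure_inter_preimage_eq_mul A {y | |y| < 1 / 4} hA
    (measurableSet_lt (by fun_prop) (by fun_prop))
  have h3 := congrArg ENNReal.toReal h2
  rw [ENNReal.toReal_mul] at h3
  calc torusMeasure.real {ω | waveSum c S ω ∈ A} / 2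
      ≤ torusMeasure.real {ω | waveSum c S ω ∈ A} *
        torusMeasure.real {ω | |waveSum c T ω| < 1 / 4} := by
        have : 0 ≤ torusMeasure.real {ω | waveSum c S ω ∈ A} := measureReal_nonneg
        nlinarith
    _ = torusMeasure.real (waveSum c S ⁻¹' A ∩ waveSum c T ⁻¹' {y | |y| < 1 / 4}) := h3.symm
    _ ≤ _ := by
        refine measureReal_mono ?_ (measure_ne_top _ _)
        rintro ω ⟨hω, hω'⟩
        simp only [Set.mem_ofPred_eq]
        have : waveSum c (S ∪ T) ω = waveSum c S ω + waveSum c T ω := Finset.sum_union hST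
        rw [this]
        exact hAB _ hω _ hω'

theorem eventually_density_mem {f : ℝ → ℝ} (hf : Measurable f) {S : Finset ℝ}
    (hS : LinearIndependent ℚ fun γ : S => (γ : ℝ)) {c : ℝ → ℂ} {ε η e : ℝ} (hε : 0 ≤ ε)
    (hms : MeanSquareLE
      (fun u => f u - 1 - ∑ γ ∈ S, (c γ * Complex.exp (γ * u * Complex.I)).re) ε)
    (hη : 0 < η) (he : 0 < e) :
    ∀ᶠ U in atTop,
      1 - torusMeasure.real {ω | 1 + waveSum c S ω ≤ 2 * η} - ε / η ^ 2 - e ≤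
        volume.real ({u | 0 < f u} ∩ Set.Ioc 0 U) / U ∧
      volume.real ({u | 0 < f u} ∩ Set.Ioc 0 U) / U ≤
        torusMeasure.real {ω | -(2 * η) ≤ 1 + waveSum c S ω} + ε / η ^ 2 + e := by
  have hms' : MeanSquareLE
      (fun u => (-f u) - (-1) - ∑ γ ∈ S, (-c γ * Complex.exp (γ * u * Complex.I)).re) ε := by
    refine hms.mono (fun u _ => le_of_eq ?_) le_rfl
    rw [← norm_neg]
    congr 1
    simp only [neg_mul, Complex.neg_re, Finset.sum_neg_distrib]
    ring
  have h2 := eventually_density_le hf.neg hS (c := fun γ => -c γ) hε hms' hη he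
  filter_upwards [eventually_density_le hf hS hε hms hη he, h2, eventually_gt_atTop 0]
    with U hU hU' hU0
  constructor
  · have e1 : {ω | -(2 * η) ≤ -1 + waveSum (fun γ => -c γ) S ω} =
        {ω | 1 + waveSum c S ω ≤ 2 * η} := by
      ext ω
      simp only [Set.mem_ofPred_eq, waveSum_neg]
      constructor <;> intro h <;> linarith
    rw [e1] at hU'
    simp only [Pi.neg_apply] at hU'
    have h3 : U ≤ volume.real ({u | 0 < f u} ∩ Set.Ioc 0 U) +
        volume.real ({u | 0 ≤ -f u} ∩ Set.Ioc 0 U) := by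
      calc U = volume.real (Set.Ioc 0 U) := by simp [hU0.le]
        _ ≤ volume.real (({u | 0 < f u} ∩ Set.Ioc 0 U) ∪ ({u | 0 ≤ -f u} ∩ Set.Ioc 0 U)) := by
            refine measureReal_mono ?_ ?_
            · intro u hu
              rcases lt_or_ge 0 (f u) with h | h
              · exact Or.inl ⟨h, hu⟩
              · exact Or.inr ⟨by simpa using h, hu⟩
            · exact ne_top_of_le_ne_top (measure_Ioc_lt_top (a := (0 : ℝ)) (b := U)).ne
                (measure_mono (Set.union_subset Set.inter_subset_right Set.inter_subset_right))
        _ ≤ _ := measureReal_union_le _ _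
    have h4 : 1 ≤ volume.real ({u | 0 < f u} ∩ Set.Ioc 0 U) / U +
        volume.real ({u | 0 ≤ -f u} ∩ Set.Ioc 0 U) / U := by
      rw [← add_div, le_div_iff₀ hU0, one_mul]; exact h3
    linarith
  · refine le_trans ?_ hU
    gcongr
    · exact ne_top_of_le_ne_top (measure_Ioc_lt_top (a := (0 : ℝ)) (b := U)).ne
        (measure_mono Set.inter_subset_right)
    · exact fun h => le_of_lt h

theorem torusMeasure_waveSum_le_neg (c : ℝ → ℂ) (S : Finset ℝ) {b : ℝ} (hb : 0 < b) :
    torusMeasure.real {ω | waveSum c S ω ≤ -b} =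
      (1 - torusMeasure.real {ω | |waveSum c S ω| < b}) / 2 := by
  have hm := measurable_waveSum c S
  have h1 := torusMeasure_waveSum_neg c S (A := Set.Iic (-b)) measurableSet_Iic
  have e1 : {ω | |waveSum c S ω| < b}ᶜ =
      {ω | waveSum c S ω ∈ Set.Iic (-b)} ∪ {ω | -waveSum c S ω ∈ Set.Iic (-b)} := by
    ext ω
    simp only [Set.mem_compl_iff, Set.mem_ofPred_eq, not_lt, Set.mem_union, Set.mem_Iic, le_abs]
    constructor
    · rintro (h | h)
      · right; linarith
      · left; linarith
    · rintro (h | h)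
      · right; linarith
      · left; linarith
  have h2 := probReal_compl_eq_one_sub (μ := torusMeasure)
    (show MeasurableSet {ω | |waveSum c S ω| < b} from
      measurableSet_lt (by fun_prop) measurable_const)
  rw [e1, measureReal_union, h1] at h2
  · have e2 : {ω | waveSum c S ω ≤ -b} = {ω | waveSum c S ω ∈ Set.Iic (-b)} := rfl
    rw [e2]
    linarith
  · rw [Set.disjoint_left]
    intro ω h h'
    simp only [Set.mem_ofPred_eq, Set.mem_Iic] at h h'
    linarith
  · exact hm.neg measurableSet_Iic

/-- A function on the line that is approximable in mean square by `1` plus trigonometric sums with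
independent frequencies and divergent coefficient sum is positive with density in `(1/2, 1)`. -/
theorem exists_density {f : ℝ → ℝ} (hf : Measurable f) {Γ : Set ℝ}
    (hΓ : LinearIndependent ℚ fun γ : Γ => (γ : ℝ)) {c : ℝ → ℂ}
    (hms : ∀ ε > 0, ∃ T₀ : Finset ℝ, (T₀ : Set ℝ) ⊆ Γ ∧ ∀ T : Finset ℝ, T₀ ⊆ T →
      (T : Set ℝ) ⊆ Γ → MeanSquareLE
        (fun u => f u - 1 - ∑ γ ∈ T, (c γ * Complex.exp (γ * u * Complex.I)).re) ε)
    (hc : ∀ B, ∃ T : Finset ℝ, (T : Set ℝ) ⊆ Γ ∧ B ≤ ∑ γ ∈ T, ‖c γ‖) :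
    ∃ δ : ℝ, Tendsto (fun U : ℝ => volume.real ({u | 0 < f u} ∩ Set.Ioc 0 U) / U) atTop (𝓝 δ) ∧
      1 / 2 < δ ∧ δ < 1 := by
  set D : ℝ → ℝ := fun U => volume.real ({u | 0 < f u} ∩ Set.Ioc 0 U) / U with hD
  have hLI : ∀ S : Finset ℝ, (S : Set ℝ) ⊆ Γ → LinearIndependent ℚ fun γ : S => (γ : ℝ) := by
    intro S hS
    exact hΓ.comp (fun γ : S => (⟨γ, hS γ.2⟩ : Γ)) fun a b h =>
      Subtype.ext (congrArg (fun x : Γ => (x : ℝ)) h)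
  have hunion : ∀ {S T : Finset ℝ}, (S : Set ℝ) ⊆ Γ → (T : Set ℝ) ⊆ Γ →
      ((S ∪ T : Finset ℝ) : Set ℝ) ⊆ Γ := by
    intro S T hS hT
    rw [Finset.coe_union]
    exact Set.union_subset hS hT
  obtain ⟨γ₀, hγ₀, hcγ₀⟩ : ∃ γ₀ ∈ Γ, c γ₀ ≠ 0 := by
    obtain ⟨T, hT, hB⟩ := hc 1
    by_contra! h
    rw [Finset.sum_eq_zero fun γ hγ => by rw [h γ (hT hγ), norm_zero]] at hB
    norm_num at hB
  have hcauchy : CauchySeq D := by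
    rw [Metric.cauchySeq_iff']
    intro e₀ he₀
    set e := e₀ / 6 with he
    have hepos : 0 < e := by positivity
    obtain ⟨η', hη', hconc⟩ := exists_torusMeasure_waveSum_le c hcγ₀ hepos
    set η := η' / 2 with hη
    have hηpos : 0 < η := by positivity
    obtain ⟨T₀, hT₀, hT⟩ := hms (e * η ^ 2) (by positivity)
    set S := T₀ ∪ {γ₀}
    have hSΓ : (S : Set ℝ) ⊆ Γ := hunion hT₀ (by simpa using hγ₀)
    have hb := eventually_density_mem hf (hLI S hSΓ) (by positivity)
      (hT S Finset.subset_union_left hSΓ) hηpos hepos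
    rw [mul_div_assoc, div_self (by positivity), mul_one] at hb
    have hu : torusMeasure.real {ω | -(2 * η) ≤ 1 + waveSum c S ω} ≤
        1 - torusMeasure.real {ω | 1 + waveSum c S ω ≤ 2 * η} + e := by
      have h1 := hconc S (Finset.mem_union_right _ (Finset.mem_singleton_self _)) (-1)
      rw [← probReal_compl_eq_one_sub (measurableSet_le
        ((measurable_waveSum c S).const_add 1) measurable_const)]
      refine le_trans ?_ (add_le_add le_rfl h1)
      refine (measureReal_mono ?_ (measure_ne_top _ _)).trans (measureReal_union_le _ _)
      intro ω hω
      simp only [Set.mem_ofPred_eq, Set.mem_union, Set.mem_compl_iff, not_le] at hω ⊢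
      rcases lt_or_ge (2 * η) (1 + waveSum c S ω) with h | h
      · exact Or.inl h
      · right
        rw [abs_le]
        constructor <;> linarith
    obtain ⟨N, hN⟩ := eventually_atTop.1 hb
    refine ⟨N, fun n hn => ?_⟩
    have h1 := hN n hn
    have h2 := hN N le_rfl
    rw [Real.dist_eq, abs_lt]
    constructor <;> linarith [h1.1, h1.2, h2.1, h2.2]
  obtain ⟨δ, hδ⟩ := cauchySeq_tendsto_of_complete hcauchy
  refine ⟨δ, hδ, ?_⟩
  obtain ⟨T₀, hT₀, hT₀ms⟩ := hms (1 / 128) (by norm_num)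
  obtain ⟨T₁, hT₁, hT₁c⟩ := hc 4
  set S₁ := T₀ ∪ T₁
  have hS₁ : (S₁ : Set ℝ) ⊆ Γ := hunion hT₀ hT₁
  have hS₁c : 4 ≤ ∑ γ ∈ S₁, ‖c γ‖ := hT₁c.trans
    (Finset.sum_le_sum_of_subset_of_nonneg Finset.subset_union_right fun _ _ _ => norm_nonneg _)
  set κ := torusMeasure.real {ω | waveSum c S₁ ω ∈ Set.Ioo (-(1 / 4)) (1 / 4)} / 2
  set κ' := torusMeasure.real {ω | waveSum c S₁ ω ∈ Set.Iio (-2)} / 2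
  have hκ : 0 < κ := half_pos (torusMeasure_waveSum_pos c S₁ (Real.pi / 2) isOpen_Ioo (by simp))
  have hκ' : 0 < κ' := half_pos (torusMeasure_waveSum_pos c S₁ Real.pi isOpen_Iio (by
    rw [Real.cos_pi, Set.mem_Iio]; linarith))
  set m := min κ κ'
  have hm : 0 < m := lt_min hκ hκ'
  obtain ⟨T₂, hT₂, hT₂ms⟩ := hms (m / 128) (by positivity)
  set S := S₁ ∪ (T₂ \ S₁) with hS
  have hSeq : S = S₁ ∪ T₂ := Finset.union_sdiff_self_eq_union
  have hdΓ : ((T₂ \ S₁ : Finset ℝ) : Set ℝ) ⊆ Γ :=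
    (Finset.coe_subset.2 Finset.sdiff_subset).trans hT₂
  have hSΓ : (S : Set ℝ) ⊆ Γ := by rw [hSeq]; exact hunion hS₁ hT₂
  have htail : MeanSquareLE
      (fun u : ℝ => ∑ γ ∈ T₂ \ S₁, (c γ * Complex.exp (γ * u * Complex.I)).re) (1 / 32) := by
    have h1 := hT₀ms S₁ Finset.subset_union_left hS₁
    have h2 := hT₀ms S (Finset.subset_union_left.trans Finset.subset_union_left) hSΓ
    have h2' : MeanSquareLE (fun u =>
        -(f u - 1 - ∑ γ ∈ S, (c γ * Complex.exp (γ * u * Complex.I)).re)) (1 / 128) :=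
      h2.mono (fun u _ => by rw [norm_neg]) le_rfl
    have h3 := h1.add h2' (by fun_prop) (by norm_num) (by norm_num)
    refine h3.mono (fun u _ => le_of_eq ?_) (by norm_num)
    congr 1
    rw [hS, Finset.sum_union Finset.disjoint_sdiff]
    ring
  have hb := eventually_density_mem hf (hLI S hSΓ) (ε := m / 128) (η := 1 / 4) (e := m / 8)
    (by positivity) (hT₂ms S (by rw [hSeq]; exact Finset.subset_union_right) hSΓ)
    (by norm_num) (by positivity)
  have hlow : κ ≤ torusMeasure.real {ω | waveSum c S ω ∈ Set.Ioo (-(1 / 2)) (1 / 2)} :=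
    half_mul_torusMeasure_le Finset.disjoint_sdiff (hLI _ hdΓ) htail measurableSet_Ioo
      fun x hx y hy => by
        rw [abs_lt] at hy
        exact ⟨by linarith [hx.1, hy.1], by linarith [hx.2, hy.2]⟩
  have hupp : κ' ≤ torusMeasure.real {ω | waveSum c S ω ∈ Set.Iio (-(3 / 2))} :=
    half_mul_torusMeasure_le Finset.disjoint_sdiff (hLI _ hdΓ) htail measurableSet_Iio
      fun x hx y hy => by
        rw [abs_lt] at hy
        rw [Set.mem_Iio] at hx ⊢
        linarith [hy.2]
  have e1 : {ω | 1 + waveSum c S ω ≤ 2 * (1 / 4)} = {ω | waveSum c S ω ≤ -(1 / 2)} := by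
    ext ω
    simp only [Set.mem_ofPred_eq]
    constructor <;> intro h <;> linarith
  have e2 : {ω | waveSum c S ω ∈ Set.Ioo (-(1 / 2)) (1 / 2)} =
      {ω | |waveSum c S ω| < 1 / 2} := by
    ext ω
    simp only [Set.mem_ofPred_eq, Set.mem_Ioo, abs_lt]
  have e3 : {ω | -(2 * (1 / 4)) ≤ 1 + waveSum c S ω} =
      {ω | waveSum c S ω ∈ Set.Iio (-(3 / 2))}ᶜ := by
    ext ω
    simp only [Set.mem_ofPred_eq, Set.mem_compl_iff, Set.mem_Iio, not_lt]
    constructor <;> intro h <;> linarith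
  rw [e1, torusMeasure_waveSum_le_neg c S (by norm_num), e3, probReal_compl_eq_one_sub
    (show MeasurableSet {ω | waveSum c S ω ∈ Set.Iio (-(3 / 2))} from
      measurable_waveSum c S measurableSet_Iio)] at hb
  rw [e2] at hlow
  rw [show m / 128 / (1 / 4) ^ 2 = m / 8 by ring] at hb
  have hmκ : m ≤ κ := min_le_left _ _
  have hmκ' : m ≤ κ' := min_le_right _ _
  constructor
  · have := ge_of_tendsto hδ (hb.mono fun U h => h.1)
    linarith
  · have := le_of_tendsto hδ (hb.mono fun U h => h.2)
    linarith

theorem analyticOrderNatAt_neg_of_even {h : ℂ → ℂ} (heven : ∀ z, h (-z) = h z) (ρ : ℂ) :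
    analyticOrderNatAt h (-ρ) = analyticOrderNatAt h ρ := by
  have h1 := analyticOrderAt_comp_of_deriv_ne_zero (f := h) (g := fun z : ℂ => -z) (z₀ := ρ)
    (by fun_prop) (by simp)
  have h2 : h ∘ (fun z : ℂ => -z) = h := funext heven
  rw [h2] at h1
  rw [analyticOrderNatAt, analyticOrderNatAt, h1]

/-- For an even entire function the error in the partial fraction expansion of the logarithmic
derivative vanishes at the origin. -/
theorem norm_logDeriv_sub_sum_le_of_even {h : ℂ → ℂ} (hh : Differentiable ℂ h)
    (heven : ∀ z, h (-z) = h z) (h0 : h 0 ≠ 0) {R M : ℝ} (hR : 0 < R) (hM : 1 < M)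
    (hb : ∀ z ∈ closedBall 0 R, ‖h z‖ ≤ M * ‖h 0‖) :
    ∃ T : Finset ℂ, (∀ ρ ∈ T, h ρ = 0) ∧ ∀ z ∈ ball (0 : ℂ) (R / 4), h z ≠ 0 →
      ‖logDeriv h z - ∑ ρ ∈ T, (analyticOrderNatAt h ρ : ℂ) / (z - ρ)‖ ≤
        260 * Real.log M / R ^ 2 * ‖z‖ := by
  obtain ⟨T, hT, -, hbound⟩ := logDeriv_sub_sum_le hh (c := 0) (r₁ := R / 4) (r₂ := R / 2) (R := R)
    (by positivity) (by linarith) (by linarith) hM h0 hb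
  refine ⟨T, fun ρ hρ => ((hT ρ).1 hρ).2, ?_⟩
  have hlogM : 0 < Real.log M := Real.log_pos hM
  have hK : (8 * (R / 2) / (R / 2 - R / 4) ^ 2 +
      R / 2 / ((R ^ 2 - (R / 2) ^ 2) * Real.log (R / (R / 2)))) * Real.log M ≤
      65 / R * Real.log M := by
    gcongr
    have e1 : R / (R / 2) = 2 := by field_simp
    rw [e1]
    have hl : 2 / 3 < Real.log 2 := by linarith [Real.log_two_gt_d9]
    have e2 : 8 * (R / 2) / (R / 2 - R / 4) ^ 2 = 64 / R := by field_simp; norm_num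
    have e3 : R / 2 / ((R ^ 2 - (R / 2) ^ 2) * Real.log 2) = (2 / (3 * Real.log 2)) / R := by
      field_simp; norm_num
    have e4 : 2 / (3 * Real.log 2) ≤ 1 := by
      rw [div_le_one (by positivity)]; linarith
    rw [e2, e3, ← add_div]
    gcongr
    linarith
  obtain ⟨g, hd, hne, hfac⟩ := hh.exists_eq_prod_pow_mul h0 T
  set m := analyticOrderNatAt h with hm
  have hgne : ∀ z ∈ ball (0 : ℂ) (R / 4), g z ≠ 0 := by
    intro z hz hgz
    refine hne z ((hT z).2 ⟨ball_subset_closedBall (ball_subset_ball (by linarith) hz), ?_⟩) hgz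
    rw [hfac, hgz, mul_zero]
  have hld : ∀ z ∈ ball (0 : ℂ) (R / 4), h z ≠ 0 →
      logDeriv h z = (∑ ρ ∈ T, (m ρ : ℂ) / (z - ρ)) + logDeriv g z := by
    intro z hz hfz
    have hzρ : ∀ ρ ∈ T, z - ρ ≠ 0 := by
      intro ρ hρ h2
      rw [sub_eq_zero.1 h2] at hfz
      exact hfz ((hT ρ).1 hρ).2
    have hfe : h = fun z => (∏ ρ ∈ T, (z - ρ) ^ m ρ) * g z := funext hfac
    rw [hfe, logDeriv_mul z (Finset.prod_ne_zero_iff.2 fun ρ hρ => pow_ne_zero _ (hzρ ρ hρ))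
      (hgne z hz) (by fun_prop) (hd z), logDeriv_prod (f := fun ρ z => (z - ρ) ^ m ρ)
      (fun ρ hρ => pow_ne_zero _ (hzρ ρ hρ)) (fun ρ _ => by fun_prop)]
    congr 1
    refine Finset.sum_congr rfl fun ρ hρ => ?_
    rw [logDeriv_fun_pow (by fun_prop), logDeriv_apply, deriv_sub_const, deriv_id'']
    ring
  have hgd : DifferentiableOn ℂ (logDeriv g) (ball 0 (R / 4)) := by
    intro z hz
    have h1 : DifferentiableAt ℂ (deriv g) z := (hd.analyticAt z).deriv.differentiableAt
    exact (h1.div (hd z) (hgne z hz)).differentiableWithinAt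
  have hmem0 : (0 : ℂ) ∈ ball (0 : ℂ) (R / 4) := mem_ball_self (by positivity)
  have hg0 : logDeriv g 0 = 0 := by
    have h1 := hld 0 hmem0 h0
    have h2 : deriv h 0 = 0 := by
      have h3 := deriv_comp_neg (f := h) (x := 0)
      rw [neg_zero, show (fun x => h (-x)) = h from funext heven] at h3
      exact self_eq_neg.1 h3
    have h3 : ∑ ρ ∈ T, (m ρ : ℂ) / (0 - ρ) = 0 := by
      have h4 : ∑ ρ ∈ T, (m ρ : ℂ) / (0 - ρ) = ∑ ρ ∈ T, -((m ρ : ℂ) / (0 - ρ)) := by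
        refine Finset.sum_equiv (Equiv.neg ℂ) (fun ρ => ?_) fun ρ _ => ?_
        · rw [Equiv.neg_apply, hT, hT, heven]
          simp
        · rw [Equiv.neg_apply, hm, analyticOrderNatAt_neg_of_even heven]
          rw [← div_neg]
          congr 1
          ring
      rw [Finset.sum_neg_distrib] at h4
      exact self_eq_neg.1 h4
    rw [logDeriv_apply, h2, h3, zero_div, zero_add] at h1
    exact h1.symm
  have hgb : ∀ z ∈ ball (0 : ℂ) (R / 4), ‖logDeriv g z‖ ≤ 65 / R * Real.log M := by
    intro z hz
    have hev : ∀ᶠ w in 𝓝[≠] z, h w ≠ 0 := by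
      refine ((hh.analyticAt z).eventually_eq_zero_or_eventually_ne_zero).resolve_left fun h1 => ?_
      exact hh.analyticOrderAt_ne_top h0 z (analyticOrderAt_eq_top.2 h1)
    have hct : Tendsto (fun w => ‖logDeriv g w‖) (𝓝[≠] z) (𝓝 ‖logDeriv g z‖) :=
      ((hgd.continuousOn.continuousAt (isOpen_ball.mem_nhds hz)).norm.tendsto).mono_left
        nhdsWithin_le_nhds
    refine le_of_tendsto hct ?_
    filter_upwards [hev, nhdsWithin_le_nhds (isOpen_ball.mem_nhds hz)] with w hw hwb
    have h1 := (hbound w (ball_subset_closedBall hwb) hw).trans hK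
    rwa [hld w hwb hw, add_sub_cancel_left] at h1
  intro z hz hfz
  rw [hld z hz hfz, add_sub_cancel_left]
  have h1 := Complex.dist_le_div_mul_dist_of_mapsTo_ball hgd
    (R₂ := 65 / R * Real.log M) (fun w hw => by
      rw [hg0, mem_closedBall_zero_iff]; exact hgb w hw) hz
  rw [hg0, dist_zero_right, dist_zero_right] at h1
  refine h1.trans (le_of_eq ?_)
  field_simp
  ring

theorem re_logDeriv_le_of_even {h : ℂ → ℂ} (hh : Differentiable ℂ h)
    (heven : ∀ z, h (-z) = h z) (h0 : h 0 ≠ 0) (hre : ∀ ρ, h ρ = 0 → ρ.re = 0) {C : ℝ} (hC : 0 < C)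
    (hgrow : ∀ N : ℕ, 2 ≤ N → ∀ z : ℂ, ‖z‖ ≤ N →
      ‖h z‖ ≤ Real.exp (C * N * Real.log N) * ‖h 0‖) {B : ℝ}
    (hB : ∀ T : Finset ℂ, (∀ ρ ∈ T, h ρ = 0) →
      ∑ ρ ∈ T, (analyticOrderNatAt h ρ : ℝ) / √(1 / 4 + ρ.im ^ 2) ≤ B)
    {x : ℝ} (hx : 1 / 2 ≤ x) : (logDeriv h x).re ≤ B := by
  have hlim : Tendsto (fun N : ℕ => B + 260 * C * x * (Real.log N / N)) atTop
      (𝓝 (B + 260 * C * x * 0)) := by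
    have h1 := (Real.tendsto_pow_log_div_mul_add_atTop 1 0 1 one_ne_zero).comp
      (tendsto_natCast_atTop_atTop (R := ℝ))
    refine Tendsto.const_add B (Tendsto.const_mul _ (h1.congr fun N => ?_))
    simp
  rw [mul_zero, add_zero] at hlim
  refine ge_of_tendsto hlim ?_
  filter_upwards [eventually_ge_atTop 2, tendsto_natCast_atTop_atTop.eventually_gt_atTop (4 * x)]
    with N hN hNx
  have hN1 : (1 : ℝ) < N := by exact_mod_cast hN
  have hlogN : 0 < Real.log N := Real.log_pos hN1
  obtain ⟨T, hT, hTb⟩ := norm_logDeriv_sub_sum_le_of_even hh heven h0 (R := N)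
    (M := Real.exp (C * N * Real.log N)) (by positivity)
    (Real.one_lt_exp_iff.2 (by positivity)) fun z hz => hgrow N hN z (by simpa using hz)
  have hx0 : 0 < x := by linarith
  have hhx : h x ≠ 0 := fun h1 => by
    have := hre x h1
    rw [Complex.ofReal_re] at this
    linarith
  have h1 := hTb x (by
    rw [mem_ball_zero_iff, Complex.norm_real, Real.norm_of_nonneg hx0.le]; linarith) hhx
  rw [Real.log_exp, Complex.norm_real, Real.norm_of_nonneg hx0.le] at h1
  have h2 := (Complex.re_le_norm _).trans h1
  rw [Complex.sub_re, Complex.re_sum] at h2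
  have h3 : ∑ ρ ∈ T, ((analyticOrderNatAt h ρ : ℂ) / (x - ρ)).re ≤ B := by
    refine (Finset.sum_le_sum fun ρ hρ => ?_).trans (hB T hT)
    have hρ0 := hre ρ (hT ρ hρ)
    rw [div_eq_mul_inv, ← Complex.ofReal_natCast, Complex.re_ofReal_mul, Complex.inv_re,
      Complex.normSq_apply, div_eq_mul_inv _ (√_)]
    gcongr
    simp only [Complex.sub_re, Complex.ofReal_re, hρ0, sub_zero, Complex.sub_im,
      Complex.ofReal_im, zero_sub]
    have hs : √(1 / 4 + ρ.im ^ 2) ≤ √(x ^ 2 + ρ.im ^ 2) := by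
      apply Real.sqrt_le_sqrt; nlinarith
    have hs2 : x ≤ √(x ^ 2 + ρ.im ^ 2) := Real.le_sqrt_of_sq_le (by nlinarith [sq_nonneg ρ.im])
    have hs3 : √(x ^ 2 + ρ.im ^ 2) * √(x ^ 2 + ρ.im ^ 2) = x ^ 2 + ρ.im ^ 2 :=
      Real.mul_self_sqrt (by positivity)
    have hs0 : 0 < √(1 / 4 + ρ.im ^ 2) := Real.sqrt_pos.2 (by positivity)
    rw [inv_eq_one_div, div_le_div_iff₀ (by nlinarith [sq_nonneg ρ.im]) hs0]
    calc x * √(1 / 4 + ρ.im ^ 2) ≤ √(x ^ 2 + ρ.im ^ 2) * √(x ^ 2 + ρ.im ^ 2) := by gcongr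
      _ = _ := by rw [hs3]; ring
  calc (logDeriv h x).re ≤ B + 260 * (C * N * Real.log N) / (N : ℝ) ^ 2 * x := by linarith
    _ = _ := by field_simp

theorem norm_le_exp_of_re_logDeriv_le {h : ℂ → ℂ} (hh : Differentiable ℂ h) {B a : ℝ}
    (hne : ∀ x : ℝ, a ≤ x → h x ≠ 0) (hB : ∀ x : ℝ, a ≤ x → (logDeriv h x).re ≤ B) {x : ℝ}
    (hx : a ≤ x) : ‖h x‖ ≤ ‖h a‖ * Real.exp (B * (x - a)) := by
  set q : ℝ → ℝ := fun x => ‖h x‖ ^ 2 * Real.exp (-(2 * B * x)) with hq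
  have hder : ∀ x : ℝ, HasDerivAt q
      (2 * inner ℝ (h x) (deriv h x) * Real.exp (-(2 * B * x)) +
        ‖h x‖ ^ 2 * (Real.exp (-(2 * B * x)) * (-(2 * B)))) x := by
    intro x
    have h1 : HasDerivAt (fun x : ℝ => h x) (deriv h x) x := (hh x).hasDerivAt.comp_ofReal
    have h2 : HasDerivAt (fun x : ℝ => Real.exp (-(2 * B * x)))
        (Real.exp (-(2 * B * x)) * (-(2 * B))) x := by
      refine HasDerivAt.exp ?_
      simpa using ((hasDerivAt_id' x).const_mul (2 * B)).fun_neg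
    exact h1.norm_sq.mul h2
  have hanti : AntitoneOn q (Set.Ici a) := by
    refine antitoneOn_of_deriv_nonpos (convex_Ici a)
      (fun x _ => (hder x).continuousAt.continuousWithinAt)
      (fun x _ => (hder x).differentiableAt.differentiableWithinAt) fun x hx => ?_
    rw [interior_Ici] at hx
    rw [(hder x).deriv]
    have hx' : a ≤ x := le_of_lt hx
    have h1 : inner ℝ (h x) (deriv h x) = ‖h x‖ ^ 2 * (logDeriv h x).re := by
      rw [Complex.inner, logDeriv_apply, ← Complex.re_ofReal_mul]
      congr 1
      have := Complex.mul_conj (h x)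
      rw [Complex.normSq_eq_norm_sq] at this
      rw [← this]
      field_simp [hne x hx']
    rw [h1]
    have h2 := hB x hx'
    have h3 : 0 ≤ ‖h x‖ ^ 2 * Real.exp (-(2 * B * x)) := by positivity
    nlinarith
  have h1 := hanti Set.self_mem_Ici hx hx
  simp only [hq] at h1
  have h2 : ‖h x‖ ^ 2 ≤ (‖h a‖ * Real.exp (B * (x - a))) ^ 2 := by
    have e1 : (‖h a‖ * Real.exp (B * (x - a))) ^ 2 =
        ‖h a‖ ^ 2 * Real.exp (-(2 * B * a)) * Real.exp (2 * B * x) := by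
      rw [mul_pow, ← Real.exp_nat_mul, mul_assoc, ← Real.exp_add]
      congr 2
      push_cast; ring
    have e2 : ‖h x‖ ^ 2 = ‖h x‖ ^ 2 * Real.exp (-(2 * B * x)) * Real.exp (2 * B * x) := by
      rw [mul_assoc, ← Real.exp_add, neg_add_cancel, Real.exp_zero, mul_one]
    rw [e1, e2]
    gcongr
  exact (pow_le_pow_iff_left₀ (norm_nonneg _) (by positivity) two_ne_zero).1 h2

theorem isPrimitive_chiMinusFour : chiMinusFour.IsPrimitive := by
  have hne : ∀ {d : ℕ} [NeZero d], (∀ a : (ZMod d)ˣ, a = 1) → chiMinusFour.conductor ≠ d := by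
    intro d _ hd hc
    have hf := chiMinusFour.factorsThrough_conductor
    rw [hc] at hf
    obtain ⟨hdvd, χ₀, hχ₀⟩ := hf
    have h1 : χ₀ = 1 := MulChar.ext fun a => by rw [hd a]; simp
    rw [h1, DirichletCharacter.changeLevel_one] at hχ₀
    exact chiMinusFour_ne_one hχ₀
  have hdvd := chiMinusFour.conductor_dvd_level
  have hle := Nat.le_of_dvd (by norm_num) hdvd
  rw [DirichletCharacter.isPrimitive_def]
  have h1 : chiMinusFour.conductor ≠ 1 := hne (by decide)
  have h2 : chiMinusFour.conductor ≠ 2 := hne (by decide)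
  have h0 := DirichletCharacter.conductor_ne_zero chiMinusFour
  have h3 : chiMinusFour.conductor ≠ 3 := fun h => by rw [h] at hdvd; norm_num at hdvd
  omega

theorem chiMinusFour_inv : chiMinusFour⁻¹ = chiMinusFour := by
  refine MulChar.ext fun a => ?_
  rw [MulChar.inv_apply_eq_inv', chiMinusFour_apply]
  have : ∀ a : ZMod 4, ZMod.χ₄ a = 0 ∨ ZMod.χ₄ a = 1 ∨ ZMod.χ₄ a = -1 := by decide
  rcases this a with h | h | h <;> simp [h]

theorem chiMinusFour_odd : chiMinusFour.Odd := by
  rw [DirichletCharacter.Odd, chiMinusFour_apply, show ZMod.χ₄ (-1) = -1 by decide]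
  simp

/-- The completed `L`-function of `χ₋₄`, recentred at the central point and normalised so that the
functional equation says that it is even. -/
noncomputable def centredXi (z : ℂ) : ℂ :=
  2 ^ z * DirichletCharacter.completedLFunction chiMinusFour (1 / 2 + z)

theorem differentiable_centredXi : Differentiable ℂ centredXi := by
  have h1 := DirichletCharacter.differentiable_completedLFunction chiMinusFour_ne_one
  have h2 : Differentiable ℂ fun z : ℂ => (2 : ℂ) ^ z := fun z =>
    DifferentiableAt.const_cpow differentiableAt_id (Or.inl two_ne_zero)
  exact h2.mul (h1.comp (by fun_prop))

theorem centredXi_eq {z : ℂ} (hz : 0 ≤ z.re) :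
    centredXi z = 2 ^ z * (Complex.Gammaℝ (3 / 2 + z) *
      DirichletCharacter.LFunction chiMinusFour (1 / 2 + z)) := by
  have hne : Complex.Gammaℝ (1 / 2 + z + 1) ≠ 0 := Complex.Gammaℝ_ne_zero_of_re_pos (by
    simp; linarith)
  rw [DirichletCharacter.LFunction_eq_completed_div_gammaFactor _ _ (Or.inr (by norm_num)),
    chiMinusFour_odd.gammaFactor_def, show (3 / 2 + z : ℂ) = 1 / 2 + z + 1 by ring,
    mul_div_cancel₀ _ hne, centredXi]

theorem centredXi_eq_zero_iff {z : ℂ} (hz : 0 ≤ z.re) :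
    centredXi z = 0 ↔ DirichletCharacter.LFunction chiMinusFour (1 / 2 + z) = 0 := by
  have hne : Complex.Gammaℝ (3 / 2 + z) ≠ 0 := Complex.Gammaℝ_ne_zero_of_re_pos (by
    simp; linarith)
  have h2 : (2 : ℂ) ^ z ≠ 0 := by simp [Complex.cpow_eq_zero_iff]
  rw [centredXi_eq hz]
  simp [hne, h2]

theorem centredXi_neg (h0 : DirichletCharacter.LFunction chiMinusFour (1 / 2) ≠ 0) (z : ℂ) :
    centredXi (-z) = centredXi z := by
  have hfe : ∀ z, centredXi (-z) = DirichletCharacter.rootNumber chiMinusFour * centredXi z := by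
    intro z
    have h1 := DirichletCharacter.IsPrimitive.completedLFunction_one_sub isPrimitive_chiMinusFour
      (1 / 2 + z)
    rw [chiMinusFour_inv, show (1 - (1 / 2 + z) : ℂ) = 1 / 2 + -z by ring,
      show (1 / 2 + z - 1 / 2 : ℂ) = z by ring] at h1
    have h4 : ((4 : ℕ) : ℂ) ^ z = 2 ^ z * 2 ^ z := by
      have := Complex.natCast_mul_natCast_cpow 2 2 z
      norm_num at this ⊢
      exact this
    have h2 : (2 : ℂ) ^ (-z) * 2 ^ z = 1 := by
      rw [← Complex.cpow_add _ _ two_ne_zero]; simp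
    rw [centredXi, h1, h4, centredXi]
    linear_combination (2 ^ z * DirichletCharacter.rootNumber chiMinusFour *
      DirichletCharacter.completedLFunction chiMinusFour (1 / 2 + z)) * h2
  have hne : centredXi 0 ≠ 0 := by
    rw [Ne, centredXi_eq_zero_iff (by simp)]
    simpa using h0
  have h1 := hfe 0
  rw [neg_zero] at h1
  rw [hfe, (right_eq_mul₀ hne).1 h1, one_mul]

theorem RHChi.centredXi_re_eq_zero (h : RHChi)
    (h0 : DirichletCharacter.LFunction chiMinusFour (1 / 2) ≠ 0) {z : ℂ} (hz : centredXi z = 0) :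
    z.re = 0 := by
  have key : ∀ w : ℂ, 0 ≤ w.re → centredXi w = 0 → w.re = 0 := by
    intro w hw h1
    have := h.re_eq ((centredXi_eq_zero_iff hw).1 h1) (by simp; linarith)
    simp at this
    exact this
  rcases le_total 0 z.re with h1 | h1
  · exact key z h1 hz
  · have := key (-z) (by simpa using h1) (by rwa [centredXi_neg h0])
    simpa using this

theorem analyticOrderNatAt_centredXi {z : ℂ} (hz : 0 ≤ z.re) :
    analyticOrderNatAt centredXi z =
      analyticOrderNatAt (DirichletCharacter.LFunction chiMinusFour) (1 / 2 + z) := by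
  set L := DirichletCharacter.LFunction chiMinusFour
  have hL : Differentiable ℂ L := DirichletCharacter.differentiable_LFunction chiMinusFour_ne_one
  have hxi := differentiable_centredXi
  have h2 : Differentiable ℂ fun z : ℂ => (2 : ℂ) ^ (-z) := fun z =>
    DifferentiableAt.const_cpow (by fun_prop) (Or.inl two_ne_zero)
  have hG : Differentiable ℂ fun z : ℂ => (Complex.Gammaℝ (3 / 2 + z))⁻¹ :=
    Complex.differentiable_Gammaℝ_inv.comp (by fun_prop : Differentiable ℂ fun z : ℂ => 3 / 2 + z)
  have hne : ∀ z : ℂ, -1 < z.re → Complex.Gammaℝ (3 / 2 + z) ≠ 0 := fun z hz =>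
    Complex.Gammaℝ_ne_zero_of_re_pos (by simp; linarith)
  have hfac : (fun z => L (1 / 2 + z)) = centredXi * fun z : ℂ =>
      (2 : ℂ) ^ (-z) * (Complex.Gammaℝ (3 / 2 + z))⁻¹ := by
    funext w
    have hc : (2 : ℂ) ^ w * 2 ^ (-w) = 1 := by
      rw [← Complex.cpow_add _ _ two_ne_zero]; simp
    simp only [L, Pi.mul_apply, centredXi]
    rw [DirichletCharacter.LFunction_eq_completed_div_gammaFactor _ _ (Or.inr (by norm_num)),
      chiMinusFour_odd.gammaFactor_def, show (3 / 2 + w : ℂ) = 1 / 2 + w + 1 by ring,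
      div_eq_mul_inv]
    linear_combination -(DirichletCharacter.completedLFunction chiMinusFour (1 / 2 + w) *
      (Complex.Gammaℝ (1 / 2 + w + 1))⁻¹) * hc
  have h3 := analyticOrderAt_comp_of_deriv_ne_zero (f := L) (g := fun z : ℂ => 1 / 2 + z) (z₀ := z)
    (by fun_prop) (by simp)
  rw [analyticOrderNatAt, analyticOrderNatAt, ← h3]
  congr 1
  change _ = analyticOrderAt (fun z => L (1 / 2 + z)) z
  rw [hfac, analyticOrderAt_mul (hxi.analyticAt z) ((h2.fun_mul hG).analyticAt z),
    ((h2.fun_mul hG).analyticAt z).analyticOrderAt_eq_zero.2, add_zero]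
  exact mul_ne_zero (by simp [Complex.cpow_eq_zero_iff]) (inv_ne_zero (hne z (by linarith)))

theorem Complex.norm_Gamma_le_Gamma_re {s : ℂ} (hs : 0 < s.re) :
    ‖Complex.Gamma s‖ ≤ Real.Gamma s.re := by
  rw [Complex.Gamma_eq_integral hs, Real.Gamma_eq_integral hs, Complex.GammaIntegral]
  refine (norm_integral_le_integral_norm _).trans (le_of_eq ?_)
  refine setIntegral_congr_fun measurableSet_Ioi fun x hx => ?_
  simp only [norm_mul, Complex.norm_real, Real.norm_eq_abs, Real.abs_exp]
  rw [Complex.norm_cpow_eq_rpow_re_of_pos hx]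
  simp

theorem norm_Gammaℝ_eq (s : ℂ) :
    ‖Complex.Gammaℝ s‖ = Real.pi ^ (-(s.re / 2)) * ‖Complex.Gamma (s / 2)‖ := by
  rw [Complex.Gammaℝ_def, norm_mul, Complex.norm_cpow_eq_rpow_re_of_pos Real.pi_pos]
  congr 2
  simp [neg_div]

theorem norm_centredXi_le {N : ℕ} (hN : 2 ≤ N) {z : ℂ} (hz : 0 ≤ z.re) (hzN : ‖z‖ ≤ N) :
    ‖centredXi z‖ ≤ max (Real.Gamma (3 / 4)) 1 * (N : ℝ) ^ (2 * N + 3) := by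
  have hN2 : (2 : ℝ) ≤ N := by exact_mod_cast hN
  have hre : z.re ≤ N := (Complex.re_le_norm z).trans hzN
  set K := max (Real.Gamma (3 / 4)) 1
  have hK : 1 ≤ K := le_max_right _ _
  have hG : ‖Complex.Gammaℝ (3 / 2 + z)‖ ≤ K * (N : ℝ) ^ N := by
    rw [norm_Gammaℝ_eq]
    have h1 : Real.pi ^ (-((3 / 2 + z).re / 2)) ≤ 1 :=
      Real.rpow_le_one_of_one_le_of_nonpos (by linarith [Real.pi_gt_three]) (by simp; linarith)
    have e1 : ((3 / 2 + z) / 2).re = 3 / 4 + z.re / 2 := by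
      rw [show (3 / 2 + z) / 2 = ((1 / 2 : ℝ) : ℂ) * (((3 / 2 : ℝ) : ℂ) + z) by push_cast; ring,
        Complex.re_ofReal_mul, Complex.add_re, Complex.ofReal_re]
      ring
    have h2 : ‖Complex.Gamma ((3 / 2 + z) / 2)‖ ≤ K * (N : ℝ) ^ N := by
      refine (Complex.norm_Gamma_le_Gamma_re (by rw [e1]; linarith)).trans ?_
      rw [e1]
      have h3 := Real.convexOn_Gamma.le_max_of_mem_Icc (x := (3 / 4 : ℝ)) (y := (N + 1 : ℝ))
        (z := 3 / 4 + z.re / 2) (by norm_num [Set.mem_Ioi]) (by rw [Set.mem_Ioi]; positivity)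
        ⟨by linarith, by linarith⟩
      refine h3.trans (max_le ?_ ?_)
      · exact (le_max_left _ _).trans (le_mul_of_one_le_right (by linarith)
          (one_le_pow₀ (by linarith)))
      · rw [Real.Gamma_nat_eq_factorial]
        calc (N.factorial : ℝ) ≤ (N : ℝ) ^ N := by exact_mod_cast N.factorial_le_pow
          _ ≤ _ := le_mul_of_one_le_left (by positivity) hK
    calc _ ≤ 1 * (K * (N : ℝ) ^ N) := by gcongr
      _ = _ := one_mul _
  have h2 : ‖(2 : ℂ) ^ z‖ ≤ (N : ℝ) ^ N := by
    rw [show (2 : ℂ) = ((2 : ℝ) : ℂ) by simp, Complex.norm_cpow_eq_rpow_re_of_pos two_pos]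
    calc (2 : ℝ) ^ z.re ≤ 2 ^ (N : ℝ) := Real.rpow_le_rpow_of_exponent_le one_le_two hre
      _ = 2 ^ N := Real.rpow_natCast _ _
      _ ≤ _ := by gcongr
  have hL : ‖DirichletCharacter.LFunction chiMinusFour (1 / 2 + z)‖ ≤ (N : ℝ) ^ 3 := by
    have hre' : (1 / 2 + z).re = 1 / 2 + z.re := by simp
    refine (norm_LFunction_chiMinusFour_le (by rw [hre']; linarith)).trans ?_
    rw [hre', div_le_iff₀ (by linarith)]
    have h3 : ‖(1 / 2 + z : ℂ)‖ ≤ 1 / 2 + N := by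
      refine (norm_add_le _ _).trans ?_
      norm_num
      exact hzN
    have h4 : (1 / 2 + N : ℝ) ≤ (N : ℝ) ^ 3 * (1 / 2) := by nlinarith [sq_nonneg ((N : ℝ) - 2)]
    have h5 : 0 ≤ (N : ℝ) ^ 3 * z.re := by positivity
    linarith
  rw [centredXi_eq hz, norm_mul, norm_mul]
  calc _ ≤ (N : ℝ) ^ N * (K * (N : ℝ) ^ N * (N : ℝ) ^ 3) := by gcongr
    _ = _ := by ring

theorem exists_norm_centredXi_le (h0 : DirichletCharacter.LFunction chiMinusFour (1 / 2) ≠ 0) :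
    ∃ C > 0, ∀ N : ℕ, 2 ≤ N → ∀ z : ℂ, ‖z‖ ≤ N →
      ‖centredXi z‖ ≤ Real.exp (C * N * Real.log N) * ‖centredXi 0‖ := by
  have hne : centredXi 0 ≠ 0 := by
    rw [Ne, centredXi_eq_zero_iff (by simp)]
    simpa using h0
  have hpos : 0 < ‖centredXi 0‖ := norm_pos_iff.2 hne
  set K := max (Real.Gamma (3 / 4)) 1
  have hK : 0 < K := lt_of_lt_of_le one_pos (le_max_right _ _)
  set A := |Real.log (K / ‖centredXi 0‖)|
  refine ⟨A + 5, by positivity, fun N hN z hz => ?_⟩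
  have hN2 : (2 : ℝ) ≤ N := by exact_mod_cast hN
  have hN0 : (0 : ℝ) < N := by linarith
  have h1 : ‖centredXi z‖ ≤ K * (N : ℝ) ^ (2 * N + 3) := by
    rcases le_total 0 z.re with h | h
    · exact norm_centredXi_le hN h hz
    · rw [← centredXi_neg h0]
      exact norm_centredXi_le hN (by simpa using h) (by simpa using hz)
  have hlog : 2 / 3 ≤ Real.log N := by
    have := Real.log_le_log two_pos hN2
    linarith [Real.log_two_gt_d9]
  have hNl : 1 ≤ N * Real.log N := by nlinarith
  have h2 : K = Real.exp (Real.log (K / ‖centredXi 0‖)) * ‖centredXi 0‖ := by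
    rw [Real.exp_log (by positivity)]; field_simp
  have h3 : (N : ℝ) ^ (2 * N + 3) = Real.exp ((2 * N + 3) * Real.log N) := by
    rw [← Real.rpow_natCast, Real.rpow_def_of_pos hN0]
    push_cast; ring_nf
  refine h1.trans ?_
  rw [h3]
  calc K * Real.exp ((2 * N + 3) * Real.log N)
      = Real.exp (Real.log (K / ‖centredXi 0‖) + (2 * N + 3) * Real.log N) * ‖centredXi 0‖ := by
        rw [Real.exp_add]
        nth_rw 1 [h2]
        ring
    _ ≤ _ := by
        gcongr
        have h4 : Real.log (K / ‖centredXi 0‖) ≤ A := le_abs_self _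
        have h5 : A ≤ A * (N * Real.log N) := le_mul_of_one_le_right (abs_nonneg _) hNl
        nlinarith

theorem exists_le_norm_centredXi : ∃ c > 0, ∀ n : ℕ, 1 ≤ n →
    c * (n.factorial : ℝ) / Real.pi ^ (n + 1) ≤ ‖centredXi ((2 * n + 1 / 2 : ℝ) : ℂ)‖ := by
  obtain ⟨c, hc, hlow⟩ := exists_le_norm_LFunction_chiMinusFour
  refine ⟨c, hc, fun n hn => ?_⟩
  have hn1 : (1 : ℝ) ≤ n := by exact_mod_cast hn
  rw [centredXi_eq (by rw [Complex.ofReal_re]; positivity), norm_mul, norm_mul, norm_Gammaℝ_eq]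
  have e1 : (3 / 2 + ((2 * n + 1 / 2 : ℝ) : ℂ)) = ((2 * (n + 1) : ℝ) : ℂ) := by push_cast; ring
  have e2 : ((2 * (n + 1) : ℝ) : ℂ) / 2 = (n : ℂ) + 1 := by push_cast; ring
  have e3 : Real.pi ^ (-((((2 * (n + 1) : ℝ) : ℂ)).re / 2)) = (Real.pi ^ (n + 1))⁻¹ := by
    rw [Complex.ofReal_re, Real.rpow_neg Real.pi_pos.le, ← Real.rpow_natCast]
    congr 2
    push_cast; ring
  rw [e1, e2, e3, Complex.Gamma_nat_eq_factorial, Complex.norm_natCast]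
  have h2 : 1 ≤ ‖(2 : ℂ) ^ ((2 * n + 1 / 2 : ℝ) : ℂ)‖ := by
    rw [show (2 : ℂ) = ((2 : ℝ) : ℂ) by simp, Complex.norm_cpow_eq_rpow_re_of_pos two_pos]
    exact Real.one_le_rpow one_le_two (by rw [Complex.ofReal_re]; positivity)
  have h3 := hlow (1 / 2 + ((2 * n + 1 / 2 : ℝ) : ℂ)) (by
    rw [Complex.add_re, Complex.ofReal_re]; norm_num; linarith)
  have hpi := Real.pi_pos
  calc _ = 1 * ((Real.pi ^ (n + 1))⁻¹ * n.factorial * c) := by field_simp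
    _ ≤ _ := by gcongr

theorem norm_raceCoeff (γ : ℝ) : ‖raceCoeff γ‖ =
    ((analyticOrderNatAt centredXi (γ * Complex.I) : ℝ) +
      analyticOrderNatAt centredXi (-(γ * Complex.I))) / √(1 / 4 + γ ^ 2) := by
  rw [analyticOrderNatAt_centredXi (by simp), analyticOrderNatAt_centredXi (by simp),
    ← sub_eq_add_neg, raceCoeff, norm_div]
  congr 1
  · rw [← Nat.cast_add, ← Nat.cast_add, Complex.norm_natCast]
  · rw [Complex.norm_eq_sqrt_sq_add_sq]
    norm_num

theorem RHChi.sum_centredXi_le (h : RHChi)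
    (h0 : DirichletCharacter.LFunction chiMinusFour (1 / 2) ≠ 0) {B : ℝ}
    (hB : ∀ T : Finset ℝ, ↑T ⊆ chiOrdinates → ∑ γ ∈ T, ‖raceCoeff γ‖ ≤ B) (T : Finset ℂ)
    (hT : ∀ ρ ∈ T, centredXi ρ = 0) :
    ∑ ρ ∈ T, (analyticOrderNatAt centredXi ρ : ℝ) / √(1 / 4 + ρ.im ^ 2) ≤ B := by
  classical
  obtain ⟨S, hS⟩ : ∃ S : Finset ℝ, S = T.image fun ρ => |ρ.im| := ⟨_, rfl⟩
  have hform : ∀ ρ ∈ T, ρ = |ρ.im| * Complex.I ∨ ρ = -(|ρ.im| * Complex.I) := by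
    intro ρ hρ
    have hre := h.centredXi_re_eq_zero h0 (hT ρ hρ)
    rcases abs_cases ρ.im with ⟨h1, -⟩ | ⟨h1, -⟩
    · left; rw [h1]; apply Complex.ext <;> simp [hre]
    · right; rw [h1]; apply Complex.ext <;> simp [hre]
  have hSsub : ↑S ⊆ chiOrdinates := by
    intro γ hγ
    rw [Finset.mem_coe, hS, Finset.mem_image] at hγ
    obtain ⟨ρ, hρ, rfl⟩ := hγ
    have hz : centredXi (|ρ.im| * Complex.I) = 0 := by
      rcases hform ρ hρ with h1 | h1
      · rw [← h1]; exact hT ρ hρ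
      · rw [← centredXi_neg h0, ← h1]; exact hT ρ hρ
    rw [centredXi_eq_zero_iff (by simp)] at hz
    refine ⟨abs_pos.2 fun h1 => h0 ?_, hz⟩
    rw [h1] at hz
    simpa using hz
  refine le_trans ?_ (hB S hSsub)
  set f : ℂ → ℝ := fun ρ => (analyticOrderNatAt centredXi ρ : ℝ) / √(1 / 4 + ρ.im ^ 2) with hf
  have hf0 : ∀ ρ, 0 ≤ f ρ := fun ρ => by positivity
  set P := S.image fun γ : ℝ => (γ : ℂ) * Complex.I
  set Q := S.image fun γ : ℝ => -((γ : ℂ) * Complex.I)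
  have hsub : T ⊆ P ∪ Q := by
    intro ρ hρ
    have hm : |ρ.im| ∈ S := hS ▸ Finset.mem_image_of_mem _ hρ
    rw [Finset.mem_union, Finset.mem_image, Finset.mem_image]
    rcases hform ρ hρ with h1 | h1
    · exact Or.inl ⟨_, hm, h1.symm⟩
    · exact Or.inr ⟨_, hm, h1.symm⟩
  calc ∑ ρ ∈ T, f ρ ≤ ∑ ρ ∈ P ∪ Q, f ρ :=
        Finset.sum_le_sum_of_subset_of_nonneg hsub fun ρ _ _ => hf0 ρ
    _ ≤ ∑ ρ ∈ P, f ρ + ∑ ρ ∈ Q, f ρ := by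
        rw [← Finset.sum_union_inter]
        exact le_add_of_nonneg_right (Finset.sum_nonneg fun ρ _ => hf0 ρ)
    _ = ∑ γ ∈ S, ‖raceCoeff γ‖ := by
        rw [Finset.sum_image (by intro a _ b _ hab; simpa using hab),
          Finset.sum_image (by intro a _ b _ hab; simpa using hab), ← Finset.sum_add_distrib]
        refine Finset.sum_congr rfl fun γ _ => ?_
        rw [norm_raceCoeff, add_div]
        simp [hf]

/-- The sum of the sizes of the oscillating terms diverges. -/
theorem RHChi.exists_le_sum_norm_raceCoeff (h : RHChi)
    (h0 : DirichletCharacter.LFunction chiMinusFour (1 / 2) ≠ 0) (B : ℝ) :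
    ∃ T : Finset ℝ, ↑T ⊆ chiOrdinates ∧ B ≤ ∑ γ ∈ T, ‖raceCoeff γ‖ := by
  by_contra! hcon
  obtain ⟨C, hC, hgrow⟩ := exists_norm_centredXi_le h0
  have hne : centredXi 0 ≠ 0 := by
    rw [Ne, centredXi_eq_zero_iff (by simp)]
    simpa using h0
  have hsum := h.sum_centredXi_le h0 (B := B) fun T hT => (hcon T hT).le
  have hne' : ∀ x : ℝ, 1 / 2 ≤ x → centredXi x ≠ 0 := fun x hx h1 => by
    have := h.centredXi_re_eq_zero h0 h1
    rw [Complex.ofReal_re] at this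
    linarith
  have hexp : ∀ x : ℝ, 1 / 2 ≤ x →
      ‖centredXi x‖ ≤ ‖centredXi (1 / 2 : ℝ)‖ * Real.exp (B * (x - 1 / 2)) := fun x hx =>
    norm_le_exp_of_re_logDeriv_le differentiable_centredXi hne' (fun y hy =>
      re_logDeriv_le_of_even differentiable_centredXi (centredXi_neg h0) hne
        (fun ρ hρ => h.centredXi_re_eq_zero h0 hρ) hC hgrow hsum hy) hx
  obtain ⟨c, hc, hlow⟩ := exists_le_norm_centredXi
  set A := ‖centredXi (1 / 2 : ℝ)‖
  have hA : 0 < A := norm_pos_iff.2 (hne' _ le_rfl)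
  have hpi := Real.pi_pos
  have hlim := FloorSemiring.tendsto_pow_div_factorial_atTop (Real.pi * Real.exp (2 * B))
  have hev := hlim.eventually_lt_const (show 0 < c / (Real.pi * A) by positivity)
  obtain ⟨n, hn, hn1⟩ := (hev.and (eventually_ge_atTop 1)).exists
  have h1 := (hlow n hn1).trans (hexp (2 * n + 1 / 2) (by linarith [n.cast_nonneg (α := ℝ)]))
  have h2 : Real.exp (B * (2 * n + 1 / 2 - 1 / 2)) = Real.exp (2 * B) ^ n := by
    rw [← Real.exp_nat_mul]; congr 1; ring
  rw [h2, div_le_iff₀ (by positivity)] at h1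
  have hfac : (0 : ℝ) < n.factorial := by positivity
  rw [div_lt_div_iff₀ hfac (by positivity), mul_pow] at hn
  rw [pow_succ] at h1
  nlinarith

theorem raceFunction_log_pos_iff {t : ℝ} (ht : 1 < t) :
    0 < raceFunction (Real.log t) ↔ primePiMod t 4 1 < primePiMod t 4 3 := by
  have hl : 0 < Real.log t * Real.exp (-(Real.log t / 2)) :=
    mul_pos (Real.log_pos ht) (Real.exp_pos _)
  rw [raceFunction, Real.exp_log (by linarith), ← mul_neg, mul_pos_iff_of_pos_left hl,
    ← primePiMod_sub_primePiMod, sub_pos, Nat.cast_lt]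

theorem setIntegral_race_eq {X : ℝ} (hX : 2 ≤ X) :
    ∫ t in {t : ℝ | 2 ≤ t ∧ t ≤ X ∧ primePiMod t 4 3 > primePiMod t 4 1}, 1 / t =
      volume.real ({u | 0 < raceFunction u} ∩ Set.Ioc (Real.log 2) (Real.log X)) := by
  have hA : MeasurableSet {u | 0 < raceFunction u} :=
    measurableSet_lt measurable_const measurable_raceFunction
  have hE : MeasurableSet {t : ℝ | 0 < raceFunction (Real.log t)} := Real.measurable_log hA
  have hset : {t : ℝ | 2 ≤ t ∧ t ≤ X ∧ primePiMod t 4 3 > primePiMod t 4 1} =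
      {t : ℝ | 0 < raceFunction (Real.log t)} ∩ Set.Icc 2 X := by
    ext t
    simp only [Set.mem_ofPred_eq, Set.mem_inter_iff, Set.mem_Icc]
    constructor
    · rintro ⟨h1, h2, h3⟩
      exact ⟨(raceFunction_log_pos_iff (by linarith)).2 h3, h1, h2⟩
    · rintro ⟨h3, h1, h2⟩
      exact ⟨h1, h2, (raceFunction_log_pos_iff (by linarith)).1 h3⟩
  have hmeas : Measurable fun t : ℝ => 1 / t := by fun_prop
  rw [hset, setIntegral_congr_set
    ((ae_eq_refl {t : ℝ | 0 < raceFunction (Real.log t)}).inter Ioc_ae_eq_Icc.symm),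
    integral_eq_lintegral_of_nonneg_ae _ hmeas.aestronglyMeasurable, Measure.real]
  · congr 1
    rw [← Measure.restrict_restrict hE, ← lintegral_indicator hE]
    have h1 := lintegral_Ioc_exp ({t : ℝ | 0 < raceFunction (Real.log t)}.indicator
      fun t => ENNReal.ofReal (1 / t)) (Real.log 2) (Real.log X)
    rw [Real.exp_log two_pos, Real.exp_log (by linarith)] at h1
    rw [h1, ← Measure.restrict_apply hA, ← lintegral_indicator_one hA]
    refine lintegral_congr fun v => ?_
    simp only [Set.indicator_apply, Set.mem_ofPred_eq, Real.log_exp, Pi.one_apply]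
    split_ifs
    · rw [← ENNReal.ofReal_mul (Real.exp_pos v).le, mul_one_div_cancel (Real.exp_pos v).ne',
        ENNReal.ofReal_one]
    · rw [mul_zero]
  · refine (ae_restrict_iff' (hE.inter measurableSet_Ioc)).2 (ae_of_all _ fun t ht => ?_)
    have : 0 < t := by linarith [ht.2.1]
    simp only [Pi.zero_apply]
    positivity

theorem tendsto_race_of_density {δ : ℝ}
    (hδ : Tendsto (fun U => volume.real ({u | 0 < raceFunction u} ∩ Set.Ioc 0 U) / U) atTop
      (𝓝 δ)) :
    Tendsto (fun X : ℝ => (1 / Real.log X) *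
      ∫ t in {t : ℝ | 2 ≤ t ∧ t ≤ X ∧ primePiMod t 4 3 > primePiMod t 4 1}, 1 / t) atTop (𝓝 δ) := by
  have h1 := hδ.comp Real.tendsto_log_atTop
  have h2 : Tendsto (fun X : ℝ =>
      volume.real ({u | 0 < raceFunction u} ∩ Set.Ioc 0 (Real.log 2)) / Real.log X) atTop (𝓝 0) :=
    Real.tendsto_log_atTop.const_div_atTop _
  have h3 := h1.sub h2
  rw [sub_zero] at h3
  refine h3.congr' ?_
  filter_upwards [eventually_ge_atTop 2] with X hX
  have hA : MeasurableSet {u | 0 < raceFunction u} :=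
    measurableSet_lt measurable_const measurable_raceFunction
  have hlog : Real.log 2 ≤ Real.log X := Real.log_le_log two_pos hX
  have hfin : ∀ a b : ℝ, volume ({u | 0 < raceFunction u} ∩ Set.Ioc a b) ≠ ⊤ := fun a b =>
    ((measure_mono Set.inter_subset_right).trans_lt measure_Ioc_lt_top).ne
  have h4 : volume.real ({u | 0 < raceFunction u} ∩ Set.Ioc 0 (Real.log X)) =
      volume.real ({u | 0 < raceFunction u} ∩ Set.Ioc 0 (Real.log 2)) +
      volume.real ({u | 0 < raceFunction u} ∩ Set.Ioc (Real.log 2) (Real.log X)) := by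
    rw [← Set.Ioc_union_Ioc_eq_Ioc (Real.log_nonneg one_le_two) hlog, Set.inter_union_distrib_left]
    refine measureReal_union ?_ (hA.inter measurableSet_Ioc) (hfin _ _) (hfin _ _)
    exact ((Set.Ioc_disjoint_Ioc_of_le le_rfl)).mono Set.inter_subset_right Set.inter_subset_right
  rw [setIntegral_race_eq hX, Function.comp_apply, h4]
  ring

theorem chiOrdinates_subset_jointOrdinates : chiOrdinates ⊆ jointOrdinates := by
  rintro γ ⟨hγ, hz⟩
  refine ⟨hγ.le, 1 / 2 + γ * Complex.I, Or.inr hz, ?_⟩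
  norm_num

/-- Assuming GRH for `ζ` and `L(s, χ₋₄)` and linear independence over `ℚ` of the
nonnegative imaginary parts of their nontrivial zeros, the logarithmic density `δ` of the
set of `x` with `π(x;4,3) > π(x;4,1)` exists and satisfies `1/2 < δ < 1`
(Rubinstein–Sarnak). -/
theorem logDensity_mod_four_race
    (RHzeta : ∀ ρ : ℂ, riemannZeta ρ = 0 → 0 < ρ.re → ρ.re < 1 → ρ.re = 1 / 2)
    (RHL : ∀ ρ : ℂ, DirichletCharacter.LFunction chiMinusFour ρ = 0 →
      0 < ρ.re → ρ.re < 1 → ρ.re = 1 / 2)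
    (LI : LinearIndependent ℚ (fun t : jointOrdinates => (t : ℝ))) :
    ∃ δ : ℝ,
      Tendsto (fun X : ℝ =>
          (1 / Real.log X) *
            ∫ t in {t : ℝ | 2 ≤ t ∧ t ≤ X ∧ primePiMod t 4 3 > primePiMod t 4 1}, 1 / t)
        atTop (nhds δ) ∧ 1 / 2 < δ ∧ δ < 1 := by
  have hχ : RHChi := RHL
  have hζ : RHZeta := RHzeta
  have h0 : DirichletCharacter.LFunction chiMinusFour (1 / 2) ≠ 0 := fun h =>
    LI.ne_zero ⟨0, le_rfl, 1 / 2, Or.inr h, by norm_num, by norm_num, by simp⟩ rfl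
  have hΓ : LinearIndependent ℚ fun γ : chiOrdinates => (γ : ℝ) :=
    LI.comp (Set.inclusion chiOrdinates_subset_jointOrdinates) (Set.inclusion_injective _)
  obtain ⟨δ, hδ, hlow, hup⟩ := exists_density measurable_raceFunction hΓ
    (fun ε hε => exists_meanSquareLE_ordinates hχ hζ h0 hε) (hχ.exists_le_sum_norm_raceCoeff h0)
  exact ⟨δ, tendsto_race_of_density hδ, hlow, hup⟩
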